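/- Let d≥2, β≥-1/2, γ>-1 and δ>β+γ+(d+2)/2. Then for every continuous function f on 𝕍₀^{d+1}, sup_{ξ∈𝕊^{d-1}} |S_n^δ(ϖ_{β,γ};f,(ξ,1)) − f(ξ,1)| → 0 as n→∞; that is, the Cesàro (C,δ) means of the Fourier orthogonal series of f converge to f uniformly on the boundary circle t=1 of the surface of the paraboloid. -/

import Mathlib

open MeasureTheory Real Filter Set
open scoped RealInnerProductSpace ENNReal

noncomputable section

/-- Pochhammer symbol `(a)_n = a(a+1)⋯(a+n-1)`. -/
def poch (a : ℝ) (n : ℕ) : ℝ := ∏ i ∈ Finset.range n, (a + i)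

/-- Jacobi polynomial `P_n^{(a,b)}(t)` via its hypergeometric expansion. -/
def jacobiP (n : ℕ) (a b : ℝ) (t : ℝ) : ℝ :=
  (poch (a + 1) n / (n.factorial : ℝ)) *
    ∑ j ∈ Finset.range (n + 1),
      (poch (-(n : ℝ)) j * poch ((n : ℝ) + a + b + 1) j) /
        (poch (a + 1) j * (j.factorial : ℝ)) * ((1 - t) / 2) ^ j

/-- Squared norm `h_n^{(a,b)}` of the Jacobi polynomials. -/
def hJ (n : ℕ) (a b : ℝ) : ℝ :=
  (poch (a + 1) n * poch (b + 1) n * (a + b + (n : ℝ) + 1)) /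
    ((n.factorial : ℝ) * poch (a + b + 2) n * (a + b + 2 * (n : ℝ) + 1))

/-- Normalization constant `c_{a,b}` of the Jacobi weight. -/
def cJ (a b : ℝ) : ℝ := Real.Gamma (a + b + 2) / (Real.Gamma (a + 1) * Real.Gamma (b + 1))

/-- Generalized binomial coefficient `C(n+δ, n) = (δ+1)_n/n!`. -/
def binomC (δ : ℝ) (n : ℕ) : ℝ := poch (δ + 1) n / (n.factorial : ℝ)

/-- The parabolic domain `𝕌 = {(x₁,x₂) : x₁² ≤ x₂ ≤ 1}`. -/
def Udom : Set (ℝ × ℝ) := {x | x.1 ^ 2 ≤ x.2 ∧ x.2 ≤ 1}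

/-- The curved part `𝕌₀` of the boundary of `𝕌`. -/
def Udom0 : Set (ℝ × ℝ) := {x ∈ Udom | x.2 = x.1 ^ 2}

/-- The weight `U_{a,b}` on the parabolic domain. -/
def Uw (a b : ℝ) (x : ℝ × ℝ) : ℝ := (1 - x.2) ^ a * (x.2 - x.1 ^ 2) ^ (b - 1/2)

/-- Normalization constant `d_{a,b}` of `U_{a,b}`. -/
def dU (a b : ℝ) : ℝ := (∫ x in Udom, Uw a b x)⁻¹

/-- The weighted measure `U_{a,b}(x) dx` on `𝕌`. -/
def μU (a b : ℝ) : Measure (ℝ × ℝ) :=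
  (volume.restrict Udom).withDensity fun x => ENNReal.ofReal (Uw a b x)

/-- The orthogonal basis `P_{k,n}^{a,b}` on the parabolic domain (with the continuous
extension to `x₂ = 0`, where in Lean `x₁/√x₂ = 0` and `(√x₂)^k = 0` for `k ≥ 1`). -/
def PknU (a b : ℝ) (k n : ℕ) (x : ℝ × ℝ) : ℝ :=
  jacobiP (n - k) (b + (k : ℝ)) a (1 - 2 * x.2) * (Real.sqrt x.2) ^ k *
    jacobiP k (b - 1/2) (b - 1/2) (x.1 / Real.sqrt x.2)

/-- Squared norms `h_{k,n}^{a,b}`. -/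
def hknU (a b : ℝ) (k n : ℕ) : ℝ :=
  (cJ b a / cJ (b + (k : ℝ)) a) * hJ (n - k) (b + (k : ℝ)) a * hJ k (b - 1/2) (b - 1/2)

/-- Reproducing kernel `P_n(U_{a,b}; x, y)` on the parabolic domain. -/
def PnU (a b : ℝ) (n : ℕ) (x y : ℝ × ℝ) : ℝ :=
  ∑ k ∈ Finset.range (n + 1), PknU a b k n x * PknU a b k n y / hknU a b k n

/-- Partial-sum kernel `K_n(U_{a,b}; x, y)`. -/
def KnU (a b : ℝ) (n : ℕ) (x y : ℝ × ℝ) : ℝ :=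
  ∑ m ∈ Finset.range (n + 1), PnU a b m x y

/-- Cesàro `(C,δ)` kernel `K_n^δ(U_{a,b}; x, y)`. -/
def KnUCes (a b δ : ℝ) (n : ℕ) (x y : ℝ × ℝ) : ℝ :=
  (binomC δ n)⁻¹ * ∑ m ∈ Finset.range (n + 1), binomC (δ - 1) (n - m) * KnU a b m x y

/-- Cesàro `(C,δ)` means `S_n^δ(U_{a,b}; f, x)`. -/
def SnUCes (a b δ : ℝ) (n : ℕ) (f : ℝ × ℝ → ℝ) (x : ℝ × ℝ) : ℝ :=
  dU a b * ∫ y in Udom, f y * KnUCes a b δ n x y * Uw a b y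

/-- `Z_m^λ`, the normalized Gegenbauer polynomial (`2T_m` in the limiting case `λ = 0`). -/
def Zm (lam : ℝ) (m : ℕ) (t : ℝ) : ℝ :=
  if lam = 0 then (if m = 0 then 1 else 2 * (Polynomial.Chebyshev.T ℝ (m : ℤ)).eval t)
  else ((m : ℝ) + lam) / lam * (poch (2 * lam) m / poch (lam + 1/2) m) *
    jacobiP m (lam - 1/2) (lam - 1/2) t

/-- Euclidean space `ℝ^d`. -/
abbrev Euc (d : ℕ) := EuclideanSpace ℝ (Fin d)

/-- The surface measure on the unit sphere `𝕊^{d-1}`. -/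
def sphMeas (d : ℕ) : Measure (Metric.sphere (0 : Euc d) 1) :=
  (volume : Measure (Euc d)).toSphere

/-- The surface area `ω_d` of the unit sphere. -/
def ωd (d : ℕ) : ℝ := (sphMeas d Set.univ).toReal

/-- Integral over the unit sphere. -/
def sphInt (d : ℕ) (f : Euc d → ℝ) : ℝ := ∫ ξ, f (ξ : Euc d) ∂(sphMeas d)

/-- Integral over the surface of the paraboloid `𝕍₀^{d+1}`:
`∫_{𝕍₀} f dσ = ∫_0^1 t^{(d-1)/2} ∫_{𝕊^{d-1}} f(√t ξ, t) dσ_𝕊(ξ) dt`. -/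
def V0Int (d : ℕ) (f : Euc d → ℝ → ℝ) : ℝ :=
  ∫ t in (0:ℝ)..1, t ^ (((d : ℝ) - 1) / 2) * ∫ ξ, f (Real.sqrt t • (ξ : Euc d)) t ∂(sphMeas d)

/-- The weight `ϖ_{β,γ}(t) = t^β (1-t)^γ`. -/
def wt (β γ : ℝ) (t : ℝ) : ℝ := t ^ β * (1 - t) ^ γ

/-- Normalization constant `b_{β,γ}` on the surface of the paraboloid. -/
def bV0 (d : ℕ) (β γ : ℝ) : ℝ := (V0Int d fun _ t => wt β γ t)⁻¹

/-- The surface of the paraboloid `𝕍₀^{d+1} = {(x,t) : ‖x‖² = t ≤ 1}`. -/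
def V0set (d : ℕ) : Set (Euc d × ℝ) := {q | ‖q.1‖ ^ 2 = q.2 ∧ q.2 ≤ 1}

/-- The weighted measure `ϖ_{β,γ} dσ` on (the sphere-parametrization of) `𝕍₀^{d+1}`. -/
def μV0 (d : ℕ) (β γ : ℝ) : Measure (Metric.sphere (0 : Euc d) 1 × ℝ) :=
  ((sphMeas d).prod (volume.restrict (Set.Icc (0:ℝ) 1))).withDensity
    fun p => ENNReal.ofReal (p.2 ^ (((d : ℝ) - 1) / 2) * wt β γ p.2)

/-- Squared norms `h_{m,n}^{β,γ}` on the surface of the paraboloid. -/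
def hV0 (d : ℕ) (β γ : ℝ) (m n : ℕ) : ℝ :=
  (cJ (β + ((d : ℝ) - 1) / 2) γ / cJ ((m : ℝ) + β + ((d : ℝ) - 1) / 2) γ) *
    hJ (n - m) ((m : ℝ) + β + ((d : ℝ) - 1) / 2) γ

/-- The reproducing kernel `P_n(ϖ_{β,γ}; (√t ξ, t), (√s η, s))` on `𝕍₀^{d+1}`,
written as a function of `t`, `s` and `c = ⟨ξ,η⟩`. -/
def PnV0 (d : ℕ) (β γ : ℝ) (n : ℕ) (t s c : ℝ) : ℝ :=
  ∑ m ∈ Finset.range (n + 1),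
    jacobiP (n - m) ((m : ℝ) + β + ((d : ℝ) - 1) / 2) γ (1 - 2 * t) *
      jacobiP (n - m) ((m : ℝ) + β + ((d : ℝ) - 1) / 2) γ (1 - 2 * s) / hV0 d β γ m n *
      (Real.sqrt t) ^ m * (Real.sqrt s) ^ m * Zm (((d : ℝ) - 2) / 2) m c

/-- Partial-sum kernel `K_n(ϖ_{β,γ})` on `𝕍₀^{d+1}`. -/
def KnV0 (d : ℕ) (β γ : ℝ) (n : ℕ) (t s c : ℝ) : ℝ :=
  ∑ m ∈ Finset.range (n + 1), PnV0 d β γ m t s c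

/-- Cesàro `(C,δ)` kernel on `𝕍₀^{d+1}`. -/
def KnV0Ces (d : ℕ) (β γ δ : ℝ) (n : ℕ) (t s c : ℝ) : ℝ :=
  (binomC δ n)⁻¹ * ∑ m ∈ Finset.range (n + 1), binomC (δ - 1) (n - m) * KnV0 d β γ m t s c

/-- Cesàro `(C,δ)` means `S_n^δ(ϖ_{β,γ}; f, (√t ξ, t))` on `𝕍₀^{d+1}`. -/
def SnV0Ces (d : ℕ) (β γ δ : ℝ) (n : ℕ) (f : Euc d × ℝ → ℝ) (ξ : Euc d) (t : ℝ) : ℝ :=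
  bV0 d β γ * ∫ s in (0:ℝ)..1, s ^ (((d : ℝ) - 1) / 2) * wt β γ s *
    ∫ η, f (Real.sqrt s • (η : Euc d), s) * KnV0Ces d β γ δ n t s ⟪ξ, (η : Euc d)⟫ ∂(sphMeas d)

/-- Normalization constant `τ_β` in the definition of `T_{β,γ}`. -/
def τβ (d : ℕ) (β : ℝ) : ℝ :=
  (∫ z₁ in (-1:ℝ)..1, ∫ z₂ in (-1:ℝ)..1,
    (1 - z₁) ^ (((d : ℝ) - 2) / 2) * (1 + z₁) ^ (β - 1/2) * (1 - z₂ ^ 2) ^ β)⁻¹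

/-- The operator `T_{β,γ}` on the surface of the paraboloid, with
`(x,t) = (√t ξ, t)` and `(y,s) = (√s η, s)`. -/
def TV0 (d : ℕ) (β γ : ℝ) (g : ℝ × ℝ → ℝ × ℝ → ℝ) (ξ η : Euc d) (t s : ℝ) : ℝ :=
  if β = -(1/2) then g (Real.sqrt t, t) (⟪ξ, Real.sqrt s • η⟫, s)
  else τβ d β * ∫ z₁ in (-1:ℝ)..1, ∫ z₂ in (-1:ℝ)..1,
    g (Real.sqrt t, t) (Real.sqrt s * ((1 - z₁) / 2 * ⟪ξ, η⟫ + (1 + z₁) / 2 * z₂), s) *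
      ((1 - z₁) ^ (((d : ℝ) - 2) / 2) * (1 + z₁) ^ (β - 1/2) * (1 - z₂ ^ 2) ^ β)

/-- The pseudo convolution `f ∗_{𝕍₀} g` on the surface of the paraboloid. -/
def convV0 (d : ℕ) (β γ : ℝ) (f : Euc d × ℝ → ℝ) (g : ℝ × ℝ → ℝ × ℝ → ℝ)
    (η : Euc d) (s : ℝ) : ℝ :=
  bV0 d β γ * ∫ t in (0:ℝ)..1, t ^ (((d : ℝ) - 1) / 2) * wt β γ t *
    ∫ ξ, f (Real.sqrt t • (ξ : Euc d), t) * TV0 d β γ g (ξ : Euc d) η t s ∂(sphMeas d)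

/-- The solid paraboloid `𝕍^{d+1} = {(x,t) : ‖x‖² ≤ t ≤ 1}`. -/
def Vset (d : ℕ) : Set (Euc d × ℝ) := {q | ‖q.1‖ ^ 2 ≤ q.2 ∧ q.2 ≤ 1}

/-- The weight `W_{β,γ,μ}` on the solid paraboloid. -/
def WW (d : ℕ) (β γ μ : ℝ) (q : Euc d × ℝ) : ℝ :=
  q.2 ^ β * (1 - q.2) ^ γ * (q.2 - ‖q.1‖ ^ 2) ^ (μ - 1/2)

/-- Normalization constant `b_{β,γ,μ}`. -/
def bW (d : ℕ) (β γ μ : ℝ) : ℝ := (∫ q in Vset d, WW d β γ μ q)⁻¹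

/-- The weighted measure `W_{β,γ,μ}(x,t) dx dt` on `𝕍^{d+1}`. -/
def μW (d : ℕ) (β γ μ : ℝ) : Measure (Euc d × ℝ) :=
  (volume.restrict (Vset d)).withDensity fun q => ENNReal.ofReal (WW d β γ μ q)

/-- The weight `ϖ_μ(y) = (1-‖y‖²)^{μ-1/2}` on the unit ball. -/
def wB (d : ℕ) (μ : ℝ) (y : Euc d) : ℝ := (1 - ‖y‖ ^ 2) ^ (μ - 1/2)

/-- Normalization constant `b_μ` of `ϖ_μ` on the unit ball. -/
def bB (d : ℕ) (μ : ℝ) : ℝ := (∫ y in Metric.closedBall (0 : Euc d) 1, wB d μ y)⁻¹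

/-- Normalization constant `σ_μ = (∫_{-1}^1 (1-u²)^{μ-1} du)⁻¹`. -/
def σμ (μ : ℝ) : ℝ := (∫ u in (-1:ℝ)..1, (1 - u ^ 2) ^ (μ - 1))⁻¹

/-- `ξ₀(x,t,y,s;u) = (⟨x,y⟩ + u √(t-‖x‖²) √(s-‖y‖²))/√(st)`. -/
def xi0 (d : ℕ) (x : Euc d) (t : ℝ) (y : Euc d) (s : ℝ) (u : ℝ) : ℝ :=
  (⟪x, y⟫ + u * Real.sqrt (t - ‖x‖ ^ 2) * Real.sqrt (s - ‖y‖ ^ 2)) / Real.sqrt (s * t)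

/-- Squared norms `h_{m,n}^{β,γ,μ}` on the solid paraboloid. -/
def hW (d : ℕ) (β γ μ : ℝ) (m n : ℕ) : ℝ :=
  (cJ (β + μ + ((d : ℝ) - 1) / 2) γ / cJ ((m : ℝ) + β + μ + ((d : ℝ) - 1) / 2) γ) *
    hJ (n - m) ((m : ℝ) + β + μ + ((d : ℝ) - 1) / 2) γ

/-- The reproducing kernel `P_n(W_{β,γ,μ}; (x,t), (y,s))` on the solid paraboloid. -/
def PnW (d : ℕ) (β γ μ : ℝ) (n : ℕ) (x : Euc d) (t : ℝ) (y : Euc d) (s : ℝ) : ℝ :=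
  σμ μ * ∫ u in (-1:ℝ)..1,
    (∑ m ∈ Finset.range (n + 1),
      jacobiP (n - m) ((m : ℝ) + β + μ + ((d : ℝ) - 1) / 2) γ (1 - 2 * t) *
        jacobiP (n - m) ((m : ℝ) + β + μ + ((d : ℝ) - 1) / 2) γ (1 - 2 * s) / hW d β γ μ m n *
        (Real.sqrt t) ^ m * (Real.sqrt s) ^ m *
        Zm (μ + ((d : ℝ) - 1) / 2) m (xi0 d x t y s u)) * (1 - u ^ 2) ^ (μ - 1)

/-- Partial-sum kernel `K_n(W_{β,γ,μ})`. -/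
def KnW (d : ℕ) (β γ μ : ℝ) (n : ℕ) (x : Euc d) (t : ℝ) (y : Euc d) (s : ℝ) : ℝ :=
  ∑ m ∈ Finset.range (n + 1), PnW d β γ μ m x t y s

/-- Cesàro `(C,δ)` kernel on the solid paraboloid. -/
def KnWCes (d : ℕ) (β γ μ δ : ℝ) (n : ℕ) (x : Euc d) (t : ℝ) (y : Euc d) (s : ℝ) : ℝ :=
  (binomC δ n)⁻¹ * ∑ m ∈ Finset.range (n + 1), binomC (δ - 1) (n - m) * KnW d β γ μ m x t y s

/-- Cesàro `(C,δ)` means `S_n^δ(W_{β,γ,μ}; f, (x,t))`. -/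
def SnWCes (d : ℕ) (β γ μ δ : ℝ) (n : ℕ) (f : Euc d × ℝ → ℝ) (x : Euc d) (t : ℝ) : ℝ :=
  bW d β γ μ * ∫ q in Vset d, f q * KnWCes d β γ μ δ n x t q.1 q.2 * WW d β γ μ q

/-- `ξ(x,t,y,s;z,u)` in the connection kernel on the solid paraboloid. -/
def ξW (d : ℕ) (x : Euc d) (t : ℝ) (y : Euc d) (s : ℝ) (z₁ z₂ u : ℝ) : ℝ :=
  (1 - z₁) / 2 * xi0 d x t y s u + (1 + z₁) / 2 * z₂

/-- Normalization constant `κ_β`. -/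
def κβ (d : ℕ) (β μ : ℝ) : ℝ :=
  (∫ z₁ in (-1:ℝ)..1, ∫ z₂ in (-1:ℝ)..1, ∫ u in (-1:ℝ)..1,
    (1 - z₁) ^ (μ + ((d : ℝ) - 1) / 2) * (1 + z₁) ^ (β - 1) * (1 - z₂ ^ 2) ^ (β - 1/2) *
      (1 - u ^ 2) ^ (μ - 1))⁻¹

/-- The operator `T_{β,γ,μ}` on the solid paraboloid. -/
def TW (d : ℕ) (β γ μ : ℝ) (g : ℝ × ℝ → ℝ × ℝ → ℝ) (x : Euc d) (t : ℝ) (y : Euc d) (s : ℝ) : ℝ :=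
  if β = 0 then
    σμ μ * ∫ u in (-1:ℝ)..1,
      g (Real.sqrt t, t) (Real.sqrt s * xi0 d x t y s u, s) * (1 - u ^ 2) ^ (μ - 1)
  else
    κβ d β μ * ∫ z₁ in (-1:ℝ)..1, ∫ z₂ in (-1:ℝ)..1, ∫ u in (-1:ℝ)..1,
      g (Real.sqrt t, t) (Real.sqrt s * ξW d x t y s z₁ z₂ u, s) *
        ((1 - z₁) ^ (μ + ((d : ℝ) - 1) / 2) * (1 + z₁) ^ (β - 1) * (1 - z₂ ^ 2) ^ (β - 1/2) *
          (1 - u ^ 2) ^ (μ - 1))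

/-- Directional derivative `⟨x,∇⟩f(x) = ∑ xᵢ ∂ᵢ f(x)`. -/
def xGrad (d : ℕ) (f : Euc d → ℝ) (x : Euc d) : ℝ := fderiv ℝ f x x

/-- Laplacian `Δf(x) = ∑ ∂ᵢ² f(x)`. -/
def lapl (d : ℕ) (f : Euc d → ℝ) (x : Euc d) : ℝ :=
  ∑ i : Fin d, fderiv ℝ (fun y => fderiv ℝ f y (EuclideanSpace.single i 1)) x
    (EuclideanSpace.single i 1)


/-- `Q_{m,n}(x,t) = P_{n-m}^{(m+α,γ)}(1-2t) t^{m/2} Y(x/√t)`. -/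
def QV0gen (d : ℕ) (α γ : ℝ) (m n : ℕ) (Y : Euc d → ℝ) (x : Euc d) (t : ℝ) : ℝ :=
  jacobiP (n - m) ((m : ℝ) + α) γ (1 - 2 * t) * (Real.sqrt t) ^ m * Y ((Real.sqrt t)⁻¹ • x)

end

local notation "𝔬" => ENNReal.ofReal
local notation "𝔯" => Finset.range
local notation:max "𝔴" γ:max l:max => (γ+l+3/2)
local notation:max "𝔡" d:max => ((d:ℝ)-1)/2
local notation "𝔦" => Ioo (0:ℝ) 1
local notation:max "𝔢" w:max => Complex.exp (w*Complex.I)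
local notation:max "𝔭" => (by positivity)
local notation:max "𝔩" => (by linarith)

theorem poch_zero (a : ℝ) : poch a 0 = 1 := by simp [poch]
theorem poch_succ (a : ℝ) (n : ℕ) : poch a (n+1) = poch a n * (a + n) := by
  simp [poch, Finset.prod_range_succ]
theorem poch_succ_left (a : ℝ) (n : ℕ) : poch a (n+1) = a * poch (a+1) n := by
  simp only [poch, Finset.prod_range_succ']
  rw [mul_comm]; congr 1
  · simp
  · apply Finset.prod_congr rfl; intro i _; push_cast; ring
theorem poch_add (a : ℝ) (m n : ℕ) : poch a (m+n) = poch a m * poch (a+m) n := by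
  induction n with
  | zero => simp [poch_zero]
  | succ k ih => rw [← add_assoc, poch_succ, ih, poch_succ]; push_cast; ring
theorem poch_pos {a : ℝ} (ha : 0 < a) (n : ℕ) : 0 < poch a n := by
  unfold poch; apply Finset.prod_pos; intro i _; positivity
theorem poch_neg_nat (N j : ℕ) (h : j ≤ N) :
    poch (-(N:ℝ)) j = (-1)^j * (N.factorial : ℝ) / ((N-j).factorial : ℝ) := by
  induction j with
  | zero => simp [poch_zero]; field_simp
  | succ k ih =>
    rw [poch_succ, ih (by omega)]
    obtain ⟨r, rfl⟩ := Nat.exists_eq_add_of_le h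
    have e1 : k + 1 + r - k = r + 1 := by omega
    have e2 : k + 1 + r - (k+1) = r := by omega
    rw [e1, e2, Nat.factorial_succ r]
    push_cast
    field_simp
    ring
theorem poch_one (n : ℕ) : poch 1 n = n.factorial := by
  induction n with
  | zero => simp [poch_zero]
  | succ k ih => rw [poch_succ, ih, Nat.factorial_succ]; push_cast; ring

theorem vandermonde (n : ℕ) : ∀ b c : ℝ, ∑ j ∈ 𝔯 (n+1),
    (n.choose j : ℝ) * ((-1)^j * poch b j * poch (c+j) (n-j)) = poch (c-b) n := by
  induction n with
  | zero => intro b c; simp [poch_zero]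
  | succ n ih =>
    intro b c
    have := Finset.sum_choose_succ_mul (fun i k => (-1:ℝ)^i * poch b i * poch (c+i) k) n
    rw [this]
    have h1 : ∑ i ∈ 𝔯 (n+1), (n.choose i : ℝ) * ((-1)^i * poch b i * poch (c+i) (n+1-i))
        = (c+n) * poch (c-b) n := by
      rw [← ih b c, Finset.mul_sum]
      apply Finset.sum_congr rfl
      intro i hi
      have hi' : i ≤ n := by simpa [Nat.lt_succ_iff] using hi
      rw [Nat.sub_add_comm hi', poch_succ, Nat.cast_sub hi']; ring
    have h2 : ∑ i ∈ 𝔯 (n+1), (n.choose i : ℝ) * ((-1)^(i+1) * poch b (i+1) * poch (c+((i+1:ℕ):ℝ)) (n-i))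
        = - b * poch (c-b) n := by
      have := ih (b+1) (c+1)
      rw [show c + 1 - (b+1) = c - b by ring] at this
      rw [← this, Finset.mul_sum]
      apply Finset.sum_congr rfl
      intro i hi
      rw [poch_succ_left, pow_succ, show c + ((i+1:ℕ):ℝ) = c + 1 + i by push_cast; ring]; ring
    rw [h1, h2, poch_succ]; ring

theorem jacobiP_alt (N : ℕ) (a b : ℝ) (ha : -1 < a) (t : ℝ) : jacobiP N a b t =
    poch (a+1) N * ∑ j ∈ 𝔯 (N+1), (-1)^j * poch ((N:ℝ)+a+b+1) j /
      (poch (a+1) j * (j.factorial:ℝ) * ((N-j).factorial : ℝ)) * ((1-t)/2)^j := by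
  unfold jacobiP
  rw [div_mul_eq_mul_div, mul_div_assoc, Finset.sum_div]
  congr 1
  apply Finset.sum_congr rfl
  intro j hj
  have hj' : j ≤ N := by simpa [Nat.lt_succ_iff] using hj
  rw [poch_neg_nat N j hj']
  have := (poch_pos (show 0 < a+1 by linarith) j).ne'
  field_simp

theorem jacobiP_neg_one (N : ℕ) (a b : ℝ) (ha : -1 < a) :
    jacobiP N a b (-1) = (-1)^N * poch (b+1) N / (N.factorial:ℝ) := by
  rw [jacobiP_alt N a b ha]
  have hv := vandermonde N (N+a+b+1) (a+1)
  have e1 : poch (a+1-(N+a+b+1)) N = (-1)^N * poch (b+1) N := by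
    rw [show a+1-(N+a+b+1) = -(N+b) by ring]
    unfold poch
    rw [← Finset.prod_range_reflect, ← Finset.card_range N, ← Finset.prod_const, Finset.card_range, ← Finset.prod_mul_distrib]
    apply Finset.prod_congr rfl
    intro i hi
    have hi' : i < N := by simpa using hi
    rw [show N - 1 - i = N - (1+i) by omega, Nat.cast_sub (by omega)]; push_cast; ring
  rw [e1] at hv
  rw [← hv, Finset.mul_sum, Finset.sum_div]
  apply Finset.sum_congr rfl
  intro j hj
  have hj' : j ≤ N := by simpa [Nat.lt_succ_iff] using hj
  have h1 := (poch_pos (show 0 < a+1 by linarith) j).ne'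
  have h2 : poch (a+1) N = poch (a+1) j * poch (a+1+j) (N-j) := by
    rw [← poch_add]; congr 1; omega
  rw [h2, Nat.cast_choose ℝ hj']
  norm_num
  field_simp

theorem Gamma_add_nat (a : ℝ) (ha : 0 < a) (m : ℕ) : Gamma (a+m) = poch a m * Gamma a := by
  induction m with
  | zero => simp [poch_zero]
  | succ k ih =>
    have : 0 < a + k := by positivity
    rw [poch_succ, Nat.cast_succ, ← add_assoc, Gamma_add_one this.ne', ih]; ring

noncomputable def kco (α γ : ℝ) (m N : ℕ) (s : ℝ) : ℝ :=
  ∑ j ∈ 𝔯 (N+1), (-1)^(N-j) * poch (α+γ+2) (m+N+j) /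
    (poch (α+1) (m+j) * (j.factorial:ℝ) * ((N-j).factorial:ℝ)) * s^j

noncomputable def pco (α γ : ℝ) (m N : ℕ) (s : ℝ) : ℝ :=
  jacobiP N (m+α) γ (-1) * jacobiP N (m+α) γ (1-2*s) /
   ((cJ α γ / cJ (m+α) γ) * hJ N (m+α) γ)

theorem pco_eq (α γ : ℝ) (hα : 0 ≤ α) (hγ : -1 < γ) (m N : ℕ) (s : ℝ) :
    pco α γ m N s = ∑ j ∈ 𝔯 (N+1), (-1)^(N-j) * (poch (α+γ+2) (m+N+j) / (α+γ+2+m+N+j-1)) *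
     (α+γ+m+2*N+1) / (poch (α+1) (m+j) * (j.factorial:ℝ) * ((N-j).factorial:ℝ)) * s^j := by
  have ha : -1 < (m:ℝ)+α := by
    have : (0:ℝ) ≤ m := by positivity
    linarith
  have hG1 : 0 < Gamma (α+1) := Gamma_pos_of_pos 𝔩
  have hG2 : 0 < Gamma (α+γ+2) := Gamma_pos_of_pos 𝔩
  have hG3 : 0 < Gamma (γ+1) := Gamma_pos_of_pos 𝔩
  have p1 := poch_pos (show 0 < α+1 by linarith) m
  have p2 := poch_pos (show 0 < α+γ+2 by linarith) m
  have hc : cJ α γ / cJ (m+α) γ = poch (α+1) m / poch (α+γ+2) m := by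
    unfold cJ
    rw [show (m:ℝ)+α+γ+2 = (α+γ+2)+m by ring, show (m:ℝ)+α+1 = (α+1)+m by ring,
      Gamma_add_nat _ 𝔩, Gamma_add_nat _ 𝔩]
    field_simp
  unfold pco
  rw [hc, jacobiP_neg_one _ _ _ ha, jacobiP_alt _ _ _ ha, hJ, Finset.mul_sum, Finset.mul_sum, Finset.sum_div]
  apply Finset.sum_congr rfl
  intro j hj
  have hj' : j ≤ N := by simpa [Nat.lt_succ_iff] using hj
  have hm : (0:ℝ) ≤ m := by positivity
  have hN : (0:ℝ) ≤ N := by positivity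
  have hjj : (0:ℝ) ≤ j := by positivity
  have p3 := poch_pos (show 0 < (m:ℝ)+α+1 by linarith) N
  have p4 := poch_pos (show 0 < (m:ℝ)+α+1 by linarith) j
  have p5 := poch_pos (show 0 < γ+1 by linarith) N
  have p6 := poch_pos (show 0 < (m:ℝ)+α+γ+2 by linarith) N
  have p7 := poch_pos (show 0 < α+γ+2 by linarith) (m+N)
  have q1 : poch (α+1) (m+j) = poch (α+1) m * poch ((m:ℝ)+α+1) j := by
    rw [poch_add]; congr 2; ring
  have q2 : poch (α+γ+2) (m+N+j) = poch (α+γ+2) m * poch ((m:ℝ)+α+γ+2) N * poch (N+(m+α)+γ+2) j := by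
    rw [poch_add, poch_add]; congr 2
    · congr 1; ring
    · push_cast; ring
  have q3 : poch ((N:ℝ)+(m+α)+γ+2) j * (N+(m+α)+γ+1) = poch ((N:ℝ)+(m+α)+γ+1) j * (N+(m+α)+γ+1+j) := by
    rw [← poch_succ, poch_succ_left]; rw [mul_comm]; congr 2; ring
  have x1 : 0 < (m:ℝ)+α+γ+N+1 := by linarith
  have x2 : 0 < (m:ℝ)+α+γ+2*N+1 := by linarith
  have x3 : 0 < α+γ+2+m+N+j-1 := by linarith
  have sg : (-1:ℝ)^N * (-1)^j = (-1)^(N-j) := by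
    obtain ⟨r, rfl⟩ := Nat.exists_eq_add_of_le hj'
    rw [pow_add, Nat.add_sub_cancel_left]
    have : ((-1:ℝ)^j)*(-1)^j = 1 := by rw [← mul_pow]; simp
    linear_combination (-1)^r * this
  rw [q1, q2, ← sg]
  rw [show (1-(1-2*s))/2 = s by ring]
  rw [show poch ((N:ℝ)+(m+α)+γ+2) j = poch ((N:ℝ)+(m+α)+γ+1) j * (N+(m+α)+γ+1+j) / (N+(m+α)+γ+1) by
    rw [← q3]; have : 0 < (N:ℝ)+(m+α)+γ+1 := by linarith
    field_simp]
  have x4 : 0 < (N:ℝ)+(m+α)+γ+1 := by linarith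
  have f1 : (j.factorial:ℝ) ≠ 0 := by positivity
  have f2 : (N.factorial:ℝ) ≠ 0 := by positivity
  have f3 : ((N-j).factorial:ℝ) ≠ 0 := by positivity
  rw [show α+γ+2+m+N+j-1 = N+(m+α)+γ+1+j by ring, show α+γ+m+2*N+1 = m+α+γ+2*N+1 by ring,
   show (m:ℝ)+α+γ+N+1 = N+(m+α)+γ+1 by ring] at *
  field_simp

theorem pco_zero (α γ : ℝ) (hα : 0 ≤ α) (hγ : -1 < γ) (m : ℕ) (s : ℝ) :
    pco α γ m 0 s = kco α γ m 0 s := by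
  rw [pco_eq α γ hα hγ, kco]
  simp
  have : 0 < α+γ+2+m-1 := by have : (0:ℝ) ≤ m := by positivity
                             linarith
  rw [show α+γ+2+m-1 = α+γ+m+1 by ring] at *
  field_simp

theorem pco_succ (α γ : ℝ) (hα : 0 ≤ α) (hγ : -1 < γ) (m N : ℕ) (s : ℝ) :
    kco α γ m N s + pco α γ m (N+1) s = kco α γ m (N+1) s := by
  rw [pco_eq α γ hα hγ, kco, kco, Finset.sum_range_succ _ (N+1), Finset.sum_range_succ _ (N+1), ← add_assoc, ← Finset.sum_add_distrib]
  have hm : (0:ℝ) ≤ m := by positivity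
  have hN : (0:ℝ) ≤ N := by positivity
  congr 1
  · apply Finset.sum_congr rfl
    intro j hj
    have hj' : j ≤ N := by simpa [Nat.lt_succ_iff] using hj
    obtain ⟨r, rfl⟩ := Nat.exists_eq_add_of_le hj'
    rw [show j + r + 1 - j = r + 1 by omega, show j+r-j = r by omega,
     show m + (j+r+1) + j = m + (j+r)+j+1 by ring, poch_succ, Nat.factorial_succ]
    have p1 := poch_pos (show 0 < α+1 by linarith) (m+j)
    have hjj : (0:ℝ) ≤ j := by positivity
    have hr : (0:ℝ) ≤ r := by positivity
    have x3 : 0 < α+γ+2+m+(j+r)+j := by linarith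
    push_cast
    rw [show α+γ+2+m+(j+r+1)+j-1 = α+γ+2+m+(j+r)+j by ring]
    rw [show α+γ+2+(m+(j+r)+j) = α+γ+2+m+(j+r)+j by ring]
    have f1 : (j.factorial:ℝ) ≠ 0 := by positivity
    have f3 : (r.factorial:ℝ) ≠ 0 := by positivity
    rw [pow_succ]
    field_simp
    ring
  · push_cast
    have x3 : 0 < α+γ+2+m+(N+1)+(N+1)-1 := by linarith
    rw [show α+γ+m+2*(N+1)+1 = α+γ+2+m+(N+1)+(N+1)-1 by ring]
    field_simp

theorem KnV0_eq (d : ℕ) (hd : 2 ≤ d) (β γ : ℝ) (hβ : -(1/2) ≤ β) (hγ : -1 < γ) (n : ℕ) (s c : ℝ) :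
    KnV0 d β γ n 1 s c = ∑ m ∈ 𝔯 (n+1), kco (β+𝔡 d) γ m (n-m) s *
      (sqrt s)^m * Zm (((d:ℝ)-2)/2) m c := by
  have hd' : (2:ℝ) ≤ d := by exact_mod_cast hd
  set α := β+𝔡 d with hα
  have hα0 : 0 ≤ α := by rw [hα]; linarith
  have hP : ∀ n, PnV0 d β γ n 1 s c = ∑ m ∈ 𝔯 (n+1), pco α γ m (n-m) s * (sqrt s)^m * Zm (((d:ℝ)-2)/2) m c := by
    intro n
    unfold PnV0 pco hV0
    apply Finset.sum_congr rfl
    intro m _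
    rw [show (m:ℝ)+β+𝔡 d = m + α by rw [hα]; ring, ← hα]
    norm_num
  induction n with
  | zero => simp [KnV0, hP, pco_zero α γ hα0 hγ]
  | succ n ih =>
    rw [KnV0, Finset.sum_range_succ, ← KnV0, ih, hP, Finset.sum_range_succ _ (n+1), Finset.sum_range_succ _ (n+1), ← add_assoc, ← Finset.sum_add_distrib]
    congr 1
    · apply Finset.sum_congr rfl
      intro m hm
      have hm' : m ≤ n := by simpa [Nat.lt_succ_iff] using hm
      rw [Nat.sub_add_comm hm', ← pco_succ α γ hα0 hγ]; ring
    · simp [pco_zero α γ hα0 hγ]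

theorem hsc {ι E : Type*} [AddCommMonoid E] [TopologicalSpace E] {f g : ι → E} {a : E} (h : HasSum g a)
    (hfg : ∀ i, f i = g i) : HasSum f a := by
  rw [funext hfg]; exact h

theorem ring_choose_poch (a : ℝ) (n : ℕ) :
    Ring.choose ((a:ℂ) + n - 1) n = ((poch a n / (n.factorial:ℝ) : ℝ) : ℂ) := by
  rw [← Ring.multichoose_eq]
  have h := Ring.factorial_nsmul_multichoose_eq_ascPochhammer (a:ℂ) n
  rw [Polynomial.ascPochhammer_smeval_eq_eval] at h
  have h2 : ∀ n : ℕ, Polynomial.eval (a:ℂ) (ascPochhammer ℂ n) = ((poch a n : ℝ) : ℂ) := by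
    intro n
    induction n with
    | zero => simp [poch_zero]
    | succ k ih => rw [ascPochhammer_succ_eval, ih, poch_succ]; push_cast; ring
  rw [h2, nsmul_eq_mul] at h
  push_cast
  rw [← h]
  have : (n.factorial : ℂ) ≠ 0 := by exact_mod_cast n.factorial_ne_zero
  field_simp

theorem binom_hasSum (a : ℝ) (z : ℂ) (hz : ‖z‖ < 1) :
    HasSum (fun n : ℕ => ((poch a n / (n.factorial:ℝ) : ℝ) : ℂ) * z^n) ((1-z)^(-(a:ℂ))) := by
  have h := (Complex.one_div_one_sub_cpow_hasFPowerSeriesOnBall_zero a).hasSum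
    (y := z) (by
      rw [Metric.mem_eball, edist_zero_right, ← ofReal_norm]
      exact ENNReal.ofReal_lt_one.2 hz)
  simp only [FormalMultilinearSeries.ofScalars_apply_eq, ring_choose_poch, zero_add, smul_eq_mul] at h
  rw [Complex.cpow_neg, ← one_div]
  exact h

theorem binom_hasSum_real (a : ℝ) (x : ℝ) (hx : |x| < 1) :
    HasSum (fun n : ℕ => poch a n / (n.factorial:ℝ) * x^n) ((1-x)^(-a)) := by
  have h := binom_hasSum a x (by simpa using hx)
  have : 0 ≤ 1 - x := by linarith [(abs_lt.1 hx).2]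
  have e : ((1:ℂ)-x)^(-(a:ℂ)) = (((1-x)^(-a) : ℝ) : ℂ) := by
    rw [Complex.ofReal_cpow this]; push_cast; rfl
  rw [e] at h
  rw [← Complex.hasSum_ofReal]
  convert h using 2
  push_cast; ring

theorem hasSum_antidiag {E : Type*} [AddCommGroup E] [UniformSpace E] [IsUniformAddGroup E] [T3Space E] {f : ℕ × ℕ → E} {S : E}
    (h : HasSum f S) : HasSum (fun n => ∑ k ∈ 𝔯 (n+1), f (k, n-k)) S := by
  have h2 := (Finset.HasAntidiagonal.sigmaAntidiagonalEquivProd (A := ℕ)).hasSum_iff.2 h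
  have h3 := HasSum.sigma h2 (g := fun n => ∑ k ∈ 𝔯 (n+1), f (k, n-k)) (by
    intro n
    rw [← Finset.Nat.sum_antidiagonal_eq_sum_range_succ_mk]
    rw [← Finset.sum_coe_sort]
    exact hasSum_fintype _)
  exact h3

theorem hasSum_prod_of {f : ℕ × ℕ → ℝ} {g : ℕ → ℝ} {G : ℕ → ℝ} {S : ℝ}
    (h1 : ∀ j, HasSum (fun i => f (j,i)) (g j)) (h2 : HasSum g S)
    (h3 : ∀ j, HasSum (fun i => ‖f (j,i)‖) (G j)) (h4 : Summable G) : HasSum f S := by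
  have hs : Summable fun p => ‖f p‖ := by
    rw [summable_prod_of_nonneg (fun p => norm_nonneg _)]
    refine ⟨fun j => (h3 j).summable, ?_⟩
    convert h4 using 2 with j
    exact (h3 j).tsum_eq
  have := hs.of_norm
  have e : ∑' p, f p = S := by
    have := this.hasSum.prod_fiberwise h1
    exact this.unique h2
  rw [← e]; exact this.hasSum

theorem rearr (A : ℝ) (hA : 0 < A) (x : ℝ) (hx : |x| < 1) (b : ℕ → ℝ) (S : ℝ)
    (h1 : HasSum (fun j => b j * x^j * (1-x)^(-(A+2*j))) S)
    (h2 : Summable (fun j : ℕ => |b j| * |x|^j * (1-|x|)^(-(A+2*j)))) :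
    HasSum (fun n => x^n * ∑ j ∈ 𝔯 (n+1), b j * (poch (A+2*j) (n-j) / ((n-j).factorial:ℝ))) S := by
  have key : HasSum (fun p : ℕ × ℕ => b p.1 * x^p.1 * (poch (A+2*p.1) p.2 / (p.2.factorial:ℝ) * x^p.2)) S := by
    apply hasSum_prod_of (g := fun j => b j * x^j * (1-x)^(-(A+2*j))) (G := fun j : ℕ => |b j| * |x|^j * (1-|x|)^(-(A+2*j)))
    · intro j
      exact (binom_hasSum_real (A+2*j) x hx).mul_left _
    · exact h1
    · intro j
      have := (binom_hasSum_real (A+2*j) |x| (by simpa using hx)).mul_left (|b j| * |x|^j)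
      refine hsc this ?_
      intro i
      have hp : 0 < poch (A+2*j) i := poch_pos 𝔭 i
      simp only [norm_eq_abs, abs_mul, abs_pow, abs_div]
      rw [abs_of_pos hp, abs_of_nonneg (show (0:ℝ) ≤ i.factorial by positivity)]
    · exact h2
  have := hasSum_antidiag key
  refine hsc this ?_
  intro n
  rw [Finset.mul_sum]
  apply Finset.sum_congr rfl
  intro j hj
  have hj' : j ≤ n := by simpa [Nat.lt_succ_iff] using hj
  simp only
  rw [show x^n = x^j * x^(n-j) by rw [← pow_add]; congr 1; omega]
  ring

theorem ps_extend (f : ℂ → ℂ) (hf : DifferentiableOn ℂ f (Metric.ball 0 1)) (a : ℕ → ℂ) (ε : ℝ) (hε : 0 < ε)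
    (h : ∀ r : ℝ, 0 < r → r < ε → HasSum (fun n => a n * (r:ℂ)^n) (f r)) (z : ℂ) (hz : ‖z‖ < 1) :
    HasSum (fun n => a n * z^n) (f z) := by
  set b : ℕ → ℂ := fun n => (n.factorial : ℂ)⁻¹ * iteratedDeriv n f 0 with hb
  have hB : ∀ z : ℂ, ‖z‖ < 1 → HasSum (fun n => b n * z^n) (f z) := by
    intro z hz
    have := Complex.hasSum_taylorSeries_on_ball hf (z := z) (by simpa using hz)
    refine hsc this ?_
    intro n
    simp [hb]; ring
  suffices hab : a = b by rw [hab]; exact hB z hz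
  set p : FormalMultilinearSeries ℂ ℂ ℂ := FormalMultilinearSeries.ofScalars ℂ (fun n => a n - b n) with hp
  set ε' := min ε 1 with hε'
  have hε'0 : 0 < ε' := by positivity
  have hz0 : ∀ r : ℝ, 0 < r → r < ε' → HasSum (fun n => (a n - b n) * (r:ℂ)^n) 0 := by
    intro r h0 h1
    have := (h r h0 (h1.trans_le (min_le_left _ _))).sub (hB r (by
      simp only [Complex.norm_real, norm_eq_abs, abs_of_pos h0]; exact h1.trans_le (min_le_right _ _)))
    rw [sub_self] at this
    exact hsc this (fun n => sub_mul _ _ _)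
  have hrad : 0 < p.radius := by
    have hs := (hz0 (ε'/2) 𝔩 𝔩).summable.norm
    have := p.le_radius_of_summable (r := toNNReal (ε'/2)) (by
      refine (summable_congr ?_).mpr hs
      intro n
      simp only [hp, FormalMultilinearSeries.ofScalars_norm, norm_mul, norm_pow, Complex.norm_real,
        norm_eq_abs]
      rw [abs_of_pos (by linarith : 0 < ε'/2), coe_toNNReal _ 𝔩])
    refine lt_of_lt_of_le ?_ this
    rw [ENNReal.coe_pos, toNNReal_pos]
    linarith
  have hP := p.hasFPowerSeriesOnBall hrad
  have hAn : AnalyticAt ℂ p.sum 0 := hP.analyticAt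
  have hfreq : ∃ᶠ z in nhdsWithin (0:ℂ) {0}ᶜ, p.sum z = 0 := by
    have ht : Tendsto (fun x : ℝ => (x:ℂ)) (nhdsWithin 0 (Ioi 0)) (nhdsWithin (0:ℂ) {0}ᶜ) := by
      apply tendsto_nhdsWithin_iff.2
      constructor
      · have : Tendsto (fun x : ℝ => (x:ℂ)) (nhds 0) (nhds ((0:ℝ):ℂ)) := Complex.continuous_ofReal.tendsto 0
        simpa using this.mono_left nhdsWithin_le_nhds
      · filter_upwards [self_mem_nhdsWithin] with x hx
        simpa using (ne_of_gt hx)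
    apply ht.frequently
    apply Eventually.frequently
    filter_upwards [Ioo_mem_nhdsGT hε'0] with x hx
    have := hz0 x hx.1 hx.2
    rw [FormalMultilinearSeries.sum]
    simp only [hp, FormalMultilinearSeries.ofScalars_apply_eq, smul_eq_mul]
    exact this.tsum_eq
  have hev := hAn.frequently_zero_iff_eventually_zero.1 hfreq
  have hp0 : p = 0 := by
    apply HasFPowerSeriesAt.eq_zero (x := 0)
    exact hP.hasFPowerSeriesAt.congr hev
  ext n
  have : p.coeff n = 0 := by rw [hp0]; rfl
  rw [hp, FormalMultilinearSeries.coeff_ofScalars] at this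
  exact sub_eq_zero.1 this

theorem poch_double (l : ℝ) (j : ℕ) : poch (2*l+1) (2*j) = 4^j * poch (l+1/2) j * poch (l+1) j := by
  induction j with
  | zero => simp [poch_zero]
  | succ k ih =>
    rw [show 2*(k+1) = 2*k+1+1 by ring, poch_succ, poch_succ, ih, poch_succ, poch_succ, pow_succ]
    push_cast; ring

theorem Zm_coef (l : ℝ) (hl : 0 < l) (j i : ℕ) :
    ((j+i:ℕ)+l)/l * poch (2*l) (2*j+i) / (poch (l+1/2) j * (i.factorial:ℝ)) =
    4^j * poch (l+1) j * (poch (2*l+1+2*j) i / (i.factorial:ℝ) +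
      (if i = 0 then 0 else poch (2*l+1+2*j) (i-1) / ((i-1).factorial:ℝ))) := by
  have p1 := poch_pos (show 0 < l+1/2 by linarith) j
  cases i with
  | zero =>
    simp only [poch_zero, add_zero, Nat.factorial_zero, if_true]
    have h := poch_succ_left (2*l) (2*j)
    rw [poch_succ, poch_double] at h
    have : (0:ℝ) < 2*l+2*j := by positivity
    push_cast at h ⊢
    rw [show poch (2*l) (2*j) = 2*l*(4^j * poch (l+1/2) j * poch (l+1) j)/(2*l+2*j) by
      rw [← h]; field_simp]
    generalize poch (l+1/2) j = P at *
    field_simp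
    ring
  | succ i =>
    simp only [Nat.add_sub_cancel, Nat.succ_ne_zero, if_false]
    rw [show 2*j+(i+1) = (2*j+i)+1 by ring, poch_succ_left, poch_add, poch_double, poch_succ, Nat.factorial_succ]
    push_cast
    generalize poch (l+1/2) j = P at *
    field_simp
    ring

noncomputable def Bz (l x : ℝ) (n : ℕ) : ℝ := ∑ j ∈ 𝔯 (n+1),
  (poch (l+1) j / (j.factorial:ℝ) * (-4*x)^j) * (poch (2*l+1+2*j) (n-j) / ((n-j).factorial:ℝ))

theorem Zm_eq_aux (l : ℝ) (hl : 0 < l) (m : ℕ) (c : ℝ) : Zm l m c =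
    ∑ j ∈ 𝔯 (m+1), (((j+(m-j):ℕ)+l)/l * poch (2*l) (2*j+(m-j)) / (poch (l+1/2) j * ((m-j).factorial:ℝ)))
      * ((-((1-c)/2))^j / (j.factorial:ℝ)) := by
  unfold Zm
  rw [if_neg hl.ne', jacobiP_alt _ _ _ 𝔩, show l - 1/2+1 = l+1/2 by ring]
  have p1 := poch_pos (show 0 < l+1/2 by linarith) m
  rw [show ∀ a b p : ℝ, ∀ S : ℝ, a * (b/p) * (p*S) = a*b/p*p*S by intros; ring, div_mul_cancel₀ _ p1.ne',
   Finset.mul_sum]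
  apply Finset.sum_congr rfl
  intro j hj
  have hj' : j ≤ m := by simpa [Nat.lt_succ_iff] using hj
  have p1 := poch_pos (show 0 < l+1/2 by linarith) j
  rw [show 2*j+(m-j) = m+j by omega, show j+(m-j) = m by omega, poch_add,
    show (m:ℝ)+(l-1/2)+(l-1/2)+1 = 2*l+m by ring, neg_pow ((1-c)/2)]
  generalize poch (l+1/2) j = P at *
  generalize ((1-c)/2)^j = Q
  field_simp

theorem Zm_eq_Bz (l : ℝ) (hl : 0 < l) (m : ℕ) (c : ℝ) : Zm l (m+1) c =
    Bz l ((1-c)/2) (m+1) + Bz l ((1-c)/2) m := by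
  rw [Zm_eq_aux l hl, Bz, Bz, Finset.sum_range_succ _ (m+1), Finset.sum_range_succ _ (m+1)]
  conv_rhs => rw [add_right_comm, ← Finset.sum_add_distrib]
  congr 1
  · apply Finset.sum_congr rfl
    intro j hj
    have hj' : j ≤ m := by simpa [Nat.lt_succ_iff] using hj
    rw [Zm_coef l hl, show m+1-j = (m-j)+1 by omega]
    simp only [Nat.succ_ne_zero, if_false, Nat.add_sub_cancel]
    rw [show -4*((1-c)/2) = 4 * (-((1-c)/2)) by ring, mul_pow]
    ring
  · rw [Zm_coef l hl]
    simp only [Nat.sub_self, if_true]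
    rw [show -4*((1-c)/2) = 4 * (-((1-c)/2)) by ring, mul_pow]
    ring

theorem Zm_zero (l : ℝ) (c : ℝ) : Zm l 0 c = 1 := by
  unfold Zm
  split_ifs with h h
  · rfl
  · contradiction
  · simp [poch_zero, jacobiP, h]

theorem Zgf_real (l : ℝ) (hl : 0 < l) (c : ℝ) (hc : |c| ≤ 1) (σ : ℝ) (h0 : 0 < σ) (h1 : σ < 1/10) :
    HasSum (fun m => Zm l m c * σ^m) ((1-σ^2) * (1-2*c*σ+σ^2)^(-(l+1))) := by
  obtain ⟨hc1, hc2⟩ := abs_le.1 hc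
  set x := (1-c)/2 with hx
  have hx0 : 0 ≤ x := by rw [hx]; linarith
  have hx1 : x ≤ 1 := by rw [hx]; linarith
  have hs : 0 < 1 - σ := by linarith
  have hD : 0 < 1-2*c*σ+σ^2 := by nlinarith
  have hab : |4*x*σ/(1-σ)^2| < 1 := by
    rw [abs_of_nonneg 𝔭, div_lt_one 𝔭]; nlinarith
  have pw : ∀ j : ℕ, ((1-σ)^(-((2*l+1)+2*j)) : ℝ) = (1-σ)^(-(2*l+1)) / ((1-σ)^2)^j := by
    intro j
    rw [neg_add, rpow_add hs, rpow_neg hs.le (2*(j:ℝ)), ← pow_mul, ← rpow_natCast (1-σ) (2*j)]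
    push_cast; rfl
  have hB : HasSum (fun n => Bz l x n * σ^n) ((1-σ) * (1-2*c*σ+σ^2)^(-(l+1))) := by
    have := rearr (2*l+1) 𝔩 σ (by rw [abs_of_pos h0]; linarith)
      (fun j => poch (l+1) j / (j.factorial:ℝ) * (-4*x)^j) ((1-σ) * (1-2*c*σ+σ^2)^(-(l+1))) ?_ ?_
    · refine hsc this ?_
      intro n; rw [Bz, mul_comm]
    · have h := (binom_hasSum_real (l+1) (-(4*x*σ/(1-σ)^2)) (by rwa [abs_neg])).mul_left ((1-σ)^(-(2*l+1)))
      have e : (1-σ)^(-(2*l+1)) * (1 - -(4*x*σ/(1-σ)^2))^(-(l+1)) = (1-σ) * (1-2*c*σ+σ^2)^(-(l+1)) := by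
        rw [show 1 - -(4*x*σ/(1-σ)^2) = (1-2*c*σ+σ^2) / (1-σ)^2 by rw [hx]; field_simp; ring,
          div_rpow hD.le 𝔭, ← rpow_natCast (1-σ) 2, ← rpow_mul hs.le]
        rw [mul_div_assoc', mul_comm, mul_div_assoc, ← rpow_sub hs]
        rw [show -(2*l+1) - ((2:ℕ):ℝ) * (-(l+1)) = 1 by push_cast; ring, rpow_one]
        ring
      rw [e] at h
      refine hsc h ?_
      intro j
      rw [pw, neg_div', div_pow, show -(4*x*σ) = -4*x*σ by ring, mul_pow (-4*x)]; ring
    · have h := ((binom_hasSum_real (l+1) (4*x*σ/(1-σ)^2) hab).mul_left ((1-σ)^(-(2*l+1)))).summable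
      refine (summable_congr ?_).mpr h
      intro j
      have := (poch_pos (show 0 < l+1 by linarith) j).le
      rw [abs_of_pos h0, pw, abs_mul, abs_pow, abs_of_nonneg (by positivity : 0 ≤ poch (l+1) j / (j.factorial:ℝ)), div_pow,
        show |-4*x| = 4*x by rw [abs_of_nonpos 𝔩]; ring, mul_pow (4*x)]; ring
  have hB2 := hB.mul_left σ
  have := (hasSum_nat_add_iff' (f := fun n => Zm l n c * σ^n) (g := (1-σ^2) * (1-2*c*σ+σ^2)^(-(l+1))) 1).1 (by
    have h3 := ((hasSum_nat_add_iff' (f := fun n => Bz l x n * σ^n) 1).2 hB).add hB2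
    have e : (1-σ) * (1-2*c*σ+σ^2)^(-(l+1)) - ∑ i ∈ 𝔯 1, Bz l x i * σ^i + σ * ((1-σ) * (1-2*c*σ+σ^2)^(-(l+1)))
       = (1-σ^2) * (1-2*c*σ+σ^2)^(-(l+1)) - ∑ i ∈ 𝔯 1, Zm l i c * σ^i := by
      simp [Zm_zero, Bz, poch_zero]; ring
    rw [e] at h3
    refine hsc h3 ?_
    intro m
    rw [Zm_eq_Bz l hl]
    simp only [pow_succ]
    ring)
  exact this

theorem cpow_mul_conj (z : ℂ) (hz : 0 < z.re) (p : ℝ) :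
    z^(p:ℂ) * ((starRingEnd ℂ) z)^(p:ℂ) = ((Complex.normSq z ^ p : ℝ) : ℂ) := by
  have hz0 : z ≠ 0 := by rintro rfl; simp at hz
  have hz1 : (starRingEnd ℂ) z ≠ 0 := by simpa using hz0
  have harg : z.arg ≠ π := by
    intro h; rw [Complex.arg_eq_pi_iff] at h; linarith [h.1]
  rw [Complex.cpow_def_of_ne_zero hz0, Complex.cpow_def_of_ne_zero hz1, ← Complex.exp_add, Complex.log_conj _ harg,
    ← add_mul, Complex.add_conj, Complex.log_re, rpow_def_of_pos (Complex.normSq_pos.2 hz0), Complex.normSq_eq_norm_sq,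
    log_pow]
  push_cast; rfl

noncomputable def Zg (l ω : ℝ) (σ : ℂ) : ℂ :=
  (1-σ^2) * (1-σ*𝔢 ω)^(-((l+1:ℝ):ℂ)) * (1-σ*Complex.exp (-(ω*Complex.I)))^(-((l+1:ℝ):ℂ))

theorem one_sub_re_pos {z : ℂ} (h : ‖z‖ < 1) : 0 < (1 - z).re := by
  have := Complex.re_le_norm z
  simp; linarith

theorem norm_exp_I (ω : ℝ) : ‖𝔢 ω‖ = 1 := Complex.norm_exp_ofReal_mul_I ω
theorem norm_exp_neg_I (ω : ℝ) : ‖Complex.exp (-(ω*Complex.I))‖ = 1 := by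
  have := Complex.norm_exp_ofReal_mul_I (-ω)
  push_cast at this; rwa [neg_mul] at this

theorem diff_one_sub_cpow (e p : ℂ) (he : ‖e‖ ≤ 1) :
    DifferentiableOn ℂ (fun σ : ℂ => (1-σ*e)^p) (Metric.ball 0 1) := by
  intro σ hσ
  apply DifferentiableAt.differentiableWithinAt
  have hσ' : ‖σ‖ < 1 := by simpa using hσ
  apply DifferentiableAt.cpow_const
  · fun_prop
  · left
    apply one_sub_re_pos
    rw [norm_mul]
    exact lt_of_le_of_lt (mul_le_of_le_one_right (norm_nonneg _) he) hσ'

theorem Zg_diff (l ω : ℝ) : DifferentiableOn ℂ (Zg l ω) (Metric.ball 0 1) := by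
  unfold Zg
  apply DifferentiableOn.mul
  · apply DifferentiableOn.mul
    · fun_prop
    · exact diff_one_sub_cpow _ _ (norm_exp_I ω).le
  · exact diff_one_sub_cpow _ _ (norm_exp_neg_I ω).le

theorem Zgf (l : ℝ) (hl : 0 ≤ l) (ω : ℝ) (σ : ℂ) (hσ : ‖σ‖ < 1) :
    HasSum (fun m => ((Zm l m (cos ω) : ℝ) : ℂ) * σ^m) (Zg l ω σ) := by
  rcases hl.eq_or_lt with rfl | hl
  · have n1 : ‖σ*𝔢 ω‖ < 1 := by rwa [norm_mul, norm_exp_I, mul_one]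
    have n2 : ‖σ*Complex.exp (-(ω*Complex.I))‖ < 1 := by rwa [norm_mul, norm_exp_neg_I, mul_one]
    have h1 := hasSum_geometric_of_norm_lt_one n1
    have h2 := hasSum_geometric_of_norm_lt_one n2
    have h3 := (h1.add h2).sub (hasSum_ite_eq (0:ℕ) (1:ℂ))
    have z1 : 1 - σ*𝔢 ω ≠ 0 := by
      intro h; have := one_sub_re_pos n1; rw [h] at this; simp at this
    have z2 : 1 - σ*Complex.exp (-(ω*Complex.I)) ≠ 0 := by
      intro h; have := one_sub_re_pos n2; rw [h] at this; simp at this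
    have ee : 𝔢 ω * Complex.exp (-(ω*Complex.I)) = 1 := by
      rw [← Complex.exp_add]; simp
    have e : Zg 0 ω σ = (1 - σ*𝔢 ω)⁻¹ + (1 - σ*Complex.exp (-(ω*Complex.I)))⁻¹ - 1 := by
      unfold Zg
      rw [zero_add, Complex.ofReal_one, Complex.cpow_neg_one, Complex.cpow_neg_one]
      field_simp
      linear_combination (σ^2) * ee
    rw [e]
    refine hsc h3 ?_
    intro m
    unfold Zm
    rw [if_pos rfl]
    rcases Nat.eq_zero_or_pos m with rfl | hm
    · simp
    · rw [if_neg hm.ne', if_neg hm.ne', Polynomial.Chebyshev.T_real_cos]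
      push_cast
      rw [Complex.cos, mul_pow, mul_pow, ← Complex.exp_nat_mul, ← Complex.exp_nat_mul]
      rw [show (m:ℂ)*ω*Complex.I = m*(ω*Complex.I) by ring, show -((m:ℂ)*ω)*Complex.I = m*(-(ω*Complex.I)) by ring]
      ring
  · apply ps_extend (Zg l ω) (Zg_diff l ω) _ (1/10) (by norm_num) _ σ hσ
    intro r h0 h1
    have h := Zgf_real l hl (cos ω) (abs_cos_le_one ω) r h0 h1
    have e : Zg l ω r = (((1-r^2) * (1-2*cos ω*r+r^2)^(-(l+1)) : ℝ) : ℂ) := by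
      unfold Zg
      have hz : 0 < (1-(r:ℂ)*𝔢 ω).re := by
        apply one_sub_re_pos; rw [norm_mul, norm_exp_I, mul_one, Complex.norm_real, norm_eq_abs, abs_of_pos h0]; linarith
      have hcj : (starRingEnd ℂ) (1-(r:ℂ)*𝔢 ω) = 1-(r:ℂ)*Complex.exp (-(ω*Complex.I)) := by
        simp [← Complex.exp_conj]
      have := cpow_mul_conj _ hz (-(l+1))
      rw [hcj] at this
      rw [Complex.ofReal_neg] at this
      rw [mul_assoc, this]
      have hn : Complex.normSq (1-(r:ℂ)*𝔢 ω) = 1-2*cos ω*r+r^2 := by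
        rw [Complex.normSq_apply]
        simp only [Complex.sub_re, Complex.sub_im, Complex.one_re, Complex.one_im, Complex.mul_re, Complex.mul_im,
          Complex.ofReal_re, Complex.ofReal_im, Complex.exp_ofReal_mul_I_re, Complex.exp_ofReal_mul_I_im]
        nlinarith [sin_sq_add_cos_sq ω]
      rw [hn]
      push_cast
      rfl
    rw [e]
    rw [← Complex.hasSum_ofReal] at h
    refine hsc h ?_
    intro m; push_cast; ring

theorem hyp_summable (a b c ρ : ℝ) (ha : 0 < a) (hb : 0 < b) (hc : 0 < c) (h0 : 0 ≤ ρ) (h1 : ρ < 1) :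
    Summable (fun k : ℕ => poch a k * poch c k / (poch b k * (k.factorial:ℝ)) * ρ^k) := by
  rcases h0.eq_or_lt with rfl | h0
  · apply summable_of_ne_finset_zero (s := {0})
    intro k hk
    rw [zero_pow (by simpa using hk), mul_zero]
  have pos : ∀ k : ℕ, 0 < poch a k * poch c k / (poch b k * (k.factorial:ℝ)) * ρ^k := by
    intro k
    have := poch_pos ha k
    have := poch_pos hb k
    have := poch_pos hc k
    positivity
  apply summable_of_ratio_test_tendsto_lt_one h1
  · exact Eventually.of_forall fun k => (pos k).ne'
  · have e : ∀ k : ℕ, ‖poch a (k+1) * poch c (k+1) / (poch b (k+1) * ((k+1).factorial:ℝ)) * ρ^(k+1)‖ /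
        ‖poch a k * poch c k / (poch b k * (k.factorial:ℝ)) * ρ^k‖ =
        ((1 + (a-b) / (b+k)) * (1 + (c-1)/(1+k))) * ρ := by
      intro k
      rw [norm_of_nonneg (pos k).le, norm_of_nonneg (pos (k+1)).le]
      have := poch_pos ha k
      have := poch_pos hb k
      have := poch_pos hc k
      rw [poch_succ, poch_succ, poch_succ, Nat.factorial_succ]
      have : 0 < b + k := by positivity
      push_cast
      field_simp
      ring
    simp_rw [e]
    have t : ∀ x y : ℝ, Tendsto (fun k : ℕ => 1 + x / (y + k)) atTop (nhds 1) := by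
      intro x y
      have : Tendsto (fun k : ℕ => x / (y + k)) atTop (nhds 0) :=
        tendsto_const_nhds.div_atTop (tendsto_atTop_add_const_left _ _ tendsto_natCast_atTop_atTop)
      simpa using this.const_add 1
    simpa using ((t (a-b) b).mul (t (c-1) 1)).mul_const ρ

noncomputable def bq (A C : ℝ) (j : ℕ) : ℝ := poch A (2*j) / (poch C j * (j.factorial:ℝ))

theorem bq_nonneg (A C : ℝ) (hA : 0 < A) (hC : 0 < C) (j : ℕ) : 0 ≤ bq A C j := by
  have := poch_pos hA (2*j)
  have := poch_pos hC j
  unfold bq; positivity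

theorem bq_summable (A C u : ℝ) (hA : 0 < A) (hC : 0 < C) (h0 : 0 ≤ u) (h1 : u < 1/4) :
    Summable (fun j => bq A C j * u^j) := by
  have := hyp_summable (A/2) C ((A+1)/2) (4*u) 𝔩 hC 𝔩 𝔩 𝔩
  refine (summable_congr ?_).mpr this
  intro j
  have h := poch_double ((A-1)/2) j
  rw [show 2*((A-1)/2)+1 = A by ring, show (A-1)/2+1/2 = A/2 by ring, show (A-1)/2+1 = (A+1)/2 by ring] at h
  rw [bq, h, mul_pow]; ring

theorem quad (A C x t : ℝ) (hA : 0 < A) (hC : 0 < C) (h0 : 0 < x) (h1 : x < 1/10) (ht : 0 < t) (ht1 : t ≤ 1) :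
    HasSum (fun n => x^n * ∑ j ∈ 𝔯 (n+1), (-1)^(n-j) * bq A C j * t^j * (poch (A+2*j) (n-j) / ((n-j).factorial:ℝ)))
      ((1+x)^(-A) * ∑' j, bq A C j * (t*x/(1+x)^2)^j) := by
  have u1 : t*x/(1+x)^2 < 1/4 := by
    rw [div_lt_iff₀ 𝔭]; nlinarith
  have u2 : t*x/(1-x)^2 < 1/4 := by
    rw [div_lt_iff₀ (by nlinarith)]; nlinarith
  have pw : ∀ (v : ℝ) (_ : 0 < v) (j : ℕ), v^(-(A+2*j)) = v^(-A) / (v^2)^j := by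
    intro v hv j
    rw [neg_add, rpow_add hv, rpow_neg hv.le (2*(j:ℝ)), ← pow_mul, ← rpow_natCast v (2*j)]
    push_cast; rfl
  have hx : 0 < 1 - x := by linarith
  have := rearr A hA (-x) (by rw [abs_neg, abs_of_pos h0]; linarith) (fun j => (-1)^j * (bq A C j * t^j))
    ((1+x)^(-A) * ∑' j, bq A C j * (t*x/(1+x)^2)^j) ?_ ?_
  · refine hsc this ?_
    intro n
    rw [neg_pow x, mul_comm ((-1)^n), mul_assoc, Finset.mul_sum (a := (-1:ℝ)^n)]
    congr 1
    apply Finset.sum_congr rfl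
    intro j hj
    have hj' : j ≤ n := by simpa [Nat.lt_succ_iff] using hj
    obtain ⟨i, rfl⟩ := Nat.exists_eq_add_of_le hj'
    rw [Nat.add_sub_cancel_left, pow_add]
    have : ((-1:ℝ)^j)*(-1)^j = 1 := by rw [← mul_pow]; simp
    linear_combination (-(-1)^i * bq A C j * t^j * (poch (A+2*j) i / (i.factorial:ℝ))) * this
  · have h := ((bq_summable A C _ hA hC 𝔭 u1).hasSum).mul_left ((1+x)^(-A))
    refine hsc h ?_
    intro j
    rw [show 1 - -x = 1 + x by ring, pw _ 𝔩, div_pow, mul_pow, neg_pow x]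
    have : ((-1:ℝ)^j)*(-1)^j = 1 := by rw [← mul_pow]; simp
    linear_combination (bq A C j * t^j * x^j * (1+x)^(-A) / ((1+x)^2)^j) * this
  · have h := ((bq_summable A C _ hA hC 𝔭 u2).mul_left ((1-x)^(-A)))
    refine (summable_congr ?_).mpr h
    intro j
    rw [abs_neg, abs_of_pos h0, pw _ hx, abs_mul, abs_pow, abs_neg, abs_one, one_pow, one_mul,
      abs_of_nonneg (mul_nonneg (bq_nonneg A C hA hC j) 𝔭), div_pow, mul_pow]
    ring

theorem poch_reflect (b : ℝ) (N : ℕ) : poch (-(N+b)) N = (-1)^N * poch (b+1) N := by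
  unfold poch
  rw [← Finset.prod_range_reflect, ← Finset.card_range N, ← Finset.prod_const, Finset.card_range, ← Finset.prod_mul_distrib]
  apply Finset.prod_congr rfl
  intro i hi
  have hi' : i < N := by simpa using hi
  rw [show N - 1 - i = N - (1+i) by omega, Nat.cast_sub (by omega)]; push_cast; ring

theorem quad_coef (A C : ℝ) (hC : 0 < C) (n : ℕ) :
    ∑ j ∈ 𝔯 (n+1), (-1)^(n-j) * bq A C j * (poch (A+2*j) (n-j) / ((n-j).factorial:ℝ)) =
     poch A n * poch (A-C+1) n / (poch C n * (n.factorial:ℝ)) := by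
  have hv := vandermonde n (A+n) C
  rw [show C - (A+n) = -(n+(A-C)) by ring, poch_reflect] at hv
  have sq1 : ((-1:ℝ)^n)*(-1)^n = 1 := by rw [← mul_pow]; simp
  have hv2 : poch (A-C+1) n = (-1)^n * ∑ j ∈ 𝔯 (n+1),
    (n.choose j : ℝ) * ((-1)^j * poch (A+n) j * poch (C+j) (n-j)) := by
    rw [hv, ← mul_assoc, sq1, one_mul]
  rw [hv2, ← mul_assoc, Finset.mul_sum, Finset.sum_div]
  apply Finset.sum_congr rfl
  intro j hj
  have hj' : j ≤ n := by simpa [Nat.lt_succ_iff] using hj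
  rw [Nat.cast_choose ℝ hj']
  have e1 : poch C n = poch C j * poch (C+j) (n-j) := by rw [← poch_add]; congr 1; omega
  have e2 : poch A (2*j) * poch (A+2*j) (n-j) = poch A n * poch (A+n) j := by
    have := poch_add A (2*j) (n-j)
    push_cast at this
    rw [← this, ← poch_add]; congr 1; omega
  have p1 := poch_pos hC j
  have p2 := poch_pos (show 0 < C + j by positivity) (n-j)
  have sg : (-1:ℝ)^n * (-1)^j = (-1)^(n-j) := by
    obtain ⟨r, rfl⟩ := Nat.exists_eq_add_of_le hj'
    rw [pow_add, Nat.add_sub_cancel_left]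
    have : ((-1:ℝ)^j)*(-1)^j = 1 := by rw [← mul_pow]; simp
    linear_combination (-1)^r * this
  rw [e1, bq, ← sg]
  field_simp
  linear_combination e2

noncomputable def kap (α γ : ℝ) (i : ℕ) : ℝ := poch (α+γ+2) i / poch (α+1) i

theorem kap_add (α γ : ℝ) (m k : ℕ) : kap α γ (m+k) = kap α γ m * (poch (α+γ+2+m) k / poch (α+1+m) k) := by
  unfold kap
  rw [poch_add, poch_add]
  exact mul_div_mul_comm _ _ _ _

theorem Tm_real (α γ : ℝ) (hα : 0 ≤ α) (hγ : -1 < γ) (m : ℕ) (s r q : ℝ) (hs : 0 < s) (hs1 : s ≤ 1)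
    (hr : 0 < r) (hr1 : r < 1/10) (hq : 0 < q) (hq1 : q < 1/10) (hqr : q/(1+q)^2 = s*r/(1+r)^2) :
    HasSum (fun N => kco α γ m N s * (√s)^m * r^(m+N))
      ((1+q)^(α+γ+2) * (1+r)^(-(α+γ+2)) * (√s * r * (1+q)/(1+r))^m *
        ∑' k, kap α γ (m+k) * (poch (γ+2) k / (k.factorial:ℝ)) * q^k) := by
  set A := α+γ+2+m with hA
  set C := α+1+m with hC
  have hm : (0:ℝ) ≤ m := by positivity
  have hA0 : 0 < A := by linarith
  have hC0 : 0 < C := by linarith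
  have h1 := quad A C r s hA0 hC0 hr hr1 hs hs1
  have h2 := quad A C q 1 hA0 hC0 hq hq1 one_pos le_rfl
  rw [one_mul, hqr] at h2
  set H := ∑' j, bq A C j * (s*r/(1+r)^2)^j
  have e2 : ∑' k, kap α γ (m+k) * (poch (γ+2) k / (k.factorial:ℝ)) * q^k = kap α γ m * ((1+q)^(-A) * H) := by
    rw [← h2.tsum_eq, ← tsum_mul_left]
    congr 1; ext k
    have := quad_coef A C hC0 k
    simp only [one_pow, mul_one]
    rw [this, kap_add, hA, hC, show α+γ+2+m-(α+1+m)+1 = γ+2 by ring]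
    ring
  rw [e2]
  have hr2 : 0 < 1 + r := by linarith
  have hq2 : 0 < 1 + q := by linarith
  have e3 : (1+q)^(α+γ+2) * (1+r)^(-(α+γ+2)) * (√s * r * (1+q)/(1+r))^m * (kap α γ m * ((1+q)^(-A) * H)) =
     (kap α γ m * (√s)^m * r^m) * ((1+r)^(-A) * H) := by
    have k1 : (1+q)^(-A) = ((1+q)^(α+γ+2))⁻¹ * ((1+q)^m)⁻¹ := by
      rw [rpow_neg hq2.le, hA, rpow_add hq2, rpow_natCast, mul_inv]
    have k2 : (1+r)^(-A) = (1+r)^(-(α+γ+2)) * ((1+r)^m)⁻¹ := by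
      rw [rpow_neg hr2.le, rpow_neg hr2.le, hA, rpow_add hr2, rpow_natCast, mul_inv]
    rw [k1, k2, div_pow, mul_pow, mul_pow]
    have : 0 < (1+q)^(α+γ+2) := by positivity
    generalize (1+r)^(-(α+γ+2)) = R
    generalize (1+q)^(α+γ+2) = Q at *
    field_simp
  rw [e3]
  refine hsc (h1.mul_left _) ?_
  intro N
  rw [kco, Finset.sum_mul, Finset.sum_mul, Finset.mul_sum, Finset.mul_sum]
  apply Finset.sum_congr rfl
  intro j hj
  have hj' : j ≤ N := by simpa [Nat.lt_succ_iff] using hj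
  have e4 : poch (α+γ+2) (m+N+j) = poch (α+γ+2) m * (poch A (2*j) * poch (A+2*j) (N-j)) := by
    have := poch_add A (2*j) (N-j)
    push_cast at this
    rw [← this, hA, ← poch_add]; congr 1; omega
  have e5 : poch (α+1) (m+j) = poch (α+1) m * poch C j := by rw [hC, ← poch_add]
  rw [e4, e5, kap, bq, pow_add]
  have p1 := poch_pos (show 0 < α+1 by linarith) m
  have p2 := poch_pos hC0 j
  field_simp

noncomputable def zt (r : ℂ) : ℂ := (1-r)/(1+r)
noncomputable def ww (s : ℝ) (r : ℂ) : ℂ := (((1-s : ℝ) : ℂ) + (s:ℂ) * (zt r)^2)^((1/2 : ℝ) : ℂ)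
noncomputable def qq (s : ℝ) (r : ℂ) : ℂ := (1 - ww s r)/(1 + ww s r)
noncomputable def XX (s : ℝ) (r : ℂ) : ℂ := ((√s : ℝ) : ℂ) * (1 - zt r)/(1 + ww s r)

theorem one_add_ne {r : ℂ} (hr : ‖r‖ < 1) : 1 + r ≠ 0 := by
  intro h
  have := one_sub_re_pos (z := -r) (by simpa using hr)
  rw [sub_neg_eq_add, h] at this
  simp at this

theorem one_sub_ne {r : ℂ} (hr : ‖r‖ < 1) : 1 - r ≠ 0 := by
  have := one_add_ne (r := -r) (by simpa using hr)
  simpa [sub_eq_add_neg] using this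

theorem zt_re {r : ℂ} (hr : ‖r‖ < 1) : (zt r).re = (1 - ‖r‖^2) / ‖1+r‖^2 := by
  rw [zt, Complex.div_re, ← Complex.normSq_eq_norm_sq, ← Complex.normSq_eq_norm_sq, ← add_div]
  congr 1
  simp [Complex.normSq_apply]; ring

theorem zt_re_pos {r : ℂ} (hr : ‖r‖ < 1) : 0 < (zt r).re := by
  rw [zt_re hr]
  have := norm_pos_iff.2 (one_add_ne hr)
  have h : ‖r‖^2 < 1 := by nlinarith [norm_nonneg r]
  apply div_pos 𝔩 𝔭

theorem one_add_re_ne {z : ℂ} (h : 0 < z.re) : 1 + z ≠ 0 := by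
  intro h'
  have := congrArg Complex.re h'
  simp at this; linarith

theorem slit {s : ℝ} (hs : 0 < s) (hs1 : s ≤ 1) {z : ℂ} (hz : 0 < z.re) :
    ((1-s : ℝ) : ℂ) + (s:ℂ) * z^2 ∈ Complex.slitPlane := by
  rw [Complex.mem_slitPlane_iff]
  by_cases h : z.im = 0
  · left
    simp [pow_two, h]
    nlinarith [mul_pos hs (mul_pos hz hz)]
  · right
    simp [pow_two]
    refine ⟨hs.ne', ?_⟩
    intro h'
    have : z.re * z.im = 0 := by linarith
    rcases mul_eq_zero.1 this with h1 | h1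
    · linarith
    · exact h h1

theorem cpow_half_re {B : ℂ} (hB : B ∈ Complex.slitPlane) : 0 < (B^((1/2:ℝ):ℂ)).re := by
  have h0 := Complex.slitPlane_ne_zero hB
  rw [Complex.cpow_def_of_ne_zero h0, Complex.exp_re]
  have h1 := Complex.mem_slitPlane_iff_arg.1 hB
  apply mul_pos (exp_pos _)
  apply cos_pos_of_mem_Ioo
  have h2 := Complex.neg_pi_lt_arg B
  have h3 := (Complex.arg_le_pi B).lt_of_ne h1.1
  have : (Complex.log B * ((1/2:ℝ):ℂ)).im = B.arg * (1/2) := by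
    rw [Complex.mul_im]
    simp [Complex.log_im]
  rw [this]
  constructor <;> linarith

theorem cpow_half_sq (B : ℂ) : (B^((1/2:ℝ):ℂ))^2 = B := by
  rw [← Complex.cpow_nat_mul]; simp

section
variable {s : ℝ}

theorem ww_re_pos (hs : 0 < s) (hs1 : s ≤ 1) {r : ℂ} (hr : ‖r‖ < 1) : 0 < (ww s r).re := cpow_half_re (slit hs hs1 (zt_re_pos hr))
theorem ww_sq (s : ℝ) (r : ℂ) : (ww s r)^2 = ((1-s : ℝ) : ℂ) + (s:ℂ) * (zt r)^2 := cpow_half_sq _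
theorem ww_ne (hs : 0 < s) (hs1 : s ≤ 1) {r : ℂ} (hr : ‖r‖ < 1) : 1 + ww s r ≠ 0 := one_add_re_ne (ww_re_pos hs hs1 hr)
theorem zt_ne {r : ℂ} (hr : ‖r‖ < 1) : 1 + zt r ≠ 0 := one_add_re_ne (zt_re_pos hr)

theorem norm_qq_lt (hs : 0 < s) (hs1 : s ≤ 1) {r : ℂ} (hr : ‖r‖ < 1) : ‖qq s r‖ < 1 := by
  rw [qq, norm_div, div_lt_one (norm_pos_iff.2 (ww_ne hs hs1 hr))]
  have h := ww_re_pos hs hs1 hr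
  apply lt_of_pow_lt_pow_left₀ 2 (norm_nonneg _)
  rw [← Complex.normSq_eq_norm_sq, ← Complex.normSq_eq_norm_sq]
  simp only [Complex.normSq_apply, Complex.sub_re, Complex.add_re, Complex.sub_im, Complex.add_im, Complex.one_re, Complex.one_im]
  nlinarith

theorem zt_diff : DifferentiableOn ℂ zt (Metric.ball 0 1) := by
  apply DifferentiableOn.div
  · fun_prop
  · fun_prop
  · intro r hr; exact one_add_ne (by simpa using hr)

theorem ww_diff (hs : 0 < s) (hs1 : s ≤ 1) : DifferentiableOn ℂ (ww s) (Metric.ball 0 1) := by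
  apply DifferentiableOn.cpow
  · exact ((zt_diff.pow 2).const_mul _).const_add _
  · fun_prop
  · intro r hr; exact slit hs hs1 (zt_re_pos (by simpa using hr))

theorem qq_diff (hs : 0 < s) (hs1 : s ≤ 1) : DifferentiableOn ℂ (qq s) (Metric.ball 0 1) := by
  apply DifferentiableOn.div
  · exact (ww_diff hs hs1).const_sub _
  · exact (ww_diff hs hs1).const_add _
  · intro r hr; exact ww_ne hs hs1 (by simpa using hr)

theorem XX_diff (hs : 0 < s) (hs1 : s ≤ 1) : DifferentiableOn ℂ (XX s) (Metric.ball 0 1) := by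
  apply DifferentiableOn.div
  · exact (zt_diff.const_sub _).const_mul _
  · exact (ww_diff hs hs1).const_add _
  · intro r hr; exact ww_ne hs hs1 (by simpa using hr)

theorem norm_qq_le (hs : 0 < s) (hs1 : s ≤ 1) {r : ℂ} (hr : ‖r‖ < 1) : ‖qq s r‖ ≤ ‖r‖ := by
  apply Complex.norm_le_norm_of_mapsTo_ball (qq_diff hs hs1) _ _ hr
  · intro z hz
    simpa using (norm_qq_lt hs hs1 (by simpa using hz)).le
  · simp [qq, ww, zt]

theorem r_eq {r : ℂ} (hr : ‖r‖ < 1) : r = (1 - zt r)/(1 + zt r) := by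
  have := one_add_ne hr
  rw [zt]; field_simp; ring

theorem XX_sq (hs : 0 < s) (hs1 : s ≤ 1) {r : ℂ} (hr : ‖r‖ < 1) : (XX s r)^2 = r * qq s r := by
  have h1 := ww_ne hs hs1 hr
  have h2 := zt_ne hr
  have h3 := ww_sq s r
  have h4 : (((√s:ℝ):ℂ))^2 = s := by rw [← Complex.ofReal_pow, sq_sqrt hs.le]
  rw [XX, qq, div_pow, mul_pow, h4]
  have h5 := r_eq hr
  generalize zt r = Z at *
  generalize ww s r = W at *
  rw [h5]
  field_simp
  push_cast at h3
  linear_combination (1 - Z) * h3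

theorem XX_alt (hs : 0 < s) (hs1 : s ≤ 1) {r : ℂ} (hr : ‖r‖ < 1) :
    XX s r = ((√s:ℝ):ℂ) * r * (1 + qq s r) / (1 + r) := by
  have h1 := ww_ne hs hs1 hr
  have h2 := one_add_ne hr
  rw [XX, qq, zt]; field_simp; ring

theorem norm_XX_sq (hs : 0 < s) (hs1 : s ≤ 1) {r : ℂ} (hr : ‖r‖ < 1) : ‖XX s r‖^2 = ‖r‖ * ‖qq s r‖ := by
  rw [← norm_pow, XX_sq hs hs1 hr, norm_mul]

theorem norm_XX_le (hs : 0 < s) (hs1 : s ≤ 1) {r : ℂ} (hr : ‖r‖ < 1) : ‖XX s r‖ ≤ ‖r‖ := by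
  apply (fun h h' => (pow_le_pow_iff_left₀ (norm_nonneg _) h' two_ne_zero).1 h) _ (norm_nonneg _)
  rw [norm_XX_sq hs hs1 hr]
  nlinarith [norm_qq_le hs hs1 hr, norm_nonneg r]

theorem norm_qq_le_XX (hs : 0 < s) (hs1 : s ≤ 1) {r : ℂ} (hr : ‖r‖ < 1) : ‖qq s r‖ ≤ ‖XX s r‖ := by
  apply (fun h h' => (pow_le_pow_iff_left₀ (norm_nonneg _) h' two_ne_zero).1 h) _ (norm_nonneg _)
  rw [norm_XX_sq hs hs1 hr]
  nlinarith [norm_qq_le hs hs1 hr, norm_nonneg (qq s r)]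

end

theorem kap_pos {α γ : ℝ} (hα : 0 ≤ α) (hγ : -1 < γ) (i : ℕ) : 0 < kap α γ i :=
  div_pos (poch_pos 𝔩 i) (poch_pos 𝔩 i)

theorem kap_submul {α γ : ℝ} (hα : 0 ≤ α) (hγ : -1 < γ) (m k : ℕ) : kap α γ (m+k) ≤ kap α γ m * kap α γ k := by
  rw [kap_add]
  apply mul_le_mul_of_nonneg_left _ (kap_pos hα hγ m).le
  rw [kap]
  simp only [poch]
  rw [← Finset.prod_div_distrib, ← Finset.prod_div_distrib]
  apply Finset.prod_le_prod
  · intro i _; positivity [show 0 < α+γ+2 by linarith]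
  · intro i _
    have h1 : (0:ℝ) ≤ i := by positivity
    have h2 : (0:ℝ) ≤ m := by positivity
    rw [div_le_div_iff₀ 𝔩 𝔩]
    nlinarith

noncomputable def gco (α γ : ℝ) (m k : ℕ) : ℝ := kap α γ (m+k) * (poch (γ+2) k / (k.factorial:ℝ))
theorem gco_nonneg {α γ : ℝ} (hα : 0 ≤ α) (hγ : -1 < γ) (m k : ℕ) : 0 ≤ gco α γ m k :=
  mul_nonneg (kap_pos hα hγ _).le (div_nonneg (poch_pos 𝔩 k).le 𝔭)
theorem gco_le {α γ : ℝ} (hα : 0 ≤ α) (hγ : -1 < γ) (m k : ℕ) : gco α γ m k ≤ kap α γ m * gco α γ 0 k := by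
  rw [gco, gco, zero_add, ← mul_assoc]
  exact mul_le_mul_of_nonneg_right (kap_submul hα hγ m k) (div_nonneg (poch_pos 𝔩 k).le 𝔭)
theorem gco_summable0 {α γ : ℝ} (hα : 0 ≤ α) (hγ : -1 < γ) {ρ : ℝ} (h0 : 0 ≤ ρ) (h1 : ρ < 1) :
    Summable (fun k => gco α γ 0 k * ρ^k) := by
  refine (hyp_summable (α+γ+2) (α+1) (γ+2) ρ 𝔩 𝔩 𝔩 h0 h1).congr ?_
  intro k; rw [gco, kap, zero_add, mul_div_mul_comm]
theorem gco_summable {α γ : ℝ} (hα : 0 ≤ α) (hγ : -1 < γ) (m : ℕ) {ρ : ℝ} (h0 : 0 ≤ ρ) (h1 : ρ < 1) :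
    Summable (fun k => gco α γ m k * ρ^k) := by
  refine Summable.of_nonneg_of_le (fun k => mul_nonneg (gco_nonneg hα hγ m k) 𝔭) (fun k => ?_)
    ((gco_summable0 hα hγ h0 h1).mul_left (kap α γ m))
  rw [← mul_assoc]
  exact mul_le_mul_of_nonneg_right (gco_le hα hγ m k) 𝔭

theorem ps_diff (a : ℕ → ℝ) (ha : ∀ k, 0 ≤ a k) (h : ∀ ρ : ℝ, 0 ≤ ρ → ρ < 1 → Summable (fun k => a k * ρ^k)) :
    DifferentiableOn ℂ (fun z : ℂ => ∑' k, ((a k : ℝ) : ℂ) * z^k) (Metric.ball 0 1) := by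
  intro z hz
  have hz' : ‖z‖ < 1 := by simpa using hz
  obtain ⟨ρ, h1, h2⟩ := exists_between hz'
  apply DifferentiableAt.differentiableWithinAt
  have : DifferentiableOn ℂ (fun z : ℂ => ∑' k, ((a k : ℝ) : ℂ) * z^k) (Metric.ball 0 ρ) := by
    apply Complex.differentiableOn_tsum_of_summable_norm (h ρ ((norm_nonneg z).trans h1.le) h2)
    · intro k; fun_prop
    · exact Metric.isOpen_ball
    · intro k w hw
      have : ‖w‖ < ρ := by simpa using hw
      rw [norm_mul, norm_pow, Complex.norm_real, norm_of_nonneg (ha k)]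
      gcongr
      exact ha k
  exact this.differentiableAt (Metric.isOpen_ball.mem_nhds (by simpa using h1))

noncomputable def Gm (α γ : ℝ) (m : ℕ) (z : ℂ) : ℂ := ∑' k, ((gco α γ m k : ℝ) : ℂ) * z^k
noncomputable def pref (a : ℝ) (s : ℝ) (r : ℂ) : ℂ := (1 + qq s r)^((a:ℝ):ℂ) * (1 + r)^(-((a:ℝ):ℂ))
noncomputable def Tm (α γ : ℝ) (m : ℕ) (s : ℝ) (r : ℂ) : ℂ := pref (α+γ+2) s r * (XX s r)^m * Gm α γ m (qq s r)

theorem pref_diff (a : ℝ) {s : ℝ} (hs : 0 < s) (hs1 : s ≤ 1) : DifferentiableOn ℂ (pref a s) (Metric.ball 0 1) := by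
  have key : ∀ z : ℂ, ‖z‖ < 1 → 1 + z ∈ Complex.slitPlane := by
    intro z hz
    left
    have := one_sub_re_pos (z := -z) (by simpa using hz)
    simpa using this
  apply DifferentiableOn.mul
  · apply DifferentiableOn.cpow
    · exact (qq_diff hs hs1).const_add _
    · fun_prop
    · intro r hr; exact key _ (norm_qq_lt hs hs1 (by simpa using hr))
  · apply DifferentiableOn.cpow
    · fun_prop
    · fun_prop
    · intro r hr; exact key _ (by simpa using hr)

theorem Tm_diff {α γ : ℝ} (hα : 0 ≤ α) (hγ : -1 < γ) (m : ℕ) {s : ℝ} (hs : 0 < s) (hs1 : s ≤ 1) :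
    DifferentiableOn ℂ (Tm α γ m s) (Metric.ball 0 1) := by
  apply DifferentiableOn.mul
  · exact (pref_diff _ hs hs1).mul ((XX_diff hs hs1).pow m)
  · have := ps_diff (gco α γ m) (gco_nonneg hα hγ m) (fun ρ h0 h1 => gco_summable hα hγ m h0 h1)
    exact this.comp (qq_diff hs hs1) (fun r hr => by simpa using norm_qq_lt hs hs1 (by simpa using hr))

noncomputable def tco (α γ : ℝ) (m : ℕ) (s : ℝ) (j : ℕ) : ℝ := if m ≤ j then kco α γ m (j-m) s * (√s)^m else 0

theorem Tm_hasSum {α γ : ℝ} (hα : 0 ≤ α) (hγ : -1 < γ) (m : ℕ) {s : ℝ} (hs : 0 < s) (hs1 : s ≤ 1) (z : ℂ) (hz : ‖z‖ < 1) :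
    HasSum (fun j => ((tco α γ m s j : ℝ):ℂ) * z^j) (Tm α γ m s z) := by
  apply ps_extend _ (Tm_diff hα hγ m hs hs1) _ (1/10) (by norm_num) _ z hz
  intro r hr hr1
  have hrn : ‖(r:ℂ)‖ < 1 := by rw [Complex.norm_real, norm_of_nonneg hr.le]; linarith
  set x := (1-r)/(1+r) with hx
  have hx0 : 0 < x := div_pos 𝔩 𝔩
  have hx1 : x < 1 := by rw [hx, div_lt_one 𝔩]; linarith
  have hzt : zt r = x := by rw [zt, hx]; push_cast; rfl
  have hB : 0 ≤ 1 - s + s*x^2 := by nlinarith [mul_pos hs (pow_pos hx0 2)]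
  set wr := √(1-s+s*x^2) with hwr
  have hw : ww s r = wr := by
    rw [ww, hzt, hwr, sqrt_eq_rpow, Complex.ofReal_cpow hB]
    push_cast; rfl
  have hwr1 : wr < 1 := by
    rw [hwr, sqrt_lt' one_pos]
    nlinarith [mul_pos hs (mul_pos (sub_pos.2 hx1) hx0), mul_pos hs (sub_pos.2 hx1)]
  have hwr0 : 0 ≤ wr := sqrt_nonneg _
  set q := (1-wr)/(1+wr) with hq
  have hqc : qq s r = q := by rw [qq, hw, hq]; push_cast; rfl
  have hq0 : 0 < q := div_pos 𝔩 𝔩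
  have hq1 : q < 1/10 := by
    have := norm_qq_le hs hs1 hrn
    rw [hqc, Complex.norm_real, Complex.norm_real, norm_of_nonneg hr.le, norm_of_nonneg hq0.le] at this
    linarith
  have hws : wr^2 = 1-s+s*x^2 := sq_sqrt hB
  have e : q/(1+q)^2 = s*r/(1+r)^2 := by
    have h1 : q/(1+q)^2 = (1-wr^2)/4 := by rw [hq]; field_simp; ring
    rw [h1, hws, hx]; field_simp; ring
  have h := Tm_real α γ hα hγ m s r q hs hs1 hr hr1 hq0 hq1 e
  have hT : Tm α γ m s r = (((1+q)^(α+γ+2) * (1+r)^(-(α+γ+2)) * (√s * r * (1+q)/(1+r))^m *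
        ∑' k, kap α γ (m+k) * (poch (γ+2) k / (k.factorial:ℝ)) * q^k : ℝ) : ℂ) := by
    rw [Tm, pref, XX_alt hs hs1 hrn, hqc, Gm]
    push_cast
    rw [Complex.ofReal_cpow 𝔩, Complex.ofReal_cpow 𝔩]
    push_cast
    simp only [gco]
    push_cast
    rfl
  rw [hT]
  have h' := Complex.hasSum_ofReal.2 h
  have hinj : Function.Injective (fun N : ℕ => m + N) := fun a b h => by simpa using h
  have hsup : ∀ x ∉ Set.range (fun N : ℕ => m + N), ((tco α γ m s x : ℝ):ℂ) * (r:ℂ)^x = 0 := by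
    intro j hj
    have : ¬ m ≤ j := fun h => hj ⟨j-m, by simp; omega⟩
    simp [tco, this]
  rw [← hinj.hasSum_iff hsup]
  refine hsc h' ?_
  intro N
  simp [tco]

theorem hasSum_circ {F : ℕ → ℝ → ℂ} {f : ℝ → ℂ} (u : ℕ → ℝ) (hu : Summable u) (hc : ∀ i, Continuous (F i))
    (hb : ∀ i θ, ‖F i θ‖ ≤ u i) (hf : ∀ θ, HasSum (fun i => F i θ) (f θ)) :
    HasSum (fun i => ∫ θ in (-π)..π, F i θ) (∫ θ in (-π)..π, f θ) := by
  apply intervalIntegral.hasSum_integral_of_dominated_convergence (fun i _ => u i)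
  · intro n; exact (hc n).aestronglyMeasurable
  · intro n; exact Eventually.of_forall (fun t _ => hb n t)
  · exact Eventually.of_forall (fun t _ => hu)
  · simp
  · exact Eventually.of_forall (fun t _ => hf t)

theorem orth (k : ℤ) : ∫ θ in (-π)..π, Complex.exp (k * (θ * Complex.I)) = if k = 0 then (2*π : ℂ) else 0 := by
  split_ifs with h
  · simp [h]; ring
  · have hk : (k:ℂ) * Complex.I ≠ 0 := mul_ne_zero (by exact_mod_cast h) Complex.I_ne_zero
    have := integral_exp_mul_complex (a := -π) (b := π) hk
    have e : ∀ θ : ℝ, Complex.exp (k * (θ * Complex.I)) = Complex.exp (k * Complex.I * θ) := by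
      intro θ; congr 1; ring
    simp_rw [e]
    rw [this, div_eq_zero_iff]; left
    rw [sub_eq_zero, Complex.exp_eq_exp_iff_exists_int]
    exact ⟨k, by push_cast; ring⟩

theorem orth_nat (n l : ℕ) : ∫ θ in (-π)..π, Complex.exp (θ * Complex.I)^n * Complex.exp (-(l * (θ * Complex.I))) =
    if n = l then (2*π : ℂ) else 0 := by
  have := orth ((n:ℤ) - l)
  have e : ∀ θ : ℝ, Complex.exp (θ * Complex.I)^n * Complex.exp (-(l * (θ * Complex.I))) = Complex.exp (((n:ℤ)-(l:ℤ) : ℤ) * (θ * Complex.I)) := by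
    intro θ
    rw [← Complex.exp_nat_mul, ← Complex.exp_add]; congr 1; push_cast; ring
  simp_rw [e]
  rw [this]
  congr 1
  simp [sub_eq_zero]

noncomputable def cz (R θ : ℝ) : ℂ := R * Complex.exp (θ * Complex.I)
theorem norm_cz {R : ℝ} (hR : 0 ≤ R) (θ : ℝ) : ‖cz R θ‖ = R := by
  rw [cz, norm_mul, norm_exp_I, Complex.norm_real, norm_of_nonneg hR, mul_one]
theorem cz_cont (R : ℝ) : Continuous (cz R) := by unfold cz; fun_prop

theorem norm_exp_neg (n : ℕ) (θ : ℝ) : ‖Complex.exp (-(n * (θ * Complex.I)))‖ = 1 := by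
  have := Complex.norm_exp_ofReal_mul_I (-(n*θ))
  rw [← this]; congr 2; push_cast; ring

theorem circ_coeff (a : ℕ → ℂ) (R : ℝ) (hR : 0 ≤ R) (ha : Summable (fun n => ‖a n‖ * R^n)) (f : ℝ → ℂ)
    (hf : ∀ θ, HasSum (fun n => a n * (cz R θ)^n) (f θ)) (l : ℕ) :
    ∫ θ in (-π)..π, f θ * Complex.exp (-(l * (θ * Complex.I))) = 2*π * R^l * a l := by
  have h := hasSum_circ (F := fun n θ => a n * (cz R θ)^n * Complex.exp (-(l * (θ * Complex.I))))
    (f := fun θ => f θ * Complex.exp (-(l * (θ * Complex.I)))) _ ha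
    (by intro i; have := cz_cont R; fun_prop)
    (by intro i θ; rw [norm_mul, norm_mul, norm_pow, norm_cz hR, norm_exp_neg, mul_one])
    (by intro θ; exact (hf θ).mul_right _)
  have e : ∀ n, ∫ θ in (-π)..π, a n * (cz R θ)^n * Complex.exp (-(l * (θ * Complex.I))) =
      if n = l then 2*π*R^l*a l else 0 := by
    intro n
    have e1 : ∀ θ : ℝ, a n * (cz R θ)^n * Complex.exp (-(l * (θ * Complex.I))) =
      (a n * R^n) * (Complex.exp (θ * Complex.I)^n * Complex.exp (-(l * (θ * Complex.I)))) := by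
      intro θ; rw [cz, mul_pow]; ring
    simp_rw [e1]
    rw [intervalIntegral.integral_const_mul, orth_nat]
    split_ifs with h
    · subst h; ring
    · simp
  simp_rw [e] at h
  exact h.unique (hasSum_ite_eq l _)

theorem Zm_summable {l : ℝ} (hl : 0 ≤ l) (ω : ℝ) {ρ : ℝ} (h0 : 0 ≤ ρ) (h1 : ρ < 1) :
    Summable (fun m => |Zm l m (cos ω)| * ρ^m) := by
  have h := (Zgf l hl ω ρ (by rw [Complex.norm_real, norm_of_nonneg h0]; exact h1)).summable.norm
  refine h.congr (fun m => ?_)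
  rw [norm_mul, norm_pow, Complex.norm_real, Complex.norm_real, norm_of_nonneg h0, norm_eq_abs]

theorem poch_ge_fact {a : ℝ} (ha : 1 ≤ a) (k : ℕ) : 1 ≤ poch a k / (k.factorial : ℝ) := by
  rw [le_div_iff₀ 𝔭, one_mul]
  induction k with
  | zero => simp [poch_zero]
  | succ k ih =>
    rw [poch_succ, Nat.factorial_succ]; push_cast
    have : (0:ℝ) < k.factorial := by positivity
    have hk : (0:ℝ) ≤ k := by positivity
    rw [mul_comm]
    apply mul_le_mul ih 𝔩 𝔭 𝔩

theorem kap_bdd {α γ : ℝ} (hα : 0 ≤ α) (hγ : -1 < γ) {ρ : ℝ} (h0 : 0 ≤ ρ) (h1 : ρ < 1) :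
    ∃ C, ∀ m, kap α γ m * ρ^m ≤ C := by
  have h := gco_summable0 hα hγ h0 h1
  refine ⟨∑' k, gco α γ 0 k * ρ^k, fun m => ?_⟩
  refine le_trans ?_ (h.le_tsum m (fun j _ => mul_nonneg (gco_nonneg hα hγ 0 j) 𝔭))
  rw [gco, zero_add]
  have := poch_ge_fact (a := γ+2) 𝔩 m
  apply mul_le_mul_of_nonneg_right _ 𝔭
  nlinarith [kap_pos hα hγ m]

theorem Zk_summable {α γ l : ℝ} (hα : 0 ≤ α) (hγ : -1 < γ) (hl : 0 ≤ l) (ω : ℝ) {ρ : ℝ} (h0 : 0 ≤ ρ) (h1 : ρ < 1) :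
    Summable (fun m => |Zm l m (cos ω)| * kap α γ m * ρ^m) := by
  obtain ⟨C, hC⟩ := kap_bdd hα hγ (ρ := √ρ) (sqrt_nonneg _) (by rw [sqrt_lt' one_pos]; simpa)
  have h := Zm_summable hl ω (ρ := √ρ) (sqrt_nonneg _) (by rw [sqrt_lt' one_pos]; simpa)
  refine Summable.of_nonneg_of_le (fun m => ?_) (fun m => ?_) (h.mul_left C)
  · have := (kap_pos hα hγ m).le; positivity
  · have e : ρ^m = (√ρ)^m * (√ρ)^m := by rw [← mul_pow, mul_self_sqrt h0]
    rw [e]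
    have := mul_le_mul_of_nonneg_right (hC m) (show 0 ≤ |Zm l m (cos ω)| * (√ρ)^m by positivity)
    calc _ = kap α γ m * (√ρ)^m * (|Zm l m (cos ω)| * (√ρ)^m) := by ring
      _ ≤ _ := this

noncomputable def hco (γ l ω : ℝ) (q X : ℂ) (i : ℕ) : ℂ :=
  ∑ m ∈ 𝔯 (i+1), ((Zm l m (cos ω) : ℝ) : ℂ) * X^m *
    (((poch (γ+2) (i-m) / ((i-m).factorial : ℝ) : ℝ) : ℂ) * q^(i-m))

noncomputable def FF (α γ l ω : ℝ) (q X : ℂ) : ℂ := ∑' i, ((kap α γ i : ℝ) : ℂ) * hco γ l ω q X i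

theorem FF_hasSum {α γ l : ℝ} (hα : 0 ≤ α) (hγ : -1 < γ) (hl : 0 ≤ l) (ω : ℝ) (q X : ℂ) (hq : ‖q‖ < 1) (hX : ‖X‖ < 1) :
    HasSum (fun m => ((Zm l m (cos ω) : ℝ) : ℂ) * (X^m * Gm α γ m q)) (FF α γ l ω q X) := by
  set f : ℕ × ℕ → ℂ := fun p => ((Zm l p.1 (cos ω) : ℝ) : ℂ) * X^p.1 * (((gco α γ p.1 p.2 : ℝ):ℂ) * q^p.2) with hf
  have hs : Summable f := by
    apply Summable.of_norm_bounded (g := fun p : ℕ × ℕ => (|Zm l p.1 (cos ω)| * kap α γ p.1 * ‖X‖^p.1) * (gco α γ 0 p.2 * ‖q‖^p.2))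
    · apply Summable.mul_of_nonneg (Zk_summable hα hγ hl ω (norm_nonneg X) hX) (gco_summable0 hα hγ (norm_nonneg q) hq)
      · intro m; have := (kap_pos hα hγ m).le; simp only [Pi.zero_apply]; positivity
      · intro m; exact mul_nonneg (gco_nonneg hα hγ 0 m) 𝔭
    · intro p
      rw [hf]
      simp only [norm_mul, norm_pow, Complex.norm_real, norm_eq_abs]
      rw [abs_of_nonneg (gco_nonneg hα hγ p.1 p.2)]
      have := mul_le_mul_of_nonneg_left (gco_le hα hγ p.1 p.2) (show 0 ≤ |Zm l p.1 (cos ω)| * ‖X‖^p.1 * ‖q‖^p.2 by positivity)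
      calc _ = |Zm l p.1 (cos ω)| * ‖X‖^p.1 * ‖q‖^p.2 * gco α γ p.1 p.2 := by ring
        _ ≤ _ := this
        _ = _ := by ring
  have h1 := hasSum_antidiag hs.hasSum
  have e1 : FF α γ l ω q X = ∑' p, f p := by
    rw [FF, ← h1.tsum_eq]
    congr 1; ext i
    rw [hco, Finset.mul_sum]
    apply Finset.sum_congr rfl
    intro m hm
    have : m + (i-m) = i := by have := Finset.mem_range.1 hm; omega
    simp only [hf, gco, this]
    push_cast; ring
  rw [e1]
  have h2 := hs.hasSum.prod_fiberwise (fun m => (hs.prod_factor m).hasSum)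
  refine hsc h2 (fun m => ?_)
  simp only [hf]
  rw [tsum_mul_left, Gm]; ring

theorem Gm_bound {α γ : ℝ} (hα : 0 ≤ α) (hγ : -1 < γ) (m : ℕ) (q : ℂ) {R : ℝ} (hq : ‖q‖ ≤ R) (hR : R < 1) :
    ‖Gm α γ m q‖ ≤ kap α γ m * ∑' k, gco α γ 0 k * R^k := by
  have hR0 := (norm_nonneg q).trans hq
  rw [Gm, ← tsum_mul_left]
  have hs := (gco_summable0 hα hγ hR0 hR).mul_left (kap α γ m)
  apply tsum_of_norm_bounded hs.hasSum
  intro k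
  rw [norm_mul, norm_pow, Complex.norm_real, norm_of_nonneg (gco_nonneg hα hγ m k), ← mul_assoc]
  have := gco_nonneg hα hγ 0 k
  have := kap_pos hα hγ m
  gcongr
  exact gco_le hα hγ m k

theorem Tm_bound {α γ : ℝ} (hα : 0 ≤ α) (hγ : -1 < γ) {s R : ℝ} (hs : 0 < s) (hs1 : s ≤ 1) (hR0 : 0 ≤ R) (hR : R < 1) :
    ∃ C, 0 ≤ C ∧ ∀ m θ, ‖Tm α γ m s (cz R θ)‖ ≤ C * (kap α γ m * R^m) := by
  have hc : Continuous (fun θ => pref (α+γ+2) s (cz R θ)) := by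
    rw [← continuousOn_univ]
    apply (pref_diff (α+γ+2) hs hs1).continuousOn.comp (cz_cont R).continuousOn
    intro θ _; simp [norm_cz hR0, hR]
  obtain ⟨C, hC⟩ : ∃ C, ∀ θ ∈ Icc (0:ℝ) (2*π), ‖pref (α+γ+2) s (cz R θ)‖ ≤ C :=
    isCompact_Icc.exists_bound_of_continuousOn hc.continuousOn
  have hC' : ∀ θ, ‖pref (α+γ+2) s (cz R θ)‖ ≤ C := by
    intro θ
    have hp : Function.Periodic (cz R) (2*π) := by
      intro θ; rw [cz, cz]; push_cast; rw [add_mul, Complex.exp_add, Complex.exp_two_pi_mul_I, mul_one]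
    obtain ⟨y, hy, h⟩ := hp.exists_mem_Ico₀ 𝔭 θ
    rw [h]; exact hC y (Ico_subset_Icc_self hy)
  have hC0 : 0 ≤ C := (norm_nonneg _).trans (hC' 0)
  have hG : 0 ≤ ∑' k, gco α γ 0 k * R^k := tsum_nonneg (fun k => mul_nonneg (gco_nonneg hα hγ 0 k) 𝔭)
  refine ⟨C * ∑' k, gco α γ 0 k * R^k, by positivity, fun m θ => ?_⟩
  have hr : ‖cz R θ‖ < 1 := by rw [norm_cz hR0]; exact hR
  rw [Tm, norm_mul, norm_mul, norm_pow]
  have h1 := hC' θ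
  have h2 := norm_XX_le hs hs1 hr
  rw [norm_cz hR0] at h2
  have h3 := Gm_bound hα hγ m (qq s (cz R θ)) (R := R) ((norm_qq_le hs hs1 hr).trans (norm_cz hR0 θ).le) hR
  calc _ ≤ C * R^m * (kap α γ m * ∑' k, gco α γ 0 k * R^k) := by gcongr
    _ = _ := by ring

theorem Kcoef (d : ℕ) (hd : 2 ≤ d) (β γ δ : ℝ) (hβ : -(1/2) ≤ β) (hγ : -1 < γ) (n : ℕ) (s ω R : ℝ)
    (hs : 0 < s) (hs1 : s ≤ 1) (hR0 : 0 ≤ R) (hR : R < 1) :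
    2*π*R^n * ((∑ j ∈ 𝔯 (n+1), binomC (δ-1) (n-j) * KnV0 d β γ j 1 s (cos ω) : ℝ) : ℂ) =
    ∫ θ in (-π)..π, ((1 - cz R θ)^(-(δ:ℂ)) * (pref (β+𝔡 d+γ+2) s (cz R θ) *
      FF (β+𝔡 d) γ (((d:ℝ)-2)/2) ω (qq s (cz R θ)) (XX s (cz R θ)))) * Complex.exp (-(n*(θ*Complex.I))) := by
  have hd' : (2:ℝ) ≤ d := by exact_mod_cast hd
  have hK : ∀ j, KnV0 d β γ j 1 s (cos ω) = _ := fun j => KnV0_eq d hd β γ hβ hγ j s (cos ω)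
  have hα : 0 ≤ β+𝔡 d := by linarith
  have hl : 0 ≤ ((d:ℝ)-2)/2 := by linarith
  set α := β+𝔡 d
  set l := ((d:ℝ)-2)/2
  have hcn : ∀ θ, ‖cz R θ‖ < 1 := fun θ => by rw [norm_cz hR0]; exact hR
  obtain ⟨C, hC0, hC⟩ := Tm_bound hα hγ hs hs1 hR0 hR
  set cc : ℕ → ℕ → ℝ := fun m n => ∑ j ∈ 𝔯 (n+1), tco α γ m s j * binomC (δ-1) (n-j) with hcc
  have hprod : ∀ m (z : ℂ), ‖z‖ < 1 → HasSum (fun n => ((cc m n : ℝ):ℂ) * z^n) ((1-z)^(-(δ:ℂ)) * Tm α γ m s z) := by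
    intro m z hz
    have h1 := Tm_hasSum hα hγ m hs hs1 z hz
    have h2 := binom_hasSum δ z hz
    have h3 := hasSum_sum_range_mul_of_summable_norm h1.summable.norm h2.summable.norm
    rw [h1.tsum_eq, h2.tsum_eq, mul_comm] at h3
    refine hsc h3 (fun n => ?_)
    rw [hcc]
    push_cast
    rw [Finset.sum_mul]
    apply Finset.sum_congr rfl
    intro j hj
    have : z^n = z^j * z^(n-j) := by rw [← pow_add]; congr 1; have := Finset.mem_range.1 hj; omega
    rw [this, binomC, show δ-1+1 = δ by ring]; push_cast; ring
  have hint : ∀ m, ∫ θ in (-π)..π, ((1 - cz R θ)^(-(δ:ℂ)) * Tm α γ m s (cz R θ)) * Complex.exp (-(n*(θ*Complex.I))) =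
      2*π*R^n * ((cc m n : ℝ):ℂ) := by
    intro m
    apply circ_coeff (fun n => ((cc m n : ℝ):ℂ)) R hR0
    · have := (hprod m R (by rw [Complex.norm_real, norm_of_nonneg hR0]; exact hR)).summable.norm
      refine this.congr (fun n => ?_)
      rw [norm_mul, norm_pow, Complex.norm_real R, norm_of_nonneg hR0]
    · intro θ; exact hprod m _ (hcn θ)
  have h1c : Continuous (fun θ => (1 - cz R θ)^(-(δ:ℂ))) := by
    have := diff_one_sub_cpow 1 (-(δ:ℂ)) (by simp)
    simp only [mul_one] at this
    rw [← continuousOn_univ]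
    apply this.continuousOn.comp (cz_cont R).continuousOn
    intro θ _; simp [norm_cz hR0, hR]
  obtain ⟨D, hD⟩ : ∃ D, ∀ θ, ‖(1 - cz R θ)^(-(δ:ℂ))‖ ≤ D := by
    refine ⟨∑' n, ‖((poch δ n / (n.factorial:ℝ) : ℝ) : ℂ) * (R:ℂ)^n‖, fun θ => ?_⟩
    have h0 := (binom_hasSum δ R (by rw [Complex.norm_real, norm_of_nonneg hR0]; exact hR)).summable.norm
    have := binom_hasSum δ (cz R θ) (hcn θ)
    rw [← this.tsum_eq]
    apply tsum_of_norm_bounded h0.hasSum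
    intro i
    simp only [norm_mul, norm_pow, norm_cz hR0, Complex.norm_real, norm_of_nonneg hR0, le_refl]
  have hD0 : 0 ≤ D := (norm_nonneg _).trans (hD 0)
  have hsum := hasSum_circ (F := fun m θ => ((Zm l m (cos ω) : ℝ):ℂ) * (((1 - cz R θ)^(-(δ:ℂ)) * Tm α γ m s (cz R θ)) * Complex.exp (-(n*(θ*Complex.I)))))
    (f := fun θ => ((1 - cz R θ)^(-(δ:ℂ)) * (pref (α+γ+2) s (cz R θ) *
      FF α γ l ω (qq s (cz R θ)) (XX s (cz R θ)))) * Complex.exp (-(n*(θ*Complex.I))))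
    (fun m => D * C * (|Zm l m (cos ω)| * kap α γ m * R^m))
    ((Zk_summable hα hγ hl ω hR0 hR).mul_left (D*C))
    (by
      intro m
      have : Continuous (fun θ => Tm α γ m s (cz R θ)) := by
        rw [← continuousOn_univ]
        apply (Tm_diff hα hγ m hs hs1).continuousOn.comp (cz_cont R).continuousOn
        intro θ _; simp [norm_cz hR0, hR]
      fun_prop)
    (by
      intro m θ
      rw [norm_mul, norm_mul, norm_mul, norm_exp_neg, Complex.norm_real, norm_eq_abs, mul_one]
      calc _ ≤ |Zm l m (cos ω)| * (D * (C * (kap α γ m * R^m))) := by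
            gcongr
            · exact hD θ
            · exact hC m θ
        _ = _ := by ring)
    (by
      intro θ
      have h := FF_hasSum hα hγ hl ω (qq s (cz R θ)) (XX s (cz R θ)) (norm_qq_lt hs hs1 (hcn θ)) ((norm_XX_le hs hs1 (hcn θ)).trans_lt (hcn θ))
      refine hsc (((h.mul_left (pref (α+γ+2) s (cz R θ))).mul_left ((1 - cz R θ)^(-(δ:ℂ)))).mul_right _) (fun m => ?_)
      rw [Tm]; ring)
  simp_rw [intervalIntegral.integral_const_mul, hint] at hsum
  have hfin := hasSum_sum_of_ne_finset_zero (L := SummationFilter.unconditional ℕ) (s := 𝔯 (n+1)) (f := fun m => ((Zm l m (cos ω) : ℝ):ℂ) * (2*π*R^n * ((cc m n : ℝ):ℂ))) (by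
    intro m hm
    have : cc m n = 0 := by
      rw [hcc]
      apply Finset.sum_eq_zero
      intro j hj
      have h1 := Finset.mem_range.1 hj
      have h2 : ¬ m < n+1 := by simpa using hm
      rw [tco, if_neg (by omega), zero_mul]
    rw [this]; simp)
  rw [hsum.unique hfin]
  have e : ∑ j ∈ 𝔯 (n+1), binomC (δ-1) (n-j) * KnV0 d β γ j 1 s (cos ω) =
      ∑ m ∈ 𝔯 (n+1), Zm l m (cos ω) * cc m n := by
    simp_rw [hcc, Finset.mul_sum]
    rw [Finset.sum_comm]
    apply Finset.sum_congr rfl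
    intro j hj
    have hj' := Finset.mem_range.1 hj
    rw [hK j, Finset.mul_sum]
    rw [← Finset.sum_subset (Finset.range_subset_range.2 (show j+1 ≤ n+1 by omega))]
    · apply Finset.sum_congr rfl
      intro m hm
      have := Finset.mem_range.1 hm
      rw [tco, if_pos (by omega)]; ring
    · intro m _ hm
      have : ¬ m < j+1 := by simpa using hm
      rw [tco, if_neg (by omega)]; ring
  rw [e]
  push_cast
  rw [Finset.mul_sum]
  apply Finset.sum_congr rfl
  intro m _; ring

theorem beta_cplx {a b x : ℝ} (hx : x ∈ 𝔦) :
    (x : ℂ) ^ ((a:ℂ) - 1) * (1 - (x : ℂ)) ^ ((b:ℂ) - 1) = ((x^(a-1) * (1-x)^(b-1) : ℝ) : ℂ) := by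
  rw [Complex.ofReal_mul, Complex.ofReal_cpow hx.1.le, Complex.ofReal_cpow (by linarith [hx.2])]
  push_cast; rfl

theorem beta_integrable {a b : ℝ} (ha : 0 < a) (hb : 0 < b) :
    IntegrableOn (fun x : ℝ => x^(a-1) * (1-x)^(b-1)) (Ioo 0 1) := by
  have h := Complex.betaIntegral_convergent (u := a) (v := b) (by simpa) (by simpa)
  rw [intervalIntegrable_iff_integrableOn_Ioo_of_le zero_le_one] at h
  have h2 := h.re
  refine IntegrableOn.congr_fun h2 (fun x hx => ?_) measurableSet_Ioo
  simp only [RCLike.re_eq_complex_re]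
  rw [beta_cplx hx, Complex.ofReal_re]

theorem beta_integral {a b : ℝ} (ha : 0 < a) (hb : 0 < b) :
    ∫ x in 𝔦, x^(a-1) * (1-x)^(b-1) = Gamma a * Gamma b / Gamma (a+b) := by
  have h := Complex.betaIntegral_eq_Gamma_mul_div a b (by simpa) (by simpa)
  rw [Complex.betaIntegral, intervalIntegral.integral_of_le zero_le_one, integral_Ioc_eq_integral_Ioo,
    setIntegral_congr_fun measurableSet_Ioo (fun x hx => beta_cplx hx), integral_complex_ofReal] at h
  rw [← Complex.ofReal_add, Complex.Gamma_ofReal, Complex.Gamma_ofReal, Complex.Gamma_ofReal] at h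
  exact_mod_cast h

theorem hco_smul (γ l ω : ℝ) (q X τ : ℂ) (i : ℕ) : hco γ l ω (τ*q) (τ*X) i = τ^i * hco γ l ω q X i := by
  unfold hco
  rw [Finset.mul_sum]
  apply Finset.sum_congr rfl
  intro m hm
  have : m + (i-m) = i := by have := Finset.mem_range.1 hm; omega
  conv_rhs => rw [← this, pow_add]
  simp only [add_tsub_cancel_left, mul_pow]
  ring

theorem hco_sum {γ l : ℝ} (hγ : -1 < γ) (hl : 0 ≤ l) (ω : ℝ) (q X : ℂ) (hq : ‖q‖ < 1) (hX : ‖X‖ < 1) :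
    Summable (fun i => ‖hco γ l ω q X i‖) ∧
    HasSum (hco γ l ω q X) (Zg l ω X * (1-q)^(-((γ+2:ℝ):ℂ))) := by
  have s1 : Summable (fun m => ‖((Zm l m (cos ω) : ℝ) : ℂ) * X^m‖) := by
    refine (Zm_summable hl ω (norm_nonneg X) hX).congr (fun m => ?_)
    simp
  have s2 : Summable (fun k => ‖((poch (γ+2) k / (k.factorial : ℝ) : ℝ) : ℂ) * q^k‖) := by
    have := (binom_hasSum_real (γ+2) ‖q‖ (by simpa using hq)).summable
    refine this.congr (fun k => ?_)
    rw [norm_mul, norm_pow, Complex.norm_real, norm_of_nonneg]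
    have := poch_pos (show 0 < γ+2 by linarith) k
    positivity
  refine ⟨(summable_norm_sum_mul_range_of_summable_norm s1 s2).congr (fun i => by rw [hco]), ?_⟩
  have := hasSum_sum_range_mul_of_summable_norm s1 s2
  rw [(Zgf l hl ω X hX).tsum_eq, (binom_hasSum (γ+2) q hq).tsum_eq] at this
  exact hsc this (fun i => by rw [hco])

theorem choose_diff_hasSum (h : ℕ → ℂ) (H : ℂ → ℂ) {v ρ : ℝ} (hv : 0 ≤ v) (hρ : 0 < ρ)
    (hs : Summable (fun i => ‖h i‖ * (v+ρ)^i)) (hH : ∀ τ : ℂ, ‖τ‖ ≤ v + ρ → HasSum (fun i => h i * τ^i) (H τ))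
    (B : ℝ) (hB : ∀ u : ℂ, ‖u‖ = ρ → ‖H (v+u)‖ ≤ B) (k : ℕ) :
    Summable (fun i => h i * ((i.choose k : ℝ) * v^(i-k) : ℝ)) ∧
    ‖∑' i, h i * ((i.choose k : ℝ) * v^(i-k) : ℝ)‖ ≤ ρ⁻¹^k * B := by
  have hn : ∀ θ, ‖(v:ℂ) + cz ρ θ‖ ≤ v + ρ := fun θ => by
    refine (norm_add_le _ _).trans ?_
    rw [norm_cz hρ.le, Complex.norm_real, norm_of_nonneg hv]
  have hH2 := hasSum_circ (F := fun i θ => h i * ((v:ℂ) + cz ρ θ)^i * Complex.exp (-(k * (θ * Complex.I))))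
    (f := fun θ => H (v + cz ρ θ) * Complex.exp (-(k * (θ * Complex.I)))) _ hs
    (by intro i; have := cz_cont ρ; fun_prop)
    (by
      intro i θ
      rw [norm_mul, norm_mul, norm_pow, norm_exp_neg, mul_one]
      gcongr
      exact hn θ)
    (by intro θ; exact (hH _ (hn θ)).mul_right _)
  have e : ∀ i, ∫ θ in (-π)..π, h i * ((v:ℂ) + cz ρ θ)^i * Complex.exp (-(k * (θ * Complex.I))) =
      (2*π*ρ^k : ℝ) * (h i * ((i.choose k : ℝ) * v^(i-k) : ℝ)) := by
    intro i
    have e1 : ∀ θ : ℝ, h i * ((v:ℂ) + cz ρ θ)^i * Complex.exp (-(k * (θ * Complex.I))) =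
        ∑ m ∈ 𝔯 (i+1), (h i * ρ^m * v^(i-m) * i.choose m) * (Complex.exp (θ * Complex.I)^m * Complex.exp (-(k * (θ * Complex.I)))) := by
      intro θ
      rw [add_comm (v:ℂ), add_pow, Finset.mul_sum, Finset.sum_mul]
      apply Finset.sum_congr rfl
      intro m _
      rw [cz, mul_pow]; ring
    simp_rw [e1]
    rw [intervalIntegral.integral_finsetSum (fun m _ => (Continuous.intervalIntegrable (by fun_prop) _ _))]
    simp_rw [intervalIntegral.integral_const_mul, orth_nat]
    simp only [mul_ite, mul_zero, Finset.sum_ite_eq', Finset.mem_range]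
    split_ifs with hk
    · push_cast; ring
    · rw [Nat.choose_eq_zero_of_lt (by omega)]; simp
  simp_rw [e] at hH2
  have hc : ((2*π*ρ^k : ℝ):ℂ) ≠ 0 := by
    have : 0 < 2*π*ρ^k := by positivity
    exact_mod_cast this.ne'
  have h3 := hH2.mul_left ((2*π*ρ^k : ℝ):ℂ)⁻¹
  have h4 := hsc h3 (f := fun i => h i * ((i.choose k : ℝ) * v^(i-k) : ℝ)) (fun i => by rw [inv_mul_cancel_left₀ hc])
  refine ⟨h4.summable, ?_⟩
  rw [h4.tsum_eq, norm_mul, norm_inv, Complex.norm_real, norm_of_nonneg 𝔭]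
  have := intervalIntegral.norm_integral_le_of_norm_le_const (a := -π) (b := π) (C := B)
    (f := fun θ => H (v + cz ρ θ) * Complex.exp (-(k * (θ * Complex.I)))) (by
      intro θ _
      rw [norm_mul, norm_exp_neg, mul_one]; exact hB _ (norm_cz hρ.le θ))
  rw [abs_of_nonneg (by linarith [pi_pos])] at this
  calc _ ≤ (2*π*ρ^k)⁻¹ * (B * (π - -π)) := by gcongr
    _ = _ := by have := pi_pos; rw [inv_pow]; field_simp; ring

noncomputable def Pn (l ω : ℝ) (x : ℂ) : ℝ :=
  ‖1-x^2‖ * (‖1-x*𝔢 ω‖ * ‖1-x*Complex.exp (-(ω*Complex.I))‖)^(-(l+1))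

theorem norm_Zg (l ω : ℝ) (x : ℂ) : ‖Zg l ω x‖ = Pn l ω x := by
  rw [Zg, Pn, norm_mul, norm_mul, ← Complex.ofReal_neg, Complex.norm_cpow_real, Complex.norm_cpow_real,
    mul_rpow (norm_nonneg _) (norm_nonneg _), mul_assoc]

theorem Pn_nonneg (l ω : ℝ) (x : ℂ) : 0 ≤ Pn l ω x := by unfold Pn; positivity

theorem near_le {a u : ℂ} {v x : ℝ} (hv : 0 ≤ v) (hx : x < 1) (ha : ‖a‖ ≤ x) (hu : ‖u‖ = (1-v*x)/2) (hvx : v*x < 1) :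
    ‖1-v*a‖/2 ≤ ‖1-(v+u)*a‖ ∧ ‖1-(v+u)*a‖ ≤ 3/2*‖1-v*a‖ := by
  have h1 : 1 - v*‖a‖ ≤ ‖1-v*a‖ := by
    have := norm_sub_norm_le (1:ℂ) (v*a)
    rwa [norm_one, norm_mul, Complex.norm_real, norm_of_nonneg hv] at this
  have h2 : ‖u*a‖ ≤ ‖1-v*a‖/2 := by
    rw [norm_mul, hu]
    have : v*‖a‖ ≤ v*x := by gcongr
    have h3 := norm_nonneg a
    nlinarith
  have e : 1-(v+u)*a = (1-v*a) - u*a := by ring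
  rw [e]
  constructor
  · have := norm_sub_norm_le (1-v*a) (u*a); linarith
  · have := norm_sub_le (1-v*a) (u*a); linarith

theorem vx_lt {v x : ℝ} (hv : 0 ≤ v) (hv1 : v ≤ 1) (h0 : 0 ≤ x) (hx : x < 1) : v*x < 1 := by nlinarith
theorem vrho_lt {v x : ℝ} (hv : 0 ≤ v) (hv1 : v ≤ 1) (h0 : 0 ≤ x) (hx : x < 1) : (v+(1-v*x)/2)*x < 1 := by
  have h1 : v*x*(1-x/2) ≤ x*(1-x/2) := by
    apply mul_le_mul_of_nonneg_right _ 𝔩; nlinarith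
  nlinarith

theorem H_near {γ l : ℝ} (hγ : -1 < γ) (hl : 0 ≤ l) (ω : ℝ) {q X u : ℂ} {v : ℝ} (hv : 0 ≤ v) (hv1 : v ≤ 1) (hqX : ‖q‖ ≤ ‖X‖) (hX : ‖X‖ < 1)
    (hu : ‖u‖ = (1-v*‖X‖)/2) :
    ‖Zg l ω ((v+u)*X) * (1-(v+u)*q)^(-((γ+2:ℝ):ℂ))‖ ≤
      (9/4 * (1/4)^(-(l+1)) * (1/2)^(-(γ+2))) * (‖1-v*q‖^(-(γ+2)) * Pn l ω (v*X)) := by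
  have hvx := vx_lt hv hv1 (norm_nonneg X) hX
  have hva : ∀ a : ℂ, ‖a‖ ≤ ‖X‖ → 0 < ‖1-v*a‖ := by
    intro a ha
    have := norm_sub_norm_le (1:ℂ) (v*a)
    rw [norm_one, norm_mul, Complex.norm_real, norm_of_nonneg hv] at this
    have : v*‖a‖ ≤ v*‖X‖ := by gcongr
    linarith
  rw [norm_mul, norm_Zg, ← Complex.ofReal_neg, Complex.norm_cpow_real]
  have n1 := near_le hv hX hqX hu hvx
  have b1 : ‖1-(v+u)*q‖^(-(γ+2)) ≤ (1/2)^(-(γ+2)) * ‖1-v*q‖^(-(γ+2)) := by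
    rw [← mul_rpow (by norm_num) (norm_nonneg _)]
    apply rpow_le_rpow_of_nonpos _ _ 𝔩
    · have := hva q hqX; positivity
    · linarith [n1.1]
  have e1 : ‖X * 𝔢 ω‖ ≤ ‖X‖ := by rw [norm_mul, norm_exp_I, mul_one]
  have e2 : ‖X * Complex.exp (-(ω*Complex.I))‖ ≤ ‖X‖ := by rw [norm_mul, norm_exp_neg_I, mul_one]
  have n2 := near_le hv hX e1 hu hvx
  have n3 := near_le hv hX e2 hu hvx
  have n4 := near_le hv hX le_rfl hu hvx
  have n5 := near_le (a := -X) hv hX (by rw [norm_neg]) hu hvx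
  have p2 := hva _ e1
  have p3 := hva _ e2
  have b2 : Pn l ω ((v+u)*X) ≤ 9/4 * (1/4)^(-(l+1)) * Pn l ω (v*X) := by
    unfold Pn
    have f1 : ‖1-((v+u)*X)^2‖ ≤ 9/4 * ‖1-(v*X)^2‖ := by
      have g1 : 1-((v+u)*X)^2 = (1-(v+u)*X)*(1-(v+u)*(-X)) := by ring
      have g2 : 1-(v*X)^2 = (1-v*X)*(1-v*(-X)) := by ring
      rw [g1, g2, norm_mul, norm_mul]
      calc _ ≤ (3/2*‖1-v*X‖) * (3/2*‖1-v*(-X)‖) := mul_le_mul n4.2 n5.2 (norm_nonneg _) 𝔭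
        _ = _ := by ring
    rw [mul_assoc (v+u), mul_assoc (v+u), mul_assoc (v:ℂ), mul_assoc (v:ℂ)]
    have f2 : (‖1-(v+u)*(X*𝔢 ω)‖ * ‖1-(v+u)*(X*Complex.exp (-(ω*Complex.I)))‖)^(-(l+1)) ≤
      (1/4)^(-(l+1)) * (‖1-v*(X*𝔢 ω)‖ * ‖1-v*(X*Complex.exp (-(ω*Complex.I)))‖)^(-(l+1)) := by
      rw [← mul_rpow (by norm_num) 𝔭]
      apply rpow_le_rpow_of_nonpos 𝔭 _ 𝔩
      calc _ = (‖1-v*(X*𝔢 ω)‖/2) * (‖1-v*(X*Complex.exp (-(ω*Complex.I)))‖/2) := by ring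
        _ ≤ _ := mul_le_mul n2.1 n3.1 𝔭 (norm_nonneg _)
    calc _ ≤ (9/4 * ‖1-(v*X)^2‖) * _ := mul_le_mul f1 f2 𝔭 𝔭
      _ = _ := by ring
  calc _ ≤ _ := mul_le_mul b2 b1 𝔭 (by have := Pn_nonneg l ω (v*X); positivity)
    _ = _ := by ring

theorem poch_neg_desc (i k : ℕ) : (-1)^k * poch (-(i:ℝ)) k = (k.factorial : ℝ) * (i.choose k : ℝ) := by
  have : (-1)^k * poch (-(i:ℝ)) k = (i.descFactorial k : ℝ) := by
    induction k with
    | zero => simp [poch_zero]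
    | succ k ih =>
      rw [poch_succ, Nat.descFactorial_succ, pow_succ]
      have : (-1)^k * (-1) * (poch (-(i:ℝ)) k * (-(i:ℝ)+k)) = ((-1)^k * poch (-(i:ℝ)) k) * ((i:ℝ)-k) := by ring
      rw [this, ih]
      rcases le_or_gt k i with h | h
      · rw [Nat.cast_mul, Nat.cast_sub h]; ring
      · rw [Nat.descFactorial_eq_zero_iff_lt.2 h]; simp
  rw [this, Nat.descFactorial_eq_factorial_mul_choose]; push_cast; ring

theorem poch_choose (a : ℝ) (N i : ℕ) (v : ℝ) : poch (a+i) N * v^i =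
    ∑ k ∈ 𝔯 (N+1), ((N.choose k : ℝ) * (k.factorial : ℝ) * poch (a+k) (N-k) * v^k) * ((i.choose k : ℝ) * v^(i-k)) := by
  have := vandermonde N (-(i:ℝ)) a
  rw [sub_neg_eq_add] at this
  rw [← this, Finset.sum_mul]
  apply Finset.sum_congr rfl
  intro k _
  rw [poch_neg_desc]
  rcases le_or_gt k i with h | h
  · have : v^i = v^k * v^(i-k) := by rw [← pow_add]; congr 1; omega
    rw [this]; ring
  · rw [Nat.choose_eq_zero_of_lt h]; simp

theorem Sv_bound {γ l α : ℝ} (hα : 0 ≤ α) (hγ : -1 < γ) (hl : 0 ≤ l) (N : ℕ) : ∃ C : ℝ, 0 ≤ C ∧ ∀ (ω : ℝ) (q X : ℂ) (v : ℝ), 0 ≤ v → v ≤ 1 →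
    ‖q‖ ≤ ‖X‖ → ‖X‖ < 1 →
    ‖∑' i : ℕ, ((poch (α+1+i) N * v^i : ℝ) : ℂ) * hco γ l ω q X i‖ ≤ C * ((1-v*‖X‖)^(-(N:ℝ)) * (‖1-v*q‖^(-(γ+2)) * Pn l ω (v*X))) := by
  set C0 : ℝ := (9/4 * (1/4)^(-(l+1)) * (1/2)^(-(γ+2))) with hC0
  set C1 : ℝ := ∑ k ∈ 𝔯 (N+1), ((N.choose k : ℝ) * (k.factorial : ℝ) * poch (α+1+k) (N-k)) with hC1
  have hpk : ∀ k : ℕ, 0 < poch (α+1+k) (N-k) := fun k => poch_pos 𝔭 _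
  have hC1' : 0 ≤ C1 := Finset.sum_nonneg (fun k _ => by have := hpk k; positivity)
  refine ⟨C1 * 2^N * C0, by positivity, ?_⟩
  intro ω q X v hv hv1 hqX hX
  have hvx := vx_lt hv hv1 (norm_nonneg X) hX
  have hvr := vrho_lt hv hv1 (norm_nonneg X) hX
  set ρ := (1-v*‖X‖)/2 with hρ
  have hρ0 : 0 < ρ := by rw [hρ]; linarith
  have hρ1 : ρ ≤ 1/2 := by rw [hρ]; have := mul_nonneg hv (norm_nonneg X); linarith
  set B := C0 * (‖1-v*q‖^(-(γ+2)) * Pn l ω (v*X)) with hB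
  have hB0 : 0 ≤ B := by have := Pn_nonneg l ω (v*X); positivity
  have sm : ∀ τ : ℂ, ‖τ‖ ≤ v+ρ → ‖τ*q‖ < 1 ∧ ‖τ*X‖ < 1 := by
    intro τ hτ
    rw [norm_mul, norm_mul]
    constructor
    · calc _ ≤ (v+ρ)*‖X‖ := by gcongr
        _ < 1 := hvr
    · calc _ ≤ (v+ρ)*‖X‖ := by gcongr
        _ < 1 := hvr
  have key := choose_diff_hasSum (hco γ l ω q X) (fun τ => Zg l ω (τ*X) * (1-τ*q)^(-((γ+2:ℝ):ℂ))) hv hρ0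
    (by
      have hn : ‖((v+ρ:ℝ):ℂ)‖ = v+ρ := by rw [Complex.norm_real, norm_of_nonneg 𝔭]
      have h := sm ((v+ρ:ℝ):ℂ) hn.le
      refine (hco_sum hγ hl ω _ _ h.1 h.2).1.congr (fun i => ?_)
      rw [hco_smul, norm_mul, norm_pow, hn]; ring)
    (by
      intro τ hτ
      have h := sm τ hτ
      refine hsc (hco_sum hγ hl ω _ _ h.1 h.2).2 (fun i => ?_)
      rw [hco_smul]; ring) B
    (by
      intro u hu
      exact H_near hγ hl ω hv hv1 hqX hX hu)
  have e : ∀ i : ℕ, ((poch (α+1+i) N * v^i : ℝ) : ℂ) * hco γ l ω q X i = ∑ k ∈ 𝔯 (N+1),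
      ((((N.choose k : ℝ) * (k.factorial : ℝ) * poch (α+1+k) (N-k) * v^k) : ℝ) : ℂ) * (hco γ l ω q X i * ((i.choose k : ℝ) * v^(i-k) : ℝ)) := by
    intro i
    rw [poch_choose, Complex.ofReal_sum, Finset.sum_mul]
    apply Finset.sum_congr rfl
    intro k _
    rw [Complex.ofReal_mul]; ring
  simp_rw [e]
  rw [Summable.tsum_finsetSum (fun k _ => (key k).1.mul_left _)]
  simp_rw [tsum_mul_left]
  have r1 : (1-v*‖X‖)^(-(N:ℝ)) = ρ⁻¹^N / 2^N := by
    rw [rpow_neg 𝔩, rpow_natCast, show 1-v*‖X‖ = 2*ρ by rw [hρ]; ring, mul_pow, inv_pow]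
    field_simp
  rw [r1]
  calc _ ≤ ∑ k ∈ 𝔯 (N+1), ((N.choose k : ℝ) * (k.factorial : ℝ) * poch (α+1+k) (N-k)) * (ρ⁻¹^N * B) := by
        refine (norm_sum_le _ _).trans (Finset.sum_le_sum fun k hk => ?_)
        have hk' : k ≤ N := by have := Finset.mem_range.1 hk; omega
        have := hpk k
        rw [norm_mul, Complex.norm_real, norm_of_nonneg 𝔭]
        have t1 : v^k ≤ 1 := pow_le_one₀ hv hv1
        have t2 : ρ⁻¹^k ≤ ρ⁻¹^N := pow_le_pow_right₀ (by rw [one_le_inv₀ hρ0]; linarith) hk'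
        have t3 := (key k).2
        calc _ ≤ ((N.choose k : ℝ) * (k.factorial : ℝ) * poch (α+1+k) (N-k) * 1) * (ρ⁻¹^N*B) := by
              gcongr
              exact t3.trans (by gcongr)
          _ = _ := by ring
    _ = C1 * (ρ⁻¹^N * B) := by rw [hC1, Finset.sum_mul]
    _ = _ := by rw [hB]; field_simp

theorem kap_formula {α γ : ℝ} (hα : 0 ≤ α) (hγ : -1 < γ) {N : ℕ} (hN : γ+1 < N) (i : ℕ) :
    kap α γ i = (Gamma (α+1) / (Gamma (α+γ+2) * Gamma (N-(γ+1)))) *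
      ∫ v in 𝔦, poch (α+1+i) N * (v^((α+γ+2+i)-1) * (1-v)^((N-(γ+1))-1)) := by
  have hi : (0:ℝ) ≤ i := Nat.cast_nonneg i
  rw [integral_const_mul, beta_integral 𝔩 𝔩, kap]
  have g1 := Gamma_add_nat (α+γ+2) 𝔩 i
  have g2 := Gamma_add_nat (α+1) 𝔩 i
  have g3 := Gamma_add_nat (α+1+i) 𝔩 N
  have e : α+γ+2+i+(N-(γ+1)) = α+1+i+N := by ring
  rw [e, g3, g1, g2]
  have p1 := Gamma_pos_of_pos (show 0 < α+γ+2 by linarith)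
  have p2 := Gamma_pos_of_pos (show 0 < α+1 by linarith)
  have p3 := Gamma_pos_of_pos (show 0 < N-(γ+1) by linarith)
  have p4 := poch_pos (show 0 < α+1+i by linarith) N
  have p5 := poch_pos (show 0 < α+1 by linarith) i
  generalize Gamma (α+γ+2) = G1 at *
  generalize Gamma (α+1) = G2 at *
  generalize Gamma (N-(γ+1)) = G3 at *
  generalize poch (α+1+i) N = P at *
  generalize poch (α+1) i = P2 at *
  field_simp

theorem pochN_summable {α γ l : ℝ} (hα : 0 ≤ α) (hγ : -1 < γ) (hl : 0 ≤ l) {N : ℕ} (hN : 0 < N) (ω : ℝ) (q X : ℂ) (hqX : ‖q‖ ≤ ‖X‖) (hX : ‖X‖ < 1) :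
    Summable (fun i : ℕ => poch (α+1+i) N * ‖hco γ l ω q X i‖) := by
  set ρ := 2/(1+‖X‖) with hρ
  have hx := norm_nonneg X
  have h1 : 1 < ρ := by rw [hρ, lt_div_iff₀ 𝔭]; linarith
  have h2 : ρ*‖X‖ < 1 := by rw [hρ, div_mul_eq_mul_div, div_lt_one 𝔭]; linarith
  have hn : ‖(ρ:ℂ)‖ = ρ := by rw [Complex.norm_real, norm_of_nonneg 𝔩]
  have s := (hco_sum hγ hl ω (ρ*q) (ρ*X) (by rw [norm_mul, hn]; nlinarith) (by rwa [norm_mul, hn])).1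
  have hN' : (0:ℝ) < N := by exact_mod_cast hN
  obtain ⟨C, hC⟩ := kap_bdd (γ := N-1) hα 𝔩 (show 0 ≤ ρ⁻¹ by positivity) (inv_lt_one_of_one_lt₀ h1)
  refine Summable.of_nonneg_of_le (fun i => ?_) (fun i => ?_) (s.mul_left (poch (α+1) N * C))
  · have := poch_pos (show 0 < α+1+i by positivity) N; positivity
  · rw [hco_smul, norm_mul, norm_pow, hn]
    have e : poch (α+1+i) N = poch (α+1) N * kap α (N-1) i := by
      rw [kap, show α+((N:ℝ)-1)+2 = α+1+N by ring]
      have p5 := poch_pos (show 0 < α+1 by linarith) i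
      have := poch_add (α+1) N i
      have h3 := poch_add (α+1) i N
      rw [add_comm i N, this] at h3
      field_simp
      linarith
    have h4 := hC i
    rw [inv_pow] at h4
    have p5 := poch_pos (show 0 < α+1 by linarith) N
    have h5 : kap α (N-1) i ≤ C * ρ^i := by
      rwa [mul_inv_le_iff₀ 𝔭] at h4
    rw [e]
    calc _ ≤ poch (α+1) N * (C*ρ^i) * ‖hco γ l ω q X i‖ := by gcongr
      _ = _ := by ring

theorem one_sub_v_le {q : ℂ} {v : ℝ} (hq : ‖q‖ < 1) (hv : 0 ≤ v) (hv1 : v ≤ 1) : ‖1-q‖/2 ≤ ‖1-v*q‖ := by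
  have h1 : 1 - v*‖q‖ ≤ ‖1-v*q‖ := by
    have := norm_sub_norm_le (1:ℂ) (v*q)
    rwa [norm_one, norm_mul, Complex.norm_real, norm_of_nonneg hv] at this
  have h2 : ‖1-q‖ ≤ ‖1-v*q‖ + (1-v)*‖q‖ := by
    have e : 1-q = (1-v*q) - ((1-v:ℝ):ℂ)*q := by push_cast; ring
    rw [e]
    refine (norm_sub_le _ _).trans ?_
    rw [norm_mul, Complex.norm_real, norm_of_nonneg 𝔩]
  nlinarith [norm_nonneg q]

theorem FF_bound {α γ l : ℝ} (hα : 0 ≤ α) (hγ : -1 < γ) (hl : 0 ≤ l) {N : ℕ} (hN : γ+1 < N) : ∃ C : ℝ, 0 ≤ C ∧ ∀ (ω : ℝ) (q X : ℂ),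
    ‖q‖ ≤ ‖X‖ → ‖X‖ < 1 →
    ‖FF α γ l ω q X‖ₑ ≤ 𝔬 (C * ‖1-q‖^(-(γ+2))) *
      ∫⁻ v in 𝔦, 𝔬 ((1-v)^((N-(γ+1))-1) * (1-v*‖X‖)^(-(N:ℝ)) * Pn l ω (v*X)) := by
  obtain ⟨C, hC0, hC⟩ := Sv_bound hα hγ hl N
  have p1 := Gamma_pos_of_pos (show 0 < α+γ+2 by linarith)
  have p2 := Gamma_pos_of_pos (show 0 < α+1 by linarith)
  have p3 := Gamma_pos_of_pos (show 0 < N-(γ+1) by linarith)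
  set c := Gamma (α+1) / (Gamma (α+γ+2) * Gamma (N-(γ+1))) with hc
  have hcp : 0 < c := by positivity
  refine ⟨c * (C * (1/2)^(-(γ+2))), by positivity, ?_⟩
  intro ω q X hqX hX
  have hN0 : 0 < N := by
    have : (0:ℝ) < N := by linarith
    exact_mod_cast this
  have hs := pochN_summable hα hγ hl hN0 ω q X hqX hX
  set S : ℝ → ℂ := fun v => ∑' i : ℕ, ((poch (α+1+i) N * v^i : ℝ) : ℂ) * hco γ l ω q X i with hS
  have hpk : ∀ i : ℕ, 0 < poch (α+1+i) N := fun k => poch_pos 𝔭 _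
  have hsS : ∀ v ∈ 𝔦, Summable (fun i : ℕ => ((poch (α+1+i) N * v^i : ℝ) : ℂ) * hco γ l ω q X i) := by
    intro v hv
    refine Summable.of_norm_bounded hs (fun i => ?_)
    have := hpk i
    have hv0 := hv.1.le
    rw [norm_mul, Complex.norm_real, norm_of_nonneg 𝔭]
    have : v^i ≤ 1 := pow_le_one₀ hv.1.le hv.2.le
    gcongr
    nlinarith
  have hrp : ∀ (i : ℕ) (v : ℝ), v ∈ 𝔦 → v^((α+γ+2+i)-1) = v^(α+γ+1) * v^i := by
    intro i v hv
    rw [show (α+γ+2+i)-1 = (α+γ+1) + (i:ℕ) by ring, rpow_add hv.1, rpow_natCast]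
  have H : HasSum (fun i : ℕ => ∫ v in 𝔦, ((poch (α+1+i) N * (v^((α+γ+2+i)-1) * (1-v)^((N-(γ+1))-1)) : ℝ) : ℂ) * hco γ l ω q X i)
      (∫ v in 𝔦, ((v^(α+γ+1) * (1-v)^((N-(γ+1))-1) : ℝ) : ℂ) * S v) := by
    apply hasSum_integral_of_dominated_convergence (fun (i:ℕ) v => (1-v)^((N-(γ+1))-1) * (poch (α+1+i) N * ‖hco γ l ω q X i‖))
    · intro i
      have : Measurable (fun v : ℝ => ((poch (α+1+i) N * (v^((α+γ+2+i)-1) * (1-v)^((N-(γ+1))-1)) : ℝ) : ℂ) * hco γ l ω q X i) := by fun_prop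
      exact this.aestronglyMeasurable
    · intro i
      refine (ae_restrict_mem measurableSet_Ioo).mono (fun v hv => ?_)
      have h1 : 0 < 1 - v := by linarith [hv.2]
      have := hpk i
      have hv0 := hv.1
      rw [norm_mul, Complex.norm_real, norm_of_nonneg 𝔭]
      have : v^((α+γ+2+i)-1) ≤ 1 := rpow_le_one hv.1.le hv.2.le (by
        have : (0:ℝ) ≤ i := Nat.cast_nonneg i
        linarith)
      calc _ ≤ poch (α+1+i) N * (1 * (1-v)^((N-(γ+1))-1)) * ‖hco γ l ω q X i‖ := by gcongr
        _ = _ := by ring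
    · exact Eventually.of_forall (fun v => hs.mul_left _)
    · simp_rw [tsum_mul_left]
      apply Integrable.mul_const
      have := beta_integrable (a := 1) one_pos (show 0 < N-(γ+1) by linarith)
      refine IntegrableOn.congr_fun this (fun v _ => ?_) measurableSet_Ioo
      simp
    · refine (ae_restrict_mem measurableSet_Ioo).mono (fun v hv => ?_)
      refine hsc ((hsS v hv).hasSum.mul_left ((v^(α+γ+1) * (1-v)^((N-(γ+1))-1) : ℝ) : ℂ)) (fun i => ?_)
      rw [hrp i v hv]; push_cast; ring
  have hFF : FF α γ l ω q X = (c:ℂ) * ∫ v in 𝔦, ((v^(α+γ+1) * (1-v)^((N-(γ+1))-1) : ℝ) : ℂ) * S v := by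
    rw [FF, ← (H.mul_left (c:ℂ)).tsum_eq]
    congr 1; ext i
    rw [integral_mul_const, kap_formula hα hγ hN i, ← hc, integral_complex_ofReal]
    push_cast; ring
  rw [hFF, enorm_mul]
  have hp : 0 ≤ ‖1-q‖ := norm_nonneg _
  have hqlt : ‖q‖ < 1 := hqX.trans_lt hX
  have h1q : 0 < ‖1-q‖ := by
    have := norm_sub_norm_le (1:ℂ) q
    rw [norm_one] at this; linarith
  calc _ ≤ 𝔬 c * ∫⁻ v in 𝔦, ‖((v^(α+γ+1) * (1-v)^((N-(γ+1))-1) : ℝ) : ℂ) * S v‖ₑ := by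
        gcongr
        · rw [← ofReal_norm, Complex.norm_real, norm_of_nonneg hcp.le]
        · exact enorm_integral_le_lintegral_enorm _
    _ ≤ 𝔬 c * ∫⁻ v in 𝔦, 𝔬 (C * (1/2)^(-(γ+2)) * ‖1-q‖^(-(γ+2))) *
          𝔬 ((1-v)^((N-(γ+1))-1) * (1-v*‖X‖)^(-(N:ℝ)) * Pn l ω (v*X)) := by
        refine mul_le_mul_right ?_ _
        apply setLIntegral_mono' measurableSet_Ioo
        intro v hv
        have h1 : 0 < 1 - v := by linarith [hv.2]
        have hv0 := hv.1
        rw [← ENNReal.ofReal_mul 𝔭, ← ofReal_norm]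
        apply ENNReal.ofReal_le_ofReal
        rw [norm_mul, Complex.norm_real, norm_of_nonneg 𝔭]
        have t1 : v^(α+γ+1) ≤ 1 := rpow_le_one hv.1.le hv.2.le 𝔩
        have t2 := hC ω q X v hv.1.le hv.2.le hqX hX
        have t3 : ‖1-v*q‖^(-(γ+2)) ≤ (1/2)^(-(γ+2)) * ‖1-q‖^(-(γ+2)) := by
          rw [← mul_rpow (by norm_num) (norm_nonneg _)]
          apply rpow_le_rpow_of_nonpos 𝔭 _ 𝔩
          have := one_sub_v_le hqlt hv.1.le hv.2.le
          linarith
        have t4 := Pn_nonneg l ω (v*X)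
        have t5 : 0 < 1 - v*‖X‖ := by have := vx_lt hv.1.le hv.2.le (norm_nonneg X) hX; linarith
        calc _ ≤ (1 * (1-v)^((N-(γ+1))-1)) * (C * ((1-v*‖X‖)^(-(N:ℝ)) * (((1/2)^(-(γ+2)) * ‖1-q‖^(-(γ+2))) * Pn l ω (v*X)))) := by
              gcongr
              exact t2.trans (by gcongr)
          _ = _ := by ring
    _ = _ := by
        rw [lintegral_const_mul' _ _ ENNReal.ofReal_ne_top, ← mul_assoc, ← ENNReal.ofReal_mul hcp.le]
        congr 2; ring

theorem lint_le {S : Set ℝ} {g G : ℝ → ℝ} {B : ℝ} (hS : MeasurableSet S) (hG : IntegrableOn G S)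
    (h : ∀ x ∈ S, g x ≤ G x) (h0 : ∀ x ∈ S, 0 ≤ G x) (hB : ∫ x in S, G x ≤ B) :
    ∫⁻ x in S, 𝔬 (g x) ≤ 𝔬 B := by
  calc _ ≤ ∫⁻ x in S, 𝔬 (G x) := setLIntegral_mono' hS (fun x hx => ENNReal.ofReal_le_ofReal (h x hx))
    _ = 𝔬 (∫ x in S, G x) := by
        rw [ofReal_integral_eq_lintegral_ofReal hG]
        exact (ae_restrict_mem hS).mono h0
    _ ≤ _ := ENNReal.ofReal_le_ofReal hB

theorem rpow_int_bound {p N η : ℝ} (hp : 0 < p) (hN : p < N) (hη : 0 < η) :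
    ∫⁻ t in Ioi (0:ℝ), 𝔬 (t^(p-1)*(η+t)^(-N)) ≤ 𝔬 ((1/p+1/(N-p))*η^(p-N)) := by
  have h1 : ∫⁻ t in Ioc 0 η, 𝔬 (t^(p-1)*(η+t)^(-N)) ≤ 𝔬 (1/p*η^(p-N)) := by
    have hi : IntervalIntegrable (fun x => x^(p-1)) volume 0 η := intervalIntegral.intervalIntegrable_rpow' 𝔩
    refine lint_le (G := fun t => t^(p-1)*η^(-N)) measurableSet_Ioc ?_ ?_ ?_ ?_
    · exact ((intervalIntegrable_iff_integrableOn_Ioc_of_le hη.le).1 hi).mul_const _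
    · intro t ht
      have := ht.1
      refine mul_le_mul_of_nonneg_left ?_ 𝔭
      exact rpow_le_rpow_of_nonpos hη 𝔩 𝔩
    · intro t ht; have := ht.1; positivity
    · rw [integral_mul_const, ← intervalIntegral.integral_of_le hη.le, integral_rpow (by left; linarith)]
      rw [sub_add_cancel, zero_rpow hp.ne', sub_zero, sub_eq_add_neg, rpow_add hη]
      apply le_of_eq; ring
  have h2 : ∫⁻ t in Ioi η, 𝔬 (t^(p-1)*(η+t)^(-N)) ≤ 𝔬 (1/(N-p)*η^(p-N)) := by
    have hlt : p-1-N < -1 := by linarith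
    refine lint_le (G := fun t => t^(p-1-N)) measurableSet_Ioi (integrableOn_Ioi_rpow_of_lt hlt hη) ?_ ?_ ?_
    · intro t ht
      have ht' : 0 < t := hη.trans ht
      rw [sub_eq_add_neg (p-1), rpow_add ht']
      refine mul_le_mul_of_nonneg_left ?_ 𝔭
      exact rpow_le_rpow_of_nonpos ht' 𝔩 𝔩
    · intro t ht; have ht' : 0 < t := hη.trans ht; positivity
    · rw [integral_Ioi_rpow_of_lt hlt hη, show p-1-N+1 = -(N-p) by ring, neg_div_neg_eq, show -(N-p) = p-N by ring]
      apply le_of_eq; ring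
  have hu : Ioi (0:ℝ) = Ioc 0 η ∪ Ioi η := (Ioc_union_Ioi_eq_Ioi hη.le).symm
  have hNp : 0 < N-p := by linarith
  rw [hu, add_mul, ENNReal.ofReal_add 𝔭 𝔭]
  exact (lintegral_union_le _ _ _).trans (add_le_add h1 h2)

theorem circ_sq (x : ℂ) (hx : ‖x‖ < 1) : ∫⁻ ω in Ioo (0:ℝ) π, 𝔬 (1/‖1-x*𝔢 ω‖^2) ≤
    𝔬 (2*π/(1-‖x‖)) := by
  have hz : ∀ ω : ℝ, ‖x*𝔢 ω‖ = ‖x‖ := fun ω => by rw [norm_mul, norm_exp_I, mul_one]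
  have hne : ∀ ω : ℝ, 1-x*𝔢 ω ≠ 0 := fun ω => one_sub_ne (by rw [hz]; exact hx)
  have h1x : 0 < 1 - ‖x‖^2 := by nlinarith [norm_nonneg x]
  -- mean value
  have hm := hasSum_circ (F := fun i ω => (x * 𝔢 ω)^i) (f := fun ω => (1 - x*𝔢 ω)⁻¹)
    (fun i => ‖x‖^i) (summable_geometric_of_lt_one (norm_nonneg x) hx) (by intro i; fun_prop)
    (by intro i θ; rw [norm_pow, hz]) (by intro θ; exact hasSum_geometric_of_norm_lt_one (by rw [hz]; exact hx))
  have e0 : ∀ i : ℕ, ∫ θ in (-π)..π, (x * Complex.exp (θ*Complex.I))^i = if i = 0 then (2*π:ℂ) else 0 := by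
    intro i
    have := orth_nat i 0
    simp only [Nat.cast_zero, zero_mul, neg_zero, Complex.exp_zero, mul_one] at this
    simp_rw [mul_pow]
    rw [intervalIntegral.integral_const_mul, this]
    split_ifs with h <;> simp [h]
  simp_rw [e0] at hm
  have hm2 : ∫ ω in (-π)..π, (1 - x*𝔢 ω)⁻¹ = (2*π:ℂ) := by
    have := (hasSum_ite_eq 0 (2*π:ℂ)).unique hm
    exact this.symm
  have hcont : Continuous (fun ω : ℝ => (1 - x*𝔢 ω)⁻¹) := Continuous.inv₀ (by fun_prop) hne
  have hP : ∀ ω : ℝ, 1/‖1-x*𝔢 ω‖^2 = (2 * ((1 - x*𝔢 ω)⁻¹).re - 1)/(1-‖x‖^2) := by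
    intro ω
    rw [← hz ω] at h1x ⊢
    have h2 := hne ω
    generalize x*𝔢 ω = z at *
    have h3 : 0 < Complex.normSq (1-z) := Complex.normSq_pos.2 h2
    rw [Complex.inv_re, ← Complex.normSq_eq_norm_sq, ← Complex.normSq_eq_norm_sq] at *
    have h4 : Complex.normSq (1-z) = 1 - 2*z.re + Complex.normSq z := by
      rw [Complex.normSq_apply, Complex.normSq_apply]; simp; ring
    have h5 : (1-z).re = 1 - z.re := by simp
    rw [h5]
    rw [div_eq_div_iff h3.ne' h1x.ne', sub_mul, mul_assoc, div_mul_cancel₀ _ h3.ne', h4]; ring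
  have hc2 : Continuous (fun ω : ℝ => 1/‖1-x*𝔢 ω‖^2) := by
    refine Continuous.div continuous_const (by fun_prop) (fun ω => ?_)
    have := norm_pos_iff.2 (hne ω); positivity
  have hint : ∫ ω in (-π)..π, 1/‖1-x*𝔢 ω‖^2 = 2*π/(1-‖x‖^2) := by
    simp_rw [hP]
    rw [intervalIntegral.integral_div, intervalIntegral.integral_sub, intervalIntegral.integral_const_mul]
    · have : ∫ ω in (-π)..π, ((1 - x*𝔢 ω)⁻¹).re = 2*π := by
        have h := intervalIntegral.intervalIntegral_re (hcont.intervalIntegrable (μ := volume) (-π) π) (𝕜 := ℂ)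
        simp only [RCLike.re_eq_complex_re] at h
        rw [h, hm2]; simp
      rw [this]; simp; ring
    · exact (Continuous.intervalIntegrable (by have := Complex.continuous_re.comp hcont; simp only [Function.comp_def] at this; fun_prop) _ _)
    · simp
  refine (lintegral_mono_set (t := Ioc (-π) π) (fun w hw => ⟨by linarith [hw.1, pi_pos], hw.2.le⟩)).trans ?_
  refine lint_le measurableSet_Ioc (hc2.integrableOn_Ioc) (fun w _ => le_rfl) (fun w _ => by positivity) ?_
  rw [← intervalIntegral.integral_of_le (by linarith [pi_pos]), hint]
  have hpi := pi_pos
  have h6 : 0 < 1-‖x‖ := by linarith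
  gcongr
  nlinarith [norm_nonneg x]

theorem norm_exp_sub_one (ω : ℝ) : ‖1 - 𝔢 ω‖^2 = 2*(1-cos ω) ∧ ‖1 - Complex.exp (-(ω*Complex.I))‖^2 = 2*(1-cos ω) := by
  have h : ∀ t : ℝ, ‖1 - Complex.exp (t*Complex.I)‖^2 = 2*(1-cos t) := by
    intro t
    rw [← Complex.normSq_eq_norm_sq, Complex.normSq_apply, Complex.exp_mul_I, ← Complex.ofReal_cos, ← Complex.ofReal_sin]
    simp only [Complex.sub_re, Complex.one_re, Complex.add_re, Complex.mul_re, Complex.ofReal_re, Complex.ofReal_im, Complex.I_re, Complex.I_im, Complex.sub_im, Complex.one_im, Complex.add_im, Complex.mul_im]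
    have := sin_sq_add_cos_sq t
    nlinarith
  refine ⟨h ω, ?_⟩
  have := h (-ω)
  rw [cos_neg] at this
  rw [← this]; congr 3; push_cast; ring_nf

theorem amgm {a t : ℝ} (ha : 0 < a) (ht : 0 < t) : 1/a ≤ (t*(1/a^2)+1/t)/2 := by
  have : (t*(1/a^2)+1/t)/2 - 1/a = (t-a)^2/(2*t*a^2) := by field_simp; ring
  have h2 : 0 ≤ (t-a)^2/(2*t*a^2) := by positivity
  linarith

theorem pt_core {a b u L ω κ t D : ℝ} (ha : 0 < a) (hb : 0 < b) (hu : 0 < u) (hL : 0 < L) (ht : 0 < t)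
    (hω : 0 < ω) (hκ : 0 ≤ κ) (hκ1 : κ ≤ 1/4) (hωu : ω ≤ 1.6*u) (hD1 : D ≤ a+b) (hD2 : D ≤ 2*L)
    (hcase : u ≤ 4*L ∨ (4*L < u ∧ u ≤ 4*a ∧ u ≤ 4*b)) :
    D/(a*b) * u^(2*κ) ≤ 300 * L^(2*κ) * (t*(1/a^2+1/b^2) + (L^(3/2:ℝ)/t+L^(1/2:ℝ))*(L+ω)^(-(3/2):ℝ)) := by
  have hLω : 0 < L+ω := by positivity
  have e8 : (64:ℝ)^(3/2:ℝ) = 512 := by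
    rw [show (64:ℝ) = 8^(2:ℝ) by norm_num, ← rpow_mul (by norm_num)]; norm_num
  rcases hcase with hc | ⟨hc, hca, hcb⟩
  · have h1 : D/(a*b) ≤ t*(1/a^2+1/b^2)/2 + 1/t := by
      calc D/(a*b) ≤ (a+b)/(a*b) := by gcongr
        _ = 1/a+1/b := by field_simp; ring
        _ ≤ _ := by have := amgm ha ht; have := amgm hb ht; linarith
    have h2 : u^(2*κ) ≤ 2 * L^(2*κ) := by
      calc u^(2*κ) ≤ (4*L)^(2*κ) := rpow_le_rpow hu.le hc 𝔩
        _ = 4^(2*κ) * L^(2*κ) := mul_rpow (by norm_num) hL.le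
        _ ≤ 4^(1/2:ℝ) * L^(2*κ) := by gcongr <;> linarith
        _ = 2 * L^(2*κ) := by
          congr 1
          rw [show (4:ℝ) = 2^(2:ℝ) by norm_num, ← rpow_mul (by norm_num)]; norm_num
    have h3 : 1 ≤ 27*(L^(3/2:ℝ) * (L+ω)^(-(3/2):ℝ)) := by
      have g : (L+ω) ≤ 8*L := by linarith
      have g2 : (L+ω)^(3/2:ℝ) ≤ 27 * L^(3/2:ℝ) := by
        calc _ ≤ (9*L)^(3/2:ℝ) := rpow_le_rpow hLω.le 𝔩 (by norm_num)
          _ = 9^(3/2:ℝ) * L^(3/2:ℝ) := mul_rpow (by norm_num) hL.le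
          _ = _ := by
            congr 1
            rw [show (9:ℝ) = 3^(2:ℝ) by norm_num, ← rpow_mul (by norm_num)]; norm_num
      rw [rpow_neg hLω.le, ← mul_assoc, ← div_eq_mul_inv, le_div_iff₀ 𝔭]
      linarith
    have h4 : 1/t ≤ 27*((L^(3/2:ℝ)/t)*(L+ω)^(-(3/2):ℝ)) := by
      calc 1/t ≤ (27*(L^(3/2:ℝ) * (L+ω)^(-(3/2):ℝ)))/t := by gcongr
        _ = _ := by ring
    have p1 : 0 ≤ L^(1/2:ℝ) * (L+ω)^(-(3/2):ℝ) := by positivity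
    have p2 : 0 ≤ t*(1/a^2+1/b^2) := by positivity
    have p3 : 0 ≤ (L^(3/2:ℝ)/t)*(L+ω)^(-(3/2):ℝ) := by positivity
    calc _ ≤ (t*(1/a^2+1/b^2)/2 + 1/t) * (2*L^(2*κ)) := by gcongr
      _ ≤ (150*(t*(1/a^2+1/b^2) + (L^(3/2:ℝ)/t+L^(1/2:ℝ))*(L+ω)^(-(3/2):ℝ))) * (2*L^(2*κ)) := by
        gcongr
        rw [add_mul]
        linarith
      _ = _ := by ring
  · have h1 : D/(a*b) ≤ 32 * L / u^2 := by
      calc D/(a*b) ≤ (2*L)/((u/4)*(u/4)) := by gcongr <;> linarith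
        _ = _ := by field_simp; ring
    have h2 : u^(2*κ)/u^2 ≤ (L^(2*κ) * L^(-(1/2):ℝ)) * (8 * (L+ω)^(-(3/2):ℝ)) := by
      have e : u^(2*κ)/u^2 = u^(2*κ-1/2) * u^(-(3/2):ℝ) := by
        rw [← rpow_natCast u 2, ← rpow_sub hu, ← rpow_add hu]; congr 1; push_cast; ring
      rw [e, ← rpow_add hL]
      have g1 : u^(2*κ-1/2) ≤ L^(2*κ + -(1/2)) := by
        rw [← sub_eq_add_neg]
        exact rpow_le_rpow_of_nonpos hL 𝔩 𝔩
      have g2 : u^(-(3/2):ℝ) ≤ 8 * (L+ω)^(-(3/2):ℝ) := by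
        calc _ ≤ ((1/4)*(L+ω))^(-(3/2):ℝ) := rpow_le_rpow_of_nonpos 𝔭 𝔩 (by norm_num)
          _ = (1/4)^(-(3/2):ℝ) * (L+ω)^(-(3/2):ℝ) := mul_rpow (by norm_num) hLω.le
          _ = _ := by
            congr 1
            rw [show (1/4:ℝ) = 2^(-2:ℝ) by rw [rpow_neg (by norm_num)]; norm_num, ← rpow_mul (by norm_num)]; norm_num
      exact mul_le_mul g1 g2 𝔭 𝔭
    have e2 : L * L^(-(1/2):ℝ) = L^(1/2:ℝ) := by
      nth_rw 1 [← rpow_one L]; rw [← rpow_add hL]; norm_num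
    have p2 : 0 ≤ t*(1/a^2+1/b^2) := by positivity
    have p3 : 0 ≤ (L^(3/2:ℝ)/t)*(L+ω)^(-(3/2):ℝ) := by positivity
    calc _ ≤ 32 * L / u^2 * u^(2*κ) := by gcongr
      _ = 32 * L * (u^(2*κ)/u^2) := by ring
      _ ≤ 32 * L * ((L^(2*κ) * L^(-(1/2):ℝ)) * (8 * (L+ω)^(-(3/2):ℝ))) := by gcongr
      _ = 256 * L^(2*κ) * ((L * L^(-(1/2):ℝ)) * (L+ω)^(-(3/2):ℝ)) := by ring
      _ ≤ _ := by
        rw [e2]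
        have p1 : 0 ≤ L^(1/2:ℝ) * (L+ω)^(-(3/2):ℝ) := by positivity
        have p4 : 0 < L^(2*κ) := by positivity
        rw [mul_comm 256, mul_assoc, mul_comm 300, mul_assoc]
        apply mul_le_mul_of_nonneg_left _ p4.le
        rw [add_mul]; linarith

set_option maxHeartbeats 1000000 in
theorem Pn_pt {l κ : ℝ} (hl : 0 ≤ l) (hκ : 0 ≤ κ) (hκ1 : κ ≤ 1/4) {x : ℂ} (hx : ‖x‖ < 1) {ω : ℝ} (hω : ω ∈ Ioo 0 π) {t : ℝ} (ht : 0 < t) :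
    Pn l ω x * ((1-cos ω)^κ * (sin ω)^(2*l)) ≤ (8*(‖1-x‖/(1-‖x‖)))^l * (300 * ‖1-x‖^(2*κ) *
      (t*(1/‖1-x*𝔢 ω‖^2+1/‖1-x*Complex.exp (-(ω*Complex.I))‖^2) +
        (‖1-x‖^(3/2:ℝ)/t+‖1-x‖^(1/2:ℝ))*(‖1-x‖+ω)^(-(3/2):ℝ))) := by
  have hn1 := norm_exp_I ω
  have hn2 := norm_exp_neg_I ω
  have hu1 := (norm_exp_sub_one ω).1
  have hu2 := (norm_exp_sub_one ω).2
  set E := 𝔢 ω with hE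
  set E' := Complex.exp (-(ω*Complex.I)) with hE'
  have hEE : E*E' = 1 := by rw [hE, hE', ← Complex.exp_add]; simp
  have hdiff : ‖E - E'‖ = 2*sin ω := by
    have e : E - E' = ((2*sin ω : ℝ):ℂ)*Complex.I := by
      rw [hE, hE', Complex.exp_mul_I, show -((ω:ℂ)*Complex.I) = ((-ω:ℝ):ℂ)*Complex.I by push_cast; ring, Complex.exp_mul_I]
      push_cast; rw [Complex.cos_neg, Complex.sin_neg]; ring
    rw [e, norm_mul, Complex.norm_I, mul_one, Complex.norm_real, norm_of_nonneg]
    have := sin_pos_of_mem_Ioo hω; positivity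
  have hs := sin_pos_of_mem_Ioo hω
  unfold Pn
  rw [← hE, ← hE']
  set a := ‖1-x*E‖ with ha
  set b := ‖1-x*E'‖ with hb
  set L := ‖1-x‖ with hL
  have hx0 := norm_nonneg x
  have low : ∀ z : ℂ, ‖z‖ = 1 → 1-‖x‖ ≤ ‖1-x*z‖ := by
    intro z hz
    have := norm_sub_norm_le (1:ℂ) (x*z)
    rwa [norm_one, norm_mul, hz, mul_one] at this
  have ha0 := low E hn1
  have hb0 := low E' hn2
  have hL0 : 1-‖x‖ ≤ L := by have := low 1 norm_one; rwa [mul_one] at this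
  rw [← ha] at ha0
  rw [← hb] at hb0
  set h := 1-‖x‖ with hh
  have hh0 : 0 < h := by rw [hh]; linarith
  have hap : 0 < a := by linarith
  have hbp : 0 < b := by linarith
  have hLp : 0 < L := by linarith
  set u := 2*sin (ω/2) with hu
  have hsin2 : 0 < sin (ω/2) := sin_pos_of_mem_Ioo ⟨by linarith [hω.1], by linarith [hω.2, hω.1]⟩
  have hup : 0 < u := by rw [hu]; positivity
  have hcos : 1 - cos ω = u^2/2 := by
    have := cos_two_mul (ω/2)
    rw [mul_div_cancel₀ _ (two_ne_zero)] at this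
    have h2 := sin_sq_add_cos_sq (ω/2)
    rw [hu]; linarith
  have hu1' : ‖1-E‖ = u := by
    rw [hcos] at hu1
    have : ‖1-E‖^2 = u^2 := by rw [hu1]; ring
    exact (pow_left_inj₀ (norm_nonneg _) hup.le two_ne_zero).1 this
  have hu2' : ‖1-E'‖ = u := by
    rw [hcos] at hu2
    have : ‖1-E'‖^2 = u^2 := by rw [hu2]; ring
    exact (pow_left_inj₀ (norm_nonneg _) hup.le two_ne_zero).1 this
  have xu1 : ‖x‖*u ≤ L + a := by
    have e : x*(1-E) = (1-x*E) - (1-x) := by ring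
    rw [← hu1', ← norm_mul, e]
    have := norm_sub_le (1-x*E) (1-x); linarith
  have xu2 : ‖x‖*u ≤ L + b := by
    have e : x*(1-E') = (1-x*E') - (1-x) := by ring
    rw [← hu2', ← norm_mul, e]
    have := norm_sub_le (1-x*E') (1-x); linarith
  have au : a ≤ L + ‖x‖*u := by
    have e : 1-x*E = (1-x) + x*(1-E) := by ring
    rw [ha, e, ← hu1', ← norm_mul]; exact norm_add_le _ _
  have bu : b ≤ L + ‖x‖*u := by
    have e : 1-x*E' = (1-x) + x*(1-E') := by ring
    rw [hb, e, ← hu2', ← norm_mul]; exact norm_add_le _ _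
  have hΛ : 1 ≤ L/h := by rw [one_le_div hh0]; exact hL0
  have rat : (sin ω)^2/(a*b) ≤ 8*(L/h) := by
    rcases lt_or_ge ‖x‖ (1/2) with hlt | hge
    · have h1 : (sin ω)^2 ≤ 1 := Real.sin_sq_le_one ω
      have h2 : (1/2:ℝ)*(1/2) ≤ a*b := mul_le_mul 𝔩 𝔩 (by norm_num) hap.le
      rw [div_le_iff₀ 𝔭]
      linarith [mul_le_mul hΛ h2 (by norm_num) 𝔭]
    · have h1 : sin ω ≤ a+b := by
        have e : x*(E-E') = (1-x*E') - (1-x*E) := by ring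
        have g : ‖x‖*(2*sin ω) ≤ a + b := by
          rw [← hdiff, ← norm_mul, e]
          have := norm_sub_le (1-x*E') (1-x*E); linarith
        linarith [mul_le_mul_of_nonneg_right hge hs.le]
      have h2 : (a+b)^2/(a*b) = a/b+b/a+2 := by field_simp; ring
      have h3 : a/b ≤ 3*(L/h) := by
        have g : a/b ≤ 1+2*(L/b) := by
          have : 1+2*(L/b) = (b+2*L)/b := by field_simp
          rw [this]; gcongr; linarith
        have g2 : L/b ≤ L/h := by gcongr
        linarith
      have h4 : b/a ≤ 3*(L/h) := by
        have g : b/a ≤ 1+2*(L/a) := by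
          have : 1+2*(L/a) = (a+2*L)/a := by field_simp
          rw [this]; gcongr; linarith
        have g2 : L/a ≤ L/h := by gcongr
        linarith
      calc _ ≤ (a+b)^2/(a*b) := by gcongr
        _ ≤ _ := by rw [h2]; linarith
  have hD1 : ‖1-x^2‖ ≤ a+b := by
    have e : 1-x^2 = (1-x*E) + x*E*(1-x*E') := by linear_combination x^2*hEE
    rw [e]
    refine (norm_add_le _ _).trans ?_
    rw [norm_mul, norm_mul, hn1, ← ha, ← hb]
    have : ‖x‖*1*b ≤ 1*1*b := by gcongr
    linarith
  have hD2 : ‖1-x^2‖ ≤ 2*L := by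
    have e : 1-x^2 = (1+x)*(1-x) := by ring
    rw [e, norm_mul]
    have := norm_add_le (1:ℂ) x
    rw [norm_one] at this
    gcongr
    linarith
  have hωu : ω ≤ 1.6*u := by
    have := mul_le_sin (x := ω/2) (by linarith [hω.1]) (by linarith [hω.2])
    have h2 : ω ≤ π/2*u := by
      rw [hu]
      have hpi := pi_pos
      have : π * (2/π*(ω/2)) ≤ π * sin (ω/2) := by gcongr
      have e : π * (2/π*(ω/2)) = ω := by field_simp
      linarith
    linarith [mul_le_mul_of_nonneg_right pi_lt_d2.le hup.le]
  have hcase : u ≤ 4*L ∨ (4*L < u ∧ u ≤ 4*a ∧ u ≤ 4*b) := by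
    rcases le_or_gt u (4*L) with g | g
    · exact Or.inl g
    · right
      have hge : 1/2 ≤ ‖x‖ := by
        by_contra hlt
        push Not at hlt
        have h1 : 1/2 < L := by linarith
        have : u ≤ 2 := by rw [hu]; linarith [sin_le_one (ω/2)]
        linarith
      have : u/2 ≤ ‖x‖*u := by linarith [mul_le_mul_of_nonneg_right hge hup.le]
      exact ⟨g, by linarith, by linarith⟩
  have core := pt_core hap hbp hup hLp ht hω.1 hκ hκ1 hωu hD1 hD2 hcase
  have s1 : (a*b)^(-(l+1)) * (sin ω)^(2*l) = ((sin ω)^2/(a*b))^l / (a*b) := by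
    rw [div_rpow 𝔭 𝔭, ← rpow_natCast (sin ω) 2, ← rpow_mul hs.le,
      neg_add, rpow_add 𝔭, rpow_neg 𝔭, rpow_neg 𝔭, rpow_one]
    push_cast
    field_simp
  have s2 : (1-cos ω)^κ ≤ u^(2*κ) := by
    rw [hcos, rpow_mul hup.le]
    apply rpow_le_rpow 𝔭 _ hκ
    rw [rpow_two]
    linarith [sq_nonneg u]
  calc _ = ((sin ω)^2/(a*b))^l * (‖1-x^2‖/(a*b) * (1-cos ω)^κ) := by
        calc _ = ‖1-x^2‖ * (1-cos ω)^κ * ((a*b)^(-(l+1)) * (sin ω)^(2*l)) := by ring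
          _ = _ := by rw [s1]; ring
    _ ≤ (8*(L/h))^l * (‖1-x^2‖/(a*b) * u^(2*κ)) := by
        gcongr
        rw [hcos]; positivity
    _ ≤ _ := by gcongr

theorem circ_sq' (x : ℂ) (hx : ‖x‖ < 1) : ∫⁻ ω in Ioo (0:ℝ) π, 𝔬 (1/‖1-x*Complex.exp (-(ω*Complex.I))‖^2) ≤
    𝔬 (2*π/(1-‖x‖)) := by
  have := circ_sq (starRingEnd ℂ x) (by rwa [Complex.norm_conj])
  rw [Complex.norm_conj] at this
  refine le_trans (le_of_eq ?_) this
  congr 1; ext ω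
  congr 3
  rw [← Complex.norm_conj]
  congr 1
  simp [← Complex.exp_conj]

theorem Pn_int {l κ : ℝ} (hl : 0 ≤ l) (hκ : 0 ≤ κ) (hκ1 : κ ≤ 1/4) {x : ℂ} (hx : ‖x‖ < 1) :
    ∫⁻ ω in Ioo (0:ℝ) π, 𝔬 (Pn l ω x * ((1-cos ω)^κ * (sin ω)^(2*l))) ≤
      𝔬 (8^l*5700 * (‖1-x‖/(1-‖x‖))^(l+1/2) * ‖1-x‖^(2*κ)) := by
  have hL0 : 1-‖x‖ ≤ ‖1-x‖ := by have := norm_sub_norm_le (1:ℂ) x; rwa [norm_one] at this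
  have hp := fun (ω : ℝ) (hω : ω ∈ Ioo 0 π) (t : ℝ) (ht : 0 < t) => Pn_pt hl hκ hκ1 hx hω ht
  have c1 := circ_sq x hx
  have c2 := circ_sq' x hx
  set L := ‖1-x‖ with hL
  set h := 1-‖x‖ with hh
  have hh0 : 0 < h := by rw [hh]; linarith
  have hLp : 0 < L := by linarith
  set t := √(L*h) with ht
  have htp : 0 < t := by rw [ht]; positivity
  have hΛ : 1 ≤ L/h := by rw [one_le_div hh0]; exact hL0
  have c3 : ∫⁻ ω in Ioo (0:ℝ) π, 𝔬 ((L+ω)^(-(3/2):ℝ)) ≤ 𝔬 (3*L^(-(1/2):ℝ)) := by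
    have := rpow_int_bound (p := 1) (N := 3/2) (by norm_num) (by norm_num) hLp
    norm_num at this
    norm_num
    exact (lintegral_mono_set Ioo_subset_Ioi_self).trans this
  set D := L^(3/2:ℝ)/t+L^(1/2:ℝ) with hD
  set c := (8*(L/h))^l * (300*L^(2*κ)) with hc
  have hD0 : 0 ≤ D := by positivity
  have hc0 : 0 ≤ c := by positivity
  calc _ ≤ ∫⁻ ω in Ioo (0:ℝ) π, 𝔬 c * (𝔬 t * (𝔬 (1/‖1-x*𝔢 ω‖^2) +
          𝔬 (1/‖1-x*Complex.exp (-(ω*Complex.I))‖^2)) + 𝔬 D * 𝔬 ((L+ω)^(-(3/2):ℝ))) := by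
        refine setLIntegral_mono' measurableSet_Ioo (fun ω hω => ?_)
        have hLω : 0 ≤ (L+ω)^(-(3/2):ℝ) := by have := hω.1; positivity
        rw [← ENNReal.ofReal_add 𝔭 𝔭, ← ENNReal.ofReal_mul htp.le, ← ENNReal.ofReal_mul hD0,
          ← ENNReal.ofReal_add 𝔭 𝔭, ← ENNReal.ofReal_mul hc0]
        apply ENNReal.ofReal_le_ofReal
        refine (hp ω hω t htp).trans (le_of_eq ?_)
        rw [hc]; ring
    _ ≤ 𝔬 c * (𝔬 t * (𝔬 (2*π/h) + 𝔬 (2*π/h)) + 𝔬 D * 𝔬 (3*L^(-(1/2):ℝ))) := by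
        rw [lintegral_const_mul' _ _ ENNReal.ofReal_ne_top, lintegral_add_left (by fun_prop), lintegral_const_mul' _ _ ENNReal.ofReal_ne_top,
          lintegral_const_mul' _ _ ENNReal.ofReal_ne_top, lintegral_add_left (by fun_prop)]
        gcongr
    _ = 𝔬 (c * (t*(2*π/h+2*π/h) + D*(3*L^(-(1/2):ℝ)))) := by
        rw [← ENNReal.ofReal_add 𝔭 𝔭, ← ENNReal.ofReal_mul htp.le, ← ENNReal.ofReal_mul hD0,
          ← ENNReal.ofReal_add 𝔭 𝔭, ← ENNReal.ofReal_mul hc0]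
    _ ≤ _ := by
        apply ENNReal.ofReal_le_ofReal
        have e1 : t/h = (L/h)^(1/2:ℝ) := by
          rw [ht, ← sqrt_eq_rpow, sqrt_mul hLp.le, sqrt_div hLp.le]
          rw [div_eq_div_iff hh0.ne' 𝔭, mul_assoc, mul_self_sqrt hh0.le]
        have e2 : L/t = (L/h)^(1/2:ℝ) := by
          rw [ht, ← sqrt_eq_rpow, sqrt_mul hLp.le, sqrt_div hLp.le]
          rw [div_eq_div_iff 𝔭 𝔭, ← mul_assoc, mul_self_sqrt hLp.le]
        have e3 : D*(3*L^(-(1/2):ℝ)) = 3*(L/t) + 3 := by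
          have p1 : L^(3/2:ℝ) = L*L^(1/2:ℝ) := by
            rw [← rpow_one_add' hLp.le (by norm_num)]; norm_num
          have p2 : L^(1/2:ℝ)*L^(-(1/2):ℝ) = 1 := by rw [← rpow_add hLp]; norm_num
          rw [hD, p1]
          linear_combination (3*(L/t)+3)*p2
        have e4 : t*(2*π/h+2*π/h) = 4*π*(t/h) := by ring
        have h1 : (1:ℝ) ≤ (L/h)^(1/2:ℝ) := one_le_rpow hΛ (by norm_num)
        have h2 : t*(2*π/h+2*π/h) + D*(3*L^(-(1/2):ℝ)) ≤ 19 * (L/h)^(1/2:ℝ) := by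
          rw [e3, e4, e1, e2]
          have := pi_lt_d2
          nlinarith
        calc _ ≤ c * (19 * (L/h)^(1/2:ℝ)) := by gcongr
          _ = _ := by
            rw [hc, mul_rpow (by norm_num) 𝔭, rpow_add 𝔭]; ring

noncomputable def Vint (γ l : ℝ) (N : ℕ) (ω : ℝ) (X : ℂ) : ℝ≥0∞ :=
  ∫⁻ v in 𝔦, 𝔬 ((1-v)^((N-(γ+1))-1)*(1-v*‖X‖)^(-(N:ℝ))*Pn l ω (v*X))

theorem Vint_meas (γ l : ℝ) (N : ℕ) {β : Type*} [MeasurableSpace β] {a : β → ℝ} {b : β → ℂ} (ha : Measurable a) (hb : Measurable b) :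
    Measurable (fun x => Vint γ l N (a x) (b x)) := by
  unfold Vint
  apply Measurable.lintegral_prod_right' (f := fun (p : β × ℝ) => 𝔬 ((1-p.2)^((N-(γ+1))-1)*(1-p.2*‖b p.1‖)^(-(N:ℝ))*Pn l (a p.1) (p.2*b p.1)))
  unfold Pn
  fun_prop

theorem lint_sub_left (f : ℝ → ℝ≥0∞) : ∫⁻ v in 𝔦, f (1-v) = ∫⁻ v in 𝔦, f v := by
  have h := (Measure.measurePreserving_sub_left (volume : Measure ℝ) 1).setLIntegral_comp_preimage_emb
    (MeasurableEquiv.subLeft (1:ℝ)).measurableEmbedding f (Ioo 0 1)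
  simpa using h

theorem V1_bound {l κ γ : ℝ} (hl : 0 ≤ l) (hγ : -1 < γ) (hκ : 0 ≤ κ) (hκ1 : κ ≤ 1/4) (hκ2 : 2*κ < γ+1) {N : ℕ} (hN : γ+1 < N) :
    ∃ C : ℝ, 0 ≤ C ∧ ∀ X : ℂ, ‖X‖ < 1 → ∫⁻ ω in Ioo (0:ℝ) π, Vint γ l N ω X * 𝔬 ((1-cos ω)^κ * (sin ω)^(2*l)) ≤
      𝔬 (C * (‖1-X‖^(l+1/2) * (1-‖X‖)^(-(𝔴 γ l)) * ‖1-X‖^(2*κ))) := by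
  set σ : ℝ := N-(γ+1) with hσ
  have hσ0 : 0 < σ := by rw [hσ]; linarith
  set c1 : ℝ := 1/σ+1/(N-σ) with hc1
  set c2 : ℝ := 1/(σ+2*κ)+1/(N-(σ+2*κ)) with hc2
  have hd1 : 0 < N-σ := by rw [hσ]; linarith
  have hd2 : 0 < N-(σ+2*κ) := by rw [hσ]; linarith
  have hc10 : 0 ≤ c1 := by positivity
  have hc20 : 0 ≤ c2 := by positivity
  refine ⟨8^l*5700*2^N*(c1+c2), by positivity, fun X hX => ?_⟩
  have hL0 : 1-‖X‖ ≤ ‖1-X‖ := by have := norm_sub_norm_le (1:ℂ) X; rwa [norm_one] at this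
  set L := ‖1-X‖ with hL
  set x := ‖X‖ with hx
  have hx0 : 0 ≤ x := norm_nonneg _
  set η := 1 - x with hη
  have hη0 : 0 < η := by rw [hη]; linarith
  have hLp : 0 < L := by linarith
  set c := 8^l*5700*(L/η)^(l+1/2) * 2^N with hc
  have hc0 : 0 ≤ c := by positivity
  calc _ = ∫⁻ ω in Ioo (0:ℝ) π, ∫⁻ v in 𝔦, 𝔬 ((1-v)^(σ-1)*(1-v*x)^(-(N:ℝ))*Pn l ω (v*X)) *
          𝔬 ((1-cos ω)^κ * (sin ω)^(2*l)) := by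
        congr 1; ext ω
        rw [lintegral_mul_const' _ _ ENNReal.ofReal_ne_top]; rfl
    _ = ∫⁻ v in 𝔦, ∫⁻ ω in Ioo (0:ℝ) π, 𝔬 ((1-v)^(σ-1)*(1-v*x)^(-(N:ℝ))*Pn l ω (v*X)) *
          𝔬 ((1-cos ω)^κ * (sin ω)^(2*l)) := by
        apply lintegral_lintegral_swap
        unfold Pn Function.uncurry
        fun_prop
    _ ≤ ∫⁻ v in 𝔦, 𝔬 c * (𝔬 (L^(2*κ)) * 𝔬 ((1-v)^(σ-1)*(η+(1-v))^(-(N:ℝ))) + 𝔬 ((1-v)^(σ+2*κ-1)*(η+(1-v))^(-(N:ℝ)))) := by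
        refine setLIntegral_mono' measurableSet_Ioo (fun v hv => ?_)
        have hv0 := hv.1
        have hv1 : 0 < 1-v := by linarith [hv.2]
        have hvx : v*x < 1 := by nlinarith [hv.2]
        have hvX : ‖(v:ℂ)*X‖ = v*x := by rw [norm_mul, Complex.norm_real, norm_of_nonneg hv0.le]
        have hvxp : 0 < 1-v*x := by linarith
        have hb1 : ‖1-(v:ℂ)*X‖ ≤ v*L+(1-v) := by
          have e : 1-(v:ℂ)*X = v*(1-X) + ((1-v:ℝ):ℂ) := by push_cast; ring
          rw [e]
          refine (norm_add_le _ _).trans ?_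
          rw [norm_mul, Complex.norm_real, Complex.norm_real, norm_of_nonneg hv0.le, norm_of_nonneg hv1.le]
        have hrat : ‖1-(v:ℂ)*X‖/(1-v*x) ≤ L/η := by
          rw [div_le_div_iff₀ hvxp hη0]
          have : ‖1-(v:ℂ)*X‖*η ≤ (v*L+(1-v))*η := by gcongr
          have e : 1-v*x = v*η+(1-v) := by rw [hη]; ring
          rw [e]; nlinarith
        have hpw : ‖1-(v:ℂ)*X‖^(2*κ) ≤ L^(2*κ)+(1-v)^(2*κ) := by
          calc _ ≤ (L+(1-v))^(2*κ) := by
                apply rpow_le_rpow (norm_nonneg _) _ 𝔩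
                nlinarith [hv.2]
            _ ≤ _ := rpow_add_le_add_rpow hLp.le hv1.le 𝔩 𝔩
        have hden : (1-v*x)^(-(N:ℝ)) ≤ 2^N * (η+(1-v))^(-(N:ℝ)) := by
          have h1 : (η+(1-v))/2 ≤ 1-v*x := by rw [hη]; nlinarith [hv.2]
          calc _ ≤ ((η+(1-v))/2)^(-(N:ℝ)) := rpow_le_rpow_of_nonpos 𝔭 h1 (by simp)
            _ = _ := by
              rw [rpow_neg 𝔭, rpow_neg 𝔭, rpow_natCast, rpow_natCast, div_pow, inv_div]; ring
        have hPi := Pn_int hl hκ hκ1 (x := (v:ℂ)*X) (by rw [hvX]; exact hvx)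
        rw [hvX] at hPi
        have e1 : ∀ ω, 𝔬 ((1-v)^(σ-1)*(1-v*x)^(-(N:ℝ))*Pn l ω (v*X)) * 𝔬 ((1-cos ω)^κ * (sin ω)^(2*l))
            = 𝔬 ((1-v)^(σ-1)*(1-v*x)^(-(N:ℝ))) * 𝔬 (Pn l ω (v*X) * ((1-cos ω)^κ * (sin ω)^(2*l))) := by
          intro ω
          rw [ENNReal.ofReal_mul 𝔭, ENNReal.ofReal_mul (Pn_nonneg _ _ _), mul_assoc]
        simp_rw [e1]
        rw [lintegral_const_mul' _ _ ENNReal.ofReal_ne_top]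
        refine (mul_le_mul_right hPi _).trans ?_
        have hN0 : 0 ≤ (η+(1-v))^(-(N:ℝ)) := by positivity
        rw [← ENNReal.ofReal_mul 𝔭, ← ENNReal.ofReal_mul 𝔭, ← ENNReal.ofReal_add 𝔭 𝔭, ← ENNReal.ofReal_mul hc0]
        apply ENNReal.ofReal_le_ofReal
        have e2 : (1-v)^(σ+2*κ-1) = (1-v)^(σ-1)*(1-v)^(2*κ) := by rw [← rpow_add hv1]; ring_nf
        rw [e2]
        calc _ ≤ (1-v)^(σ-1)*(2^N * (η+(1-v))^(-(N:ℝ))) * (8^l*5700*(L/η)^(l+1/2)*(L^(2*κ)+(1-v)^(2*κ))) := by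
              refine mul_le_mul (mul_le_mul_of_nonneg_left hden 𝔭) ?_ 𝔭 𝔭
              refine mul_le_mul (mul_le_mul_of_nonneg_left (rpow_le_rpow 𝔭 hrat 𝔩) 𝔭) hpw 𝔭 𝔭
          _ = _ := by rw [hc]; ring
    _ = ∫⁻ t in 𝔦, 𝔬 c * (𝔬 (L^(2*κ)) * 𝔬 (t^(σ-1)*(η+t)^(-(N:ℝ))) + 𝔬 (t^(σ+2*κ-1)*(η+t)^(-(N:ℝ)))) :=
        lint_sub_left (fun t => 𝔬 c * (𝔬 (L^(2*κ)) * 𝔬 (t^(σ-1)*(η+t)^(-(N:ℝ))) + 𝔬 (t^(σ+2*κ-1)*(η+t)^(-(N:ℝ)))))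
    _ ≤ 𝔬 c * (𝔬 (L^(2*κ)) * 𝔬 (c1*η^(σ-N)) + 𝔬 (c2*η^(σ+2*κ-N))) := by
        rw [lintegral_const_mul' _ _ ENNReal.ofReal_ne_top, lintegral_add_left (by fun_prop), lintegral_const_mul' _ _ ENNReal.ofReal_ne_top]
        have i1 := (lintegral_mono_set (μ := volume) (f := fun t => 𝔬 (t^(σ-1)*(η+t)^(-(N:ℝ)))) (Ioo_subset_Ioi_self : 𝔦 ⊆ Ioi 0)).trans (rpow_int_bound (N := N) hσ0 𝔩 hη0)
        have i2 := (lintegral_mono_set (μ := volume) (f := fun t => 𝔬 (t^(σ+2*κ-1)*(η+t)^(-(N:ℝ)))) (Ioo_subset_Ioi_self : 𝔦 ⊆ Ioi 0)).trans (rpow_int_bound (N := N) (p := σ+2*κ) 𝔭 𝔩 hη0)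
        gcongr
    _ ≤ _ := by
        rw [← ENNReal.ofReal_mul 𝔭, ← ENNReal.ofReal_add 𝔭 𝔭, ← ENNReal.ofReal_mul hc0]
        apply ENNReal.ofReal_le_ofReal
        have e1 : η^(σ+2*κ-N) = η^(2*κ) * η^(σ-N) := by rw [← rpow_add hη0]; ring_nf
        have e2 : η^(2*κ) ≤ L^(2*κ) := rpow_le_rpow hη0.le hL0 𝔩
        have e3 : (L/η)^(l+1/2) * η^(σ-N) = L^(l+1/2) * η^(-(𝔴 γ l)) := by
          rw [div_rpow hLp.le hη0.le, div_eq_mul_inv, ← rpow_neg hη0.le, mul_assoc, ← rpow_add hη0, hσ]; ring_nf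
        rw [e1]
        calc _ ≤ c * (L^(2*κ) * (c1*η^(σ-N)) + c2*(L^(2*κ)*η^(σ-N))) := by gcongr
          _ = (8^l*5700*2^N*(c1+c2)) * (((L/η)^(l+1/2) * η^(σ-N)) * L^(2*κ)) := by rw [hc]; ring
          _ = _ := by rw [e3]

theorem Vint_bound {l κ γ : ℝ} (hl : 0 ≤ l) (hγ : -1 < γ) (hκ : 0 ≤ κ) (hκ1 : κ ≤ 1/4) (hκ2 : 2*κ < γ+1) {N : ℕ} (hN : γ+1 < N) :
    ∃ C : ℝ, 0 ≤ C ∧ ∀ (X : ℂ) (Y : ℝ), ‖X‖ < 1 → 0 ≤ Y → ∫⁻ ω in Ioo (0:ℝ) π, Vint γ l N ω X * 𝔬 (((1-cos ω)^κ+Y) * (sin ω)^(2*l)) ≤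
      𝔬 (C * (‖1-X‖^(l+1/2) * (1-‖X‖)^(-(𝔴 γ l)) * (‖1-X‖^(2*κ)+Y))) := by
  obtain ⟨C1, hC1, h1⟩ := V1_bound hl hγ hκ hκ1 hκ2 hN
  obtain ⟨C2, hC2, h2⟩ := V1_bound (κ := 0) hl hγ le_rfl (by norm_num) 𝔩 hN
  refine ⟨C1+C2, by positivity, fun X Y hX hY => ?_⟩
  specialize h1 X hX
  specialize h2 X hX
  simp only [mul_zero, rpow_zero, one_mul, mul_one] at h2
  have hη : 0 < 1-‖X‖ := by linarith
  set Q := ‖1-X‖^(l+1/2) * (1-‖X‖)^(-(𝔴 γ l)) with hQ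
  have hQ0 : 0 ≤ Q := by positivity
  have hm := Vint_meas γ l N (β := ℝ) (a := fun x => x) (b := fun _ => X) measurable_id measurable_const
  calc _ = ∫⁻ ω in Ioo (0:ℝ) π, (Vint γ l N ω X * 𝔬 ((1-cos ω)^κ * (sin ω)^(2*l)) + 𝔬 Y * (Vint γ l N ω X * 𝔬 ((sin ω)^(2*l)))) := by
        refine setLIntegral_congr_fun measurableSet_Ioo (fun ω hω => ?_)
        have := sin_pos_of_mem_Ioo hω
        have h3 : 0 ≤ 1-cos ω := by linarith [cos_le_one ω]
        rw [add_mul, ENNReal.ofReal_add 𝔭 𝔭, ENNReal.ofReal_mul hY]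
        ring
    _ ≤ 𝔬 (C1 * (Q * ‖1-X‖^(2*κ))) + 𝔬 Y * 𝔬 (C2*Q) := by
        rw [lintegral_add_left (by fun_prop), lintegral_const_mul' _ _ ENNReal.ofReal_ne_top]
        gcongr
    _ ≤ _ := by
        rw [← ENNReal.ofReal_mul hY, ← ENNReal.ofReal_add 𝔭 𝔭]
        apply ENNReal.ofReal_le_ofReal
        have : 0 ≤ ‖1-X‖^(2*κ) := by positivity
        have : 0 ≤ C2*(Q*‖1-X‖^(2*κ)) := by positivity
        have : 0 ≤ C1*(Q*Y) := by positivity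
        nlinarith

theorem le_of_sq_le_sq₀' {a b : ℝ} (h : a^2 ≤ b^2) (hb : 0 ≤ b) : a ≤ b := by
  by_contra hc
  push Not at hc
  nlinarith

section geom
variable {s : ℝ} {r : ℂ}

theorem norm_one_add_ge {z : ℂ} (hz : 0 < z.re) : 1 ≤ ‖1+z‖ ∧ ‖z‖ ≤ ‖1+z‖ := by
  constructor
  · have := Complex.re_le_norm (1+z)
    simp at this; linarith
  · apply (fun h h' => (pow_le_pow_iff_left₀ (norm_nonneg _) h' two_ne_zero).1 h) _ (norm_nonneg _)
    rw [← Complex.normSq_eq_norm_sq, ← Complex.normSq_eq_norm_sq, Complex.normSq_apply, Complex.normSq_apply]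
    simp; nlinarith

theorem geo_add (hs : 0 < s) (hs1 : s ≤ 1) (hr : ‖r‖ < 1) : ‖ww s r‖ ≤ ‖ww s r + zt r‖ ∧ ‖zt r‖ ≤ ‖ww s r + zt r‖ := by
  have hw := ww_re_pos hs hs1 hr
  have hz := zt_re_pos hr
  have hsq := congrArg Complex.im (ww_sq s r)
  set w := ww s r
  set z := zt r
  have e : 2*(w.re*w.im) = 2*(s*(z.re*z.im)) := by
    simp [pow_two] at hsq; linarith
  have key : 0 ≤ w.re*z.re + w.im*z.im := by
    have h1 : 0 ≤ w.re * (w.re*z.re + w.im*z.im) := by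
      have : w.re * (w.re*z.re + w.im*z.im) = w.re^2*z.re + s*z.re*z.im^2 := by linear_combination z.im/2*e
      rw [this]; positivity
    exact nonneg_of_mul_nonneg_right h1 hw
  constructor <;>
  · apply (fun h h' => (pow_le_pow_iff_left₀ (norm_nonneg _) h' two_ne_zero).1 h) _ (norm_nonneg _)
    rw [← Complex.normSq_eq_norm_sq, ← Complex.normSq_eq_norm_sq, Complex.normSq_apply, Complex.normSq_apply]
    simp; nlinarith [sq_nonneg w.re, sq_nonneg w.im, sq_nonneg z.re, sq_nonneg z.im]

theorem norm_one_add_r (hr : ‖r‖ < 1) : ‖1+r‖ * ‖1+zt r‖ = 2 := by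
  have := one_add_ne hr
  rw [← norm_mul, show (1+r)*(1+zt r) = 2 by rw [zt]; field_simp; ring]; simp

theorem norm_one_sub_r (hr : ‖r‖ < 1) : ‖1-r‖ * ‖1+zt r‖ = 2*‖zt r‖ := by
  have := one_add_ne hr
  rw [← norm_mul, show (1-r)*(1+zt r) = 2*zt r by rw [zt]; field_simp; ring, norm_mul]; simp

theorem norm_one_sub_zt (hr : ‖r‖ < 1) : ‖1-zt r‖ = ‖r‖*‖1+zt r‖ := by
  have := one_add_ne hr
  rw [← norm_mul, show r*(1+zt r) = 1-zt r by rw [zt]; field_simp; ring]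

theorem norm_XX (hs : 0 < s) (hs1 : s ≤ 1) (hr : ‖r‖ < 1) : ‖XX s r‖ * ‖1+ww s r‖ = √s*(‖r‖*‖1+zt r‖) := by
  rw [← norm_one_sub_zt hr, ← norm_mul, XX, div_mul_cancel₀ _ (ww_ne hs hs1 hr), norm_mul, Complex.norm_real, norm_of_nonneg (sqrt_nonneg s)]

theorem norm_one_sub_qq (hs : 0 < s) (hs1 : s ≤ 1) (hr : ‖r‖ < 1) : ‖1-qq s r‖ = 2*‖ww s r‖/‖1+ww s r‖ := by
  have := ww_ne hs hs1 hr
  rw [show 1-qq s r = 2*ww s r/(1+ww s r) by rw [qq]; field_simp; ring, norm_div, norm_mul]; simp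

theorem norm_one_add_qq (hs : 0 < s) (hs1 : s ≤ 1) (hr : ‖r‖ < 1) : ‖1+qq s r‖ = 2/‖1+ww s r‖ := by
  have := ww_ne hs hs1 hr
  rw [show 1+qq s r = 2/(1+ww s r) by rw [qq]; field_simp; ring, norm_div]; simp

theorem norm_pref (A : ℝ) (hs : 0 < s) (hs1 : s ≤ 1) (hr : ‖r‖ < 1) : ‖pref A s r‖ = (‖1+zt r‖/‖1+ww s r‖)^A := by
  have h1 := norm_pos_iff.2 (ww_ne hs hs1 hr)
  have h2 := norm_pos_iff.2 (zt_ne hr)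
  have h3 : ‖1+r‖ = 2/‖1+zt r‖ := by rw [← norm_one_add_r hr]; field_simp
  rw [pref, norm_mul, ← Complex.ofReal_neg, Complex.norm_cpow_real, Complex.norm_cpow_real, norm_one_add_qq hs hs1 hr, h3, rpow_neg 𝔭,
    ← div_eq_mul_inv, ← div_rpow 𝔭 𝔭]
  congr 1; field_simp

theorem geo_eta (hs : 0 < s) (hs1 : s ≤ 1) (hr : ‖r‖ < 1) :
    (1-‖r‖) * √s * ‖ww s r + zt r‖ * ‖1+zt r‖ ≤ 4*‖ww s r‖*‖1+ww s r‖*(1-‖XX s r‖) := by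
  have h1 := ww_ne hs hs1 hr
  have h2 := zt_ne hr
  have hwn := norm_pos_iff.2 h1
  have hzn := norm_pos_iff.2 h2
  have hw0 : 0 < ‖ww s r‖ := norm_pos_iff.2 (fun h => by have := ww_re_pos hs hs1 hr; rw [h] at this; simp at this)
  have hadd := (geo_add hs hs1 hr).1
  have hXr := norm_XX_le hs hs1 hr
  have hx0 : 0 < √s := sqrt_pos.2 hs
  have hxx : ((√s:ℝ):ℂ)^2 = s := by rw [← Complex.ofReal_pow, sq_sqrt hs.le]
  have hsq := ww_sq s r
  have hre : r*(1+zt r) = 1-zt r := by rw [zt]; have := one_add_ne hr; field_simp; ring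
  have hXe : XX s r * (1+ww s r) = ((√s:ℝ):ℂ)*(1-zt r) := by rw [XX, div_mul_cancel₀ _ h1]
  generalize hXg : XX s r = X at *
  generalize ww s r = w at *
  generalize zt r = z at *
  generalize hx : √s = x at *
  have hs2 : s = x^2 := by rw [← hx, sq_sqrt hs.le]
  have i1 : (x-X)*(1+w) = x*(w+z) := by linear_combination -hXe
  have i2 : r*(x-X)=X*(1-x*X) := by
    have : (r*(x-X)-X*(1-x*X))*((1+w)^2*(1+z)) = 0 := by
      push_cast at hsq
      rw [← hxx] at hsq
      linear_combination ((x-X)*(1+w)^2)*hre + (x*X*(1+w)*(1+z) - (1-z)*(1+w) -(1+z)*(1+w) + x*x*(1-z)*(1+z))*hXe + x*(1-z)*hsq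
    have h3 : (1+w)^2*(1+z) ≠ 0 := mul_ne_zero (pow_ne_zero _ h1) h2
    exact sub_eq_zero.1 ((mul_eq_zero.1 this).resolve_right h3)
  have i3 : (1-2*x*X+X^2)*((1+z)*(1+w)) = 2*w*(w+z) := by
    have : ((1-2*x*X+X^2)*((1+z)*(1+w)) - 2*w*(w+z))*(1+w) = 0 := by
      push_cast at hsq
      rw [← hxx] at hsq
      linear_combination ((-2*x*(1+w) + (X*(1+w)+x*(1-z)))*(1+z))*hXe - ((1+z)+2*w)*hsq
    exact sub_eq_zero.1 ((mul_eq_zero.1 this).resolve_right h1)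
  have n1 : ‖(x:ℂ)-X‖ * ‖1+w‖ = x*‖w+z‖ := by
    rw [← norm_mul, i1, norm_mul, Complex.norm_real, norm_of_nonneg hx0.le]
  have n2 : ‖r‖*‖(x:ℂ)-X‖ = ‖X‖*‖1-x*X‖ := by rw [← norm_mul, i2, norm_mul]
  have n3 : ‖1-2*x*X+X^2‖*(‖1+z‖*‖1+w‖) = 2*‖w‖*‖w+z‖ := by
    rw [← norm_mul (1+z), ← norm_mul, i3, norm_mul, norm_mul]; simp
  have n4 : (1-‖r‖^2)*‖(x:ℂ)-X‖^2 ≤ (1-‖X‖^2)*(x*‖1-2*x*X+X^2‖) := by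
    have e1 : (1-‖r‖^2)*‖(x:ℂ)-X‖^2 = (1-‖X‖^2)*(x*(x*(1+‖X‖^2)-2*X.re)) := by
      have : (1-‖r‖^2)*‖(x:ℂ)-X‖^2 = ‖(x:ℂ)-X‖^2 - ‖X‖^2*‖1-x*X‖^2 := by
        linear_combination (-(‖r‖*‖(x:ℂ)-X‖) - ‖X‖*‖1-x*X‖)*n2
      rw [this]
      simp only [← Complex.normSq_eq_norm_sq, Complex.normSq_apply]
      simp; ring
    have e2 : x*(1+‖X‖^2)-2*X.re ≤ ‖1-2*x*X+X^2‖ := by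
      apply le_of_sq_le_sq₀' _ (norm_nonneg _)
      have : ‖1-2*x*X+X^2‖^2 - (x*(1+‖X‖^2)-2*X.re)^2 = (1-x^2)*(1-‖X‖^2)^2 := by
        simp only [← Complex.normSq_eq_norm_sq, Complex.normSq_apply]
        simp [pow_two]; ring
      have : 0 ≤ (1-x^2)*(1-‖X‖^2)^2 := by rw [← hs2]; have : 0 ≤ 1-s := by linarith
                                           positivity
      linarith
    have e3 : 0 ≤ 1-‖X‖^2 := by nlinarith [norm_nonneg X]
    rw [e1]
    gcongr
  have hA : 0 < ‖w+z‖ := by linarith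
  have n5 : (1-‖r‖^2)*x*‖w+z‖*‖1+z‖ ≤ 2*‖w‖*‖1+w‖*(1-‖X‖^2) := by
    have h := mul_le_mul_of_nonneg_right n4 (show 0 ≤ ‖1+w‖^2*‖1+z‖ by positivity)
    have h' : ((1-‖r‖^2)*x*‖w+z‖*‖1+z‖)*(x*‖w+z‖) ≤ (2*‖w‖*‖1+w‖*(1-‖X‖^2))*(x*‖w+z‖) := by
      calc _ = (1-‖r‖^2)*‖(x:ℂ)-X‖^2*(‖1+w‖^2*‖1+z‖) := by
            linear_combination -((1-‖r‖^2)*‖1+z‖)*(‖(x:ℂ)-X‖*‖1+w‖ + x*‖w+z‖)*n1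
        _ ≤ _ := h
        _ = _ := by linear_combination (1-‖X‖^2)*x*‖1+w‖*n3
    exact le_of_mul_le_mul_right h' 𝔭
  have hr0 := norm_nonneg r
  have hX0 := norm_nonneg X
  calc _ ≤ (1-‖r‖^2)*x*‖w+z‖*‖1+z‖ := by gcongr; nlinarith
    _ ≤ 2*‖w‖*‖1+w‖*(1-‖X‖^2) := n5
    _ ≤ 2*‖w‖*‖1+w‖*(2*(1-‖X‖)) := by gcongr; nlinarith
    _ = _ := by ring

theorem geo_eta2 (hs : 0 < s) (hs1 : s ≤ 1) (hr : ‖r‖ < 1) (h : 2*‖zt r‖ ≤ ‖ww s r‖) :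
    ‖ww s r‖ ≤ 2*‖1+ww s r‖^2*(1-‖XX s r‖) := by
  have hw := ww_re_pos hs hs1 hr
  have hz0 := norm_nonneg (zt r)
  have hX := norm_XX_sq hs hs1 hr
  have hX0 := norm_nonneg (XX s r)
  have hX1 := norm_XX_le hs hs1 hr
  have hP := norm_pos_iff.2 (ww_ne hs hs1 hr)
  have q0 := norm_nonneg (qq s r)
  have q1 : (1-‖qq s r‖^2)*‖1+ww s r‖^2 = 4*(ww s r).re := by
    have : ‖qq s r‖*‖1+ww s r‖ = ‖1-ww s r‖ := by rw [← norm_mul, qq, div_mul_cancel₀ _ (ww_ne hs hs1 hr)]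
    calc _ = ‖1+ww s r‖^2 - (‖qq s r‖*‖1+ww s r‖)^2 := by ring
      _ = _ := by
        rw [this, ← Complex.normSq_eq_norm_sq, ← Complex.normSq_eq_norm_sq, Complex.normSq_apply, Complex.normSq_apply]
        simp; ring
  have hre := congrArg Complex.re (ww_sq s r)
  have hrez : -‖zt r‖^2 ≤ ((zt r)^2).re := by
    have := Complex.abs_re_le_norm ((zt r)^2)
    rw [norm_pow] at this
    exact (abs_le.1 this).1
  have hn := Complex.normSq_eq_norm_sq (ww s r)
  rw [Complex.normSq_apply] at hn
  have hre2 : (ww s r).re^2 - (ww s r).im^2 = (1-s) + s*((zt r)^2).re := by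
    have : ((ww s r)^2).re = (ww s r).re^2 - (ww s r).im^2 := by simp [pow_two]
    rw [← this, hre]; simp
  have hsz : -‖zt r‖^2 ≤ s*((zt r)^2).re := by nlinarith [sq_nonneg (‖zt r‖)]
  have hbig : ‖ww s r‖^2 ≤ 4*(ww s r).re^2 := by nlinarith
  have hW : ‖ww s r‖ ≤ 2*(ww s r).re := by
    apply le_of_sq_le_sq₀' _ 𝔭
    linarith [mul_pow 2 (ww s r).re 2]
  have hq1 := norm_qq_lt hs hs1 hr
  have hr0 := norm_nonneg r
  have e : 1-‖qq s r‖^2 ≤ 4*(1-‖XX s r‖) := by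
    have : ‖XX s r‖^2 ≤ ‖qq s r‖ := by rw [hX]; nlinarith
    nlinarith
  calc _ ≤ 2*(ww s r).re := hW
    _ = (1-‖qq s r‖^2)*‖1+ww s r‖^2/2 := by rw [q1]; ring
    _ ≤ (4*(1-‖XX s r‖))*‖1+ww s r‖^2/2 := by gcongr
    _ = _ := by ring

theorem geo_W (hs : 0 < s) (hs1 : s ≤ 1) : ‖ww s r‖^2 ≤ (1-s)+‖zt r‖^2 ∧ (1-s) ≤ ‖ww s r‖^2+‖zt r‖^2 ∧ s*‖zt r‖^2-(1-s) ≤ ‖ww s r‖^2 := by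
  have h := ww_sq s r
  have hy : 0 ≤ 1-s := by linarith
  have e1 : ‖((1-s:ℝ):ℂ)‖ = 1-s := by rw [Complex.norm_real, norm_of_nonneg hy]
  have e2 : ‖(s:ℂ)*(zt r)^2‖ = s*‖zt r‖^2 := by rw [norm_mul, norm_pow, Complex.norm_real, norm_of_nonneg hs.le]
  have e3 : s*‖zt r‖^2 ≤ ‖zt r‖^2 := by nlinarith [sq_nonneg ‖zt r‖]
  rw [← norm_pow, h]
  refine ⟨?_, ?_, ?_⟩
  · have := norm_add_le ((1-s:ℝ):ℂ) ((s:ℂ)*(zt r)^2)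
    linarith
  · have := norm_sub_norm_le ((1-s:ℝ):ℂ) (-((s:ℂ)*(zt r)^2))
    rw [sub_neg_eq_add, norm_neg] at this
    linarith
  · have := norm_sub_norm_le ((s:ℂ)*(zt r)^2) (-((1-s:ℝ):ℂ))
    rw [sub_neg_eq_add, norm_neg, add_comm ((s:ℂ)*(zt r)^2)] at this
    linarith

theorem geo_D (hs : 0 < s) (hs1 : s ≤ 1) (hr : ‖r‖ < 1) : ‖1-XX s r‖ ≤ 2*(1-s)+‖ww s r‖+‖zt r‖ := by
  have hP := (norm_one_add_ge (ww_re_pos hs hs1 hr)).1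
  have h1 := ww_ne hs hs1 hr
  have hX : ‖XX s r‖ ≤ 1 := (norm_XX_le hs hs1 hr).trans hr.le
  have hsx : √s ≤ 1 := sqrt_le_one.2 hs1
  have hsq := sq_sqrt hs.le
  have hs0 := sqrt_nonneg s
  have hxx : ((√s:ℝ):ℂ)*((√s:ℝ):ℂ) = s := by rw [← Complex.ofReal_mul, mul_self_sqrt hs.le]
  have e : 1-XX s r = (((1-s:ℝ):ℂ)+ww s r+s*zt r)/(1+ww s r) - ((1-√s:ℝ):ℂ)*XX s r := by
    rw [XX]; field_simp; push_cast; linear_combination (-(1-zt r))*hxx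
  have hy : 0 ≤ 1-s := by linarith
  have hz := norm_nonneg (zt r)
  have n1 : ‖((1-s:ℝ):ℂ)+ww s r+s*zt r‖ ≤ (1-s)+‖ww s r‖+‖zt r‖ := by
    refine (norm_add₃_le).trans ?_
    rw [norm_mul, Complex.norm_real, Complex.norm_real, norm_of_nonneg hy, norm_of_nonneg hs.le]
    nlinarith
  rw [e]
  refine (norm_sub_le _ _).trans ?_
  rw [norm_div, norm_mul, Complex.norm_real, norm_of_nonneg (show (0:ℝ) ≤ 1-√s by linarith)]
  have n2 : ‖((1-s:ℝ):ℂ)+ww s r+s*zt r‖/‖1+ww s r‖ ≤ (1-s)+‖ww s r‖+‖zt r‖ := (div_le_self (norm_nonneg _) hP).trans n1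
  have n3 : (1-√s)*‖XX s r‖ ≤ (1-s)*1 := by
    apply mul_le_mul _ hX (norm_nonneg _) hy
    nlinarith
  linarith

theorem geo_sing (hr : ‖r‖ < 1) (hr2 : 1/2 ≤ ‖r‖) : ∃ y1 : ℝ, ∀ s : ℝ, ‖1+zt r‖^2*|(1-s)-y1| ≤ 2*‖ww s r‖^2 := by
  have h1 := norm_one_sub_zt hr
  have h2 := norm_pos_iff.2 (zt_ne hr)
  have h3 : 0 < ‖1-zt r‖ := by rw [h1]; positivity
  have hB : (1-zt r)*(1+zt r) ≠ 0 := mul_ne_zero (norm_pos_iff.1 h3) (zt_ne hr)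
  refine ⟨(-(zt r)^2/((1-zt r)*(1+zt r))).re, fun s => ?_⟩
  rw [← norm_pow (ww s r), ww_sq]
  have e : ((1-s:ℝ):ℂ)+s*(zt r)^2 = ((1-zt r)*(1+zt r))*(((1-s:ℝ):ℂ) - (-(zt r)^2/((1-zt r)*(1+zt r)))) := by
    rw [mul_sub, mul_div_cancel₀ _ hB]; push_cast; ring
  rw [e, norm_mul, norm_mul, h1]
  have := Complex.abs_re_le_norm (((1-s:ℝ):ℂ) - (-(zt r)^2/((1-zt r)*(1+zt r))))
  rw [Complex.sub_re, Complex.ofReal_re] at this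
  set A := ‖((1-s:ℝ):ℂ) - (-(zt r)^2/((1-zt r)*(1+zt r)))‖
  calc _ ≤ ‖1+zt r‖^2*A := by gcongr
    _ = 2*((1/2)*‖1+zt r‖*‖1+zt r‖*A) := by ring
    _ ≤ _ := by gcongr
end geom

theorem rp1 {x c z p : ℝ} (hx : 0 ≤ x) (hc : 0 ≤ c) (hz : 0 ≤ z) (h : x ≤ c*z) (hp : 0 ≤ p) : x^p ≤ c^p*z^p := by
  rw [← mul_rpow hc hz]; exact rpow_le_rpow hx h hp
theorem rp2 {x c z p : ℝ} (hz : 0 < z) (hc : 0 < c) (h : z ≤ c*x) (hp : 0 ≤ p) : x^(-p) ≤ c^p*z^(-p) := by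
  have hx : z/c ≤ x := by rw [div_le_iff₀ hc]; linarith
  calc _ ≤ (z/c)^(-p) := rpow_le_rpow_of_nonpos 𝔭 hx 𝔩
    _ = _ := by
      rw [div_rpow hz.le hc.le, rpow_neg hc.le]; field_simp

noncomputable def Mr (α γ l κ T P W D η y : ℝ) : ℝ :=
  (T/P)^(α+γ+2) * (W/P)^(-(γ+2)) * D^(l+1/2) * η^(-(𝔴 γ l)) * (D^(2*κ)+y^κ)

section mr
variable {α γ l κ T P W D η y s a ε x : ℝ}

theorem Mr_case1 (hα : 0 ≤ α) (hγ : -1 < γ) (hl : 0 ≤ l) (hκ : 0 ≤ κ) (hκ1 : κ ≤ 1/4)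
    (hT : 0 < T) (hT1 : T ≤ 2) (hP : 1 ≤ P) (hP1 : P ≤ 3) (hW : 0 < W) (hD : 0 ≤ D) (hD1 : D ≤ 5*W) (hη : W ≤ 18*η)
    (hy1 : W^2 ≤ 2*y) (hy2 : y ≤ 2*W^2) (hay : a^2 ≤ y) :
    y^γ * Mr α γ l κ T P W D η y ≤ (2^(α+γ+2)*3^(γ+2)*5^(l+1/2)*18^(𝔴 γ l)*(5^(2*κ)*2^κ+1)*2^(γ+3/2)*2^(3/2-κ)) * (a^2+y)^(-(3/2-κ)) := by
  have hy : 0 < y := by nlinarith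
  have hη0 : 0 < η := by linarith
  have b1 : (T/P)^(α+γ+2) ≤ 2^(α+γ+2) := by
    apply rpow_le_rpow 𝔭 _ 𝔩
    exact (div_le_self hT.le hP).trans hT1
  have b2 : (W/P)^(-(γ+2)) ≤ 3^(γ+2)*W^(-(γ+2)) := rp2 hW (by norm_num) (by
    rw [mul_div_assoc', le_div_iff₀ 𝔩]; nlinarith) 𝔩
  have b3 : D^(l+1/2) ≤ 5^(l+1/2)*W^(l+1/2) := rp1 hD (by norm_num) hW.le hD1 𝔩
  have b4 : η^(-(𝔴 γ l)) ≤ 18^(𝔴 γ l)*W^(-(𝔴 γ l)) := rp2 hW (by norm_num) hη 𝔩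
  have w2 : (W^2)^κ = W^(2*κ) := by rw [← rpow_natCast, ← rpow_mul hW.le]; norm_num
  have b5 : D^(2*κ)+y^κ ≤ (5^(2*κ)*2^κ+1)*y^κ := by
    have h1 := rp1 hD (by norm_num) hW.le hD1 (p := 2*κ) 𝔩
    have h2 := rp1 (sq_nonneg W) (by norm_num) hy.le hy1 hκ
    rw [w2] at h2
    have : (5:ℝ)^(2*κ)*W^(2*κ) ≤ 5^(2*κ)*(2^κ*y^κ) := by gcongr
    linarith
  have b6 : W^(-(2*(γ+3/2))) ≤ 2^(γ+3/2)*y^(-(γ+3/2)) := by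
    have := rp2 hy (by norm_num) hy2 (p := γ+3/2) 𝔩
    rwa [← rpow_natCast, ← rpow_mul hW.le, show ((2:ℕ):ℝ)*(-(γ+3/2)) = -(2*(γ+3/2)) by push_cast; ring] at this
  have b7 : y^(-(3/2-κ)) ≤ 2^(3/2-κ)*(a^2+y)^(-(3/2-κ)) := rp2 𝔭 (by norm_num) 𝔩 𝔩
  have e1 : W^(-(γ+2))*W^(l+1/2)*W^(-(𝔴 γ l)) = W^(-(2*(γ+3/2))) := by
    rw [← rpow_add hW, ← rpow_add hW]; ring_nf
  have e2 : y^γ*(y^(-(γ+3/2))*y^κ) = y^(-(3/2-κ)) := by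
    rw [← rpow_add hy, ← rpow_add hy]; ring_nf
  unfold Mr
  calc _ ≤ y^γ * (2^(α+γ+2) * (3^(γ+2)*W^(-(γ+2))) * (5^(l+1/2)*W^(l+1/2)) * (18^(𝔴 γ l)*W^(-(𝔴 γ l))) * ((5^(2*κ)*2^κ+1)*y^κ)) := by
        refine mul_le_mul_of_nonneg_left ?_ 𝔭
        refine mul_le_mul (mul_le_mul (mul_le_mul (mul_le_mul b1 b2 ?_ ?_) b3 ?_ ?_) b4 ?_ ?_) b5 ?_ ?_ <;> positivity
    _ = (2^(α+γ+2)*3^(γ+2)*5^(l+1/2)*18^(𝔴 γ l)*(5^(2*κ)*2^κ+1)) * (y^γ*(W^(-(2*(γ+3/2)))*y^κ)) := by rw [← e1]; ring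
    _ ≤ (2^(α+γ+2)*3^(γ+2)*5^(l+1/2)*18^(𝔴 γ l)*(5^(2*κ)*2^κ+1)) * (y^γ*((2^(γ+3/2)*y^(-(γ+3/2)))*y^κ)) := by gcongr
    _ = (2^(α+γ+2)*3^(γ+2)*5^(l+1/2)*18^(𝔴 γ l)*(5^(2*κ)*2^κ+1)*2^(γ+3/2)) * y^(-(3/2-κ)) := by rw [← e2]; ring
    _ ≤ (2^(α+γ+2)*3^(γ+2)*5^(l+1/2)*18^(𝔴 γ l)*(5^(2*κ)*2^κ+1)*2^(γ+3/2)) * (2^(3/2-κ)*(a^2+y)^(-(3/2-κ))) := by gcongr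
    _ = _ := by ring

theorem Mr_case2 (hα : 0 ≤ α) (hγ : -1 < γ) (hl : 0 ≤ l) (hκ : 0 ≤ κ) (hκ1 : κ ≤ 1/4)
    (hT : 0 < T) (hT1 : T ≤ 2) (hP : 1 ≤ P) (hP1 : P ≤ 3) (hW : 0 < W) (ha : 0 < a) (hWa : W ≤ 2*a) (hD : 0 ≤ D) (hD1 : D ≤ 5*a) (hε : 0 < ε) (hη : ε*a ≤ 18*W*η)
    (hy : 0 ≤ y) (hy1 : y ≤ 5*a^2) :
    Mr α γ l κ T P W D η y ≤ (2^(α+γ+2)*3^(γ+2)*5^(l+1/2)*18^(𝔴 γ l)*(5^(2*κ)+5^κ)*2^l) * (ε^(-(𝔴 γ l)) * a^(l-γ-1+2*κ) * W^(-(1/2):ℝ)) := by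
  have hη0 : 0 < η := by
    by_contra h
    push Not at h
    have : 0 < ε*a := by positivity
    nlinarith
  have b1 : (T/P)^(α+γ+2) ≤ 2^(α+γ+2) := by
    apply rpow_le_rpow 𝔭 _ 𝔩
    exact (div_le_self hT.le hP).trans hT1
  have b2 : (W/P)^(-(γ+2)) ≤ 3^(γ+2)*W^(-(γ+2)) := rp2 hW (by norm_num) (by
    rw [mul_div_assoc', le_div_iff₀ 𝔩]; nlinarith) 𝔩
  have b3 : D^(l+1/2) ≤ 5^(l+1/2)*a^(l+1/2) := rp1 hD (by norm_num) ha.le hD1 𝔩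
  have b4 : η^(-(𝔴 γ l)) ≤ 18^(𝔴 γ l)*(W^(𝔴 γ l)*(ε^(-(𝔴 γ l))*a^(-(𝔴 γ l)))) := by
    have := rp2 (x := η) (c := 18*W) (z := ε*a) (p := γ+l+3/2) 𝔭 𝔭 hη 𝔩
    rw [mul_rpow hε.le ha.le, mul_rpow (by norm_num) hW.le] at this
    linarith
  have b5 : D^(2*κ)+y^κ ≤ (5^(2*κ)+5^κ)*a^(2*κ) := by
    have h1 := rp1 hD (by norm_num) ha.le hD1 (p := 2*κ) 𝔩
    have h2 := rp1 hy (by norm_num) (sq_nonneg a) hy1 hκ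
    rw [show (a^2)^κ = a^(2*κ) by rw [← rpow_natCast, ← rpow_mul ha.le]; norm_num] at h2
    linarith
  have b6 : W^l ≤ 2^l*a^l := rp1 hW.le (by norm_num) ha.le hWa hl
  have e1 : W^(-(γ+2))*W^(𝔴 γ l) = W^l*W^(-(1/2):ℝ) := by
    rw [← rpow_add hW, ← rpow_add hW]; ring_nf
  have e2 : a^(l+1/2)*a^(-(𝔴 γ l))*a^(2*κ)*a^l = a^(l-γ-1+2*κ) := by
    rw [← rpow_add ha, ← rpow_add ha, ← rpow_add ha]; ring_nf
  unfold Mr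
  calc _ ≤ (2^(α+γ+2) * (3^(γ+2)*W^(-(γ+2))) * (5^(l+1/2)*a^(l+1/2)) * (18^(𝔴 γ l)*(W^(𝔴 γ l)*(ε^(-(𝔴 γ l))*a^(-(𝔴 γ l))))) * ((5^(2*κ)+5^κ)*a^(2*κ))) := by
        refine mul_le_mul (mul_le_mul (mul_le_mul (mul_le_mul b1 b2 ?_ ?_) b3 ?_ ?_) b4 ?_ ?_) b5 ?_ ?_ <;> positivity
    _ = (2^(α+γ+2)*3^(γ+2)*5^(l+1/2)*18^(𝔴 γ l)*(5^(2*κ)+5^κ)) * (a^(l+1/2)*a^(-(𝔴 γ l))*a^(2*κ)*ε^(-(𝔴 γ l))*((W^(-(γ+2))*W^(𝔴 γ l)))) := by ring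
    _ = (2^(α+γ+2)*3^(γ+2)*5^(l+1/2)*18^(𝔴 γ l)*(5^(2*κ)+5^κ)) * (a^(l+1/2)*a^(-(𝔴 γ l))*a^(2*κ)*ε^(-(𝔴 γ l))*(W^l*W^(-(1/2):ℝ))) := by rw [e1]
    _ ≤ (2^(α+γ+2)*3^(γ+2)*5^(l+1/2)*18^(𝔴 γ l)*(5^(2*κ)+5^κ)) * (a^(l+1/2)*a^(-(𝔴 γ l))*a^(2*κ)*ε^(-(𝔴 γ l))*((2^l*a^l)*W^(-(1/2):ℝ))) := by gcongr
    _ = _ := by rw [← e2]; ring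

theorem Mr_case3 (hα : 0 ≤ α) (hγ : -1 < γ) (hl : 0 ≤ l) (hκ : 0 ≤ κ) (hx : 0 < x) (hx1 : x ≤ 1)
    (hT : 0 < T) (hP : 1 ≤ P) (hTP : x*T ≤ 2*P) (hε : 0 < ε) (hε1 : ε ≤ 1) (hTε : T*ε ≤ 2)
    (hW : P ≤ 4*W) (hD : 0 ≤ D) (hD1 : D ≤ 2) (hη : 1 ≤ 2*η) (hy : 0 ≤ y) (hy1 : y ≤ 1) :
    x^(2*α) * Mr α γ l κ T P W D η y ≤ (2^(α+1)*2^(γ+1)*4^(γ+2)*2^(l+1/2)*2^(𝔴 γ l)*(2^(2*κ)+1)) * (ε^(-(𝔴 γ l)) * x^(-1:ℝ)) := by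
  have hP0 : 0 < P := by linarith
  have hη0 : 0 < η := by linarith
  have hW0 : 0 < W := by linarith
  have b1 : (T/P)^(α+γ+2) ≤ (2^(α+1)*x^(-(α+1))) * (2^(γ+1)*ε^(-(γ+1))) := by
    rw [show α+γ+2 = (α+1)+(γ+1) by ring, rpow_add 𝔭]
    apply mul_le_mul
    · rw [rpow_neg hx.le, ← div_eq_mul_inv, ← div_rpow (by norm_num) hx.le]
      apply rpow_le_rpow 𝔭 _ 𝔩
      rw [div_le_div_iff₀ hP0 hx]; linarith
    · rw [rpow_neg hε.le, ← div_eq_mul_inv, ← div_rpow (by norm_num) hε.le]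
      apply rpow_le_rpow 𝔭 _ 𝔩
      refine (div_le_self hT.le hP).trans ?_
      rw [le_div_iff₀ hε]; exact hTε
    · positivity
    · positivity
  have b2 : (W/P)^(-(γ+2)) ≤ 4^(γ+2) := by
    have := rp2 (x := W/P) (c := 4) (z := 1) (p := γ+2) one_pos (by norm_num) (by rw [mul_div_assoc', le_div_iff₀ 𝔩]; linarith) 𝔩
    simpa using this
  have b3 : D^(l+1/2) ≤ 2^(l+1/2) := rpow_le_rpow hD hD1 𝔩
  have b4 : η^(-(𝔴 γ l)) ≤ 2^(𝔴 γ l) := by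
    have := rp2 (x := η) (c := 2) (z := 1) (p := γ+l+3/2) one_pos (by norm_num) hη 𝔩
    simpa using this
  have b5 : D^(2*κ)+y^κ ≤ 2^(2*κ)+1 := add_le_add (rpow_le_rpow hD hD1 𝔩) (rpow_le_one hy hy1 hκ)
  have b6 : ε^(-(γ+1)) ≤ ε^(-(𝔴 γ l)) := rpow_le_rpow_of_exponent_ge hε hε1 𝔩
  have b7 : x^(2*α)*x^(-(α+1)) ≤ x^(-1:ℝ) := by
    rw [← rpow_add hx]
    exact rpow_le_rpow_of_exponent_ge hx hx1 𝔩
  unfold Mr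
  calc _ ≤ x^(2*α) * (((2^(α+1)*x^(-(α+1))) * (2^(γ+1)*ε^(-(γ+1)))) * 4^(γ+2) * 2^(l+1/2) * 2^(𝔴 γ l) * (2^(2*κ)+1)) := by
        refine mul_le_mul_of_nonneg_left ?_ 𝔭
        refine mul_le_mul (mul_le_mul (mul_le_mul (mul_le_mul b1 b2 ?_ ?_) b3 ?_ ?_) b4 ?_ ?_) b5 ?_ ?_ <;> positivity
    _ = (2^(α+1)*2^(γ+1)*4^(γ+2)*2^(l+1/2)*2^(𝔴 γ l)*(2^(2*κ)+1)) * (ε^(-(γ+1)) * (x^(2*α)*x^(-(α+1)))) := by ring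
    _ ≤ _ := by gcongr

theorem Mr_case4 (hαl : l ≤ α) (hγ : -1 < γ) (hl : 0 ≤ l) (hκ : 0 ≤ κ) (hx : 0 < x) (hx1 : x ≤ 1)
    (hT : 0 < T) (hP : 1 ≤ P) (hTP : x*T ≤ 2*P) (hε : 0 < ε) (hη : ε*T ≤ 72*W*η)
    (hW0 : 0 < W) (hWP : W ≤ P) (hD : 0 ≤ D) (hD1 : D ≤ 2) (hy : 0 ≤ y) (hy1 : y ≤ 1) :
    x^(2*α) * Mr α γ l κ T P W D η y ≤ (2^(l+1/2)*72^(𝔴 γ l)*(2^(2*κ)+1)*2^(α-l)) * (ε^(-(𝔴 γ l)) * (T/W)^(1/2:ℝ)) := by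
  have hP0 : 0 < P := by linarith
  have hη0 : 0 < η := by
    by_contra h
    push Not at h
    have : 0 < ε*T := by positivity
    nlinarith
  have b3 : D^(l+1/2) ≤ 2^(l+1/2) := rpow_le_rpow hD hD1 𝔩
  have b4 : η^(-(𝔴 γ l)) ≤ 72^(𝔴 γ l)*(W^(𝔴 γ l)*(ε^(-(𝔴 γ l))*T^(-(𝔴 γ l)))) := by
    have := rp2 (x := η) (c := 72*W) (z := ε*T) (p := γ+l+3/2) 𝔭 𝔭 hη 𝔩
    rw [mul_rpow hε.le hT.le, mul_rpow (by norm_num) hW0.le] at this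
    linarith
  have b5 : D^(2*κ)+y^κ ≤ 2^(2*κ)+1 := add_le_add (rpow_le_rpow hD hD1 𝔩) (rpow_le_one hy hy1 hκ)
  have b1 : (T/P)^(α-l) ≤ 2^(α-l)*x^(-(α-l)) := by
    rw [rpow_neg hx.le, ← div_eq_mul_inv, ← div_rpow (by norm_num) hx.le]
    apply rpow_le_rpow 𝔭 _ 𝔩
    rw [div_le_div_iff₀ hP0 hx]; linarith
  have b6 : x^(2*α)*x^(-(α-l)) ≤ 1 := by
    rw [← rpow_add hx]
    exact rpow_le_one hx.le hx1 𝔩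
  have e1 : (T/P)^(α+γ+2) * (W/P)^(-(γ+2)) * (W^(𝔴 γ l)*T^(-(𝔴 γ l))) = (T/P)^(α-l)*(W/P)^l*(T/W)^(1/2:ℝ) := by
    rw [div_rpow hT.le hP0.le, div_rpow hW0.le hP0.le, div_rpow hT.le hP0.le, div_rpow hW0.le hP0.le, div_rpow hT.le hW0.le]
    simp only [div_eq_mul_inv, ← rpow_neg hP0.le, ← rpow_neg hW0.le, neg_neg]
    have t1 : T^(α+γ+2)*T^(-(𝔴 γ l)) = T^(α-l)*T^(1/2:ℝ) := by rw [← rpow_add hT, ← rpow_add hT]; ring_nf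
    have t2 : P^(-(α+γ+2))*P^(γ+2) = P^(-(α-l))*P^(-l) := by rw [← rpow_add hP0, ← rpow_add hP0]; ring_nf
    have t3 : W^(-(γ+2))*W^(𝔴 γ l) = W^l*W^(-(2⁻¹):ℝ) := by rw [← rpow_add hW0, ← rpow_add hW0]; ring_nf
    norm_num at t1 t2 t3 ⊢
    calc _ = (T^(α+γ+2)*T^(-(𝔴 γ l))) * (P^(-(α+γ+2))*P^(γ+2)) * (W^(-(γ+2))*W^(𝔴 γ l)) := by norm_num; ring
      _ = _ := by norm_num; rw [t1, t2, t3]; ring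
  have b7 : (W/P)^l ≤ 1 := rpow_le_one 𝔭 (by rw [div_le_one hP0]; exact hWP) hl
  unfold Mr
  calc _ ≤ x^(2*α) * ((T/P)^(α+γ+2) * (W/P)^(-(γ+2)) * 2^(l+1/2) * (72^(𝔴 γ l)*(W^(𝔴 γ l)*(ε^(-(𝔴 γ l))*T^(-(𝔴 γ l))))) * (2^(2*κ)+1)) := by
        refine mul_le_mul_of_nonneg_left ?_ 𝔭
        refine mul_le_mul (mul_le_mul (mul_le_mul_of_nonneg_left b3 ?_) b4 ?_ ?_) b5 ?_ ?_ <;> positivity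
    _ = x^(2*α) * (2^(l+1/2)*72^(𝔴 γ l)*(2^(2*κ)+1)*ε^(-(𝔴 γ l))) * ((T/P)^(α+γ+2) * (W/P)^(-(γ+2)) * (W^(𝔴 γ l)*T^(-(𝔴 γ l)))) := by ring
    _ = x^(2*α) * (2^(l+1/2)*72^(𝔴 γ l)*(2^(2*κ)+1)*ε^(-(𝔴 γ l))) * ((T/P)^(α-l)*(W/P)^l*(T/W)^(1/2:ℝ)) := by rw [e1]
    _ ≤ x^(2*α) * (2^(l+1/2)*72^(𝔴 γ l)*(2^(2*κ)+1)*ε^(-(𝔴 γ l))) * ((2^(α-l)*x^(-(α-l)))*1*(T/W)^(1/2:ℝ)) := by gcongr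
    _ = (2^(l+1/2)*72^(𝔴 γ l)*(2^(2*κ)+1)*2^(α-l))*(ε^(-(𝔴 γ l))*(T/W)^(1/2:ℝ)) * (x^(2*α)*x^(-(α-l))) := by ring
    _ ≤ (2^(l+1/2)*72^(𝔴 γ l)*(2^(2*κ)+1)*2^(α-l))*(ε^(-(𝔴 γ l))*(T/W)^(1/2:ℝ)) * 1 := by gcongr
    _ = _ := by ring
end mr

theorem sq_rp {W p : ℝ} (hW : 0 ≤ W) : (W^2)^p = W^(2*p) := by
  rw [← rpow_natCast, ← rpow_mul hW]; norm_num

theorem pw_mid {γ q y c C : ℝ} (hγ : -1 < γ) (hq : 0 < q) (hc : 0 < c) (hC : 0 < C) (h1 : c*q ≤ y) (h2 : y ≤ C*q) :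
    y^γ ≤ (C^(γ+1)*c⁻¹)*q^γ := by
  have hy : 0 < y := lt_of_lt_of_le 𝔭 h1
  have e1 : y^γ = y^(γ+1)*y^(-1:ℝ) := by rw [← rpow_add hy]; ring_nf
  have e2 : q^γ = q^(γ+1)*q^(-1:ℝ) := by rw [← rpow_add hq]; ring_nf
  have b1 := rp1 hy.le hC.le hq.le h2 (p := γ+1) 𝔩
  have b2 : y^(-1:ℝ) ≤ c⁻¹*q^(-1:ℝ) := by
    rw [rpow_neg_one, rpow_neg_one, ← mul_inv]
    exact inv_anti₀ 𝔭 h1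
  rw [e1, e2]
  calc _ ≤ (C^(γ+1)*q^(γ+1))*(c⁻¹*q^(-1:ℝ)) := mul_le_mul b1 b2 𝔭 𝔭
    _ = _ := by ring

theorem loc_fac {q C t n : ℝ} (hq : 0 < q) (hC : 0 < C) (ht : 0 ≤ t) (h : q+t ≤ C*q) (hn : 0 ≤ n) :
    1 ≤ C^n*(q^n*(q+t)^(-n)) := by
  have hqt : 0 < q+t := by positivity
  have := rp1 hqt.le hC.le hq.le h hn
  rw [rpow_neg hqt.le, ← mul_assoc, ← div_eq_mul_inv, le_div_iff₀ 𝔭, one_mul]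
  exact this

theorem sing_pt {W v c : ℝ} (hW : 0 < W) (hv : 0 < v) (hc : 0 < c) (h : v ≤ c*W^2) : W^(-(1/2):ℝ) ≤ c^(1/4:ℝ)*v^(-(1/4):ℝ) := by
  have := rp2 hv hc h (p := 1/4) (by norm_num)
  rw [sq_rp hW.le] at this
  convert this using 2; norm_num

theorem ar0 {W y a : ℝ} (hy : y < 1) (ha : 0 < a) (ha1 : a ≤ 1/8) (h : W^2 ≤ y+a^2) : W ≤ 1.01 := by
  apply le_of_sq_le_sq₀' _ (by norm_num); nlinarith
theorem ar1 {W y a D P η : ℝ} (hW : 0 < W) (hWb : W ≤ 1.01) (ha : 0 < a) (hc : 2*a ≤ W) (hP : 1 ≤ P) (hP1 : P ≤ 1+W)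
    (hη : W ≤ 2*P^2*η) (hD : D ≤ 2*y+W+a) (hW1 : W^2 ≤ y+a^2) (hW2 : y ≤ W^2+a^2) :
    D ≤ 5*W ∧ W ≤ 18*η ∧ W^2 ≤ 2*y ∧ y ≤ 2*W^2 ∧ a^2 ≤ y := by
  have a2 : a^2 ≤ W^2/4 := by nlinarith
  have w2 : W^2 ≤ 1.01*W := by nlinarith
  have hP2 : P^2 ≤ 9 := by nlinarith
  have hη0 : 0 < η := by
    by_contra h
    push Not at h
    have := mul_nonneg (sq_nonneg P) (neg_nonneg.2 h)
    linarith
  have : P^2*η ≤ 9*η := mul_le_mul_of_nonneg_right hP2 hη0.le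
  refine ⟨?_, ?_, ?_, ?_, ?_⟩ <;> linarith [sq_nonneg W]
theorem ar2 {W y a D P η ε : ℝ} (hW : 0 < W) (ha : 0 < a) (ha1 : a ≤ 1/8) (hc : W < 2*a) (hε : 0 < ε) (hP : 1 ≤ P) (hP1 : P ≤ 1+W)
    (hη : y ≤ 1/2 → ε*a ≤ 8*W*P*η) (hD : D ≤ 2*y+W+a) (hW2 : y ≤ W^2+a^2) :
    y ≤ 5*a^2 ∧ D ≤ 5*a ∧ ε*a ≤ 18*W*η := by
  have a2 : W^2 ≤ 4*a^2 := by nlinarith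
  have a3 : a^2 ≤ a/8 := by nlinarith
  have hη' := hη 𝔩
  have hea : 0 < ε*a := by positivity
  have hWη : 0 < W*η := by
    by_contra h
    push Not at h
    have := mul_nonneg (show 0 ≤ P by linarith) (neg_nonneg.2 h)
    linarith
  refine ⟨by linarith, by linarith, ?_⟩
  have : W*η*P ≤ W*η*2 := mul_le_mul_of_nonneg_left 𝔩 hWη.le
  linarith

theorem near_pt {α γ l κ : ℝ} (hα : 0 ≤ α) (hγ : -1 < γ) (hl : 0 ≤ l) (hκ : 0 ≤ κ) (hκ1 : κ ≤ 1/4) :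
    ∃ C, 0 ≤ C ∧ ∀ T P W D η y a ε y1 : ℝ, 1 ≤ T → T ≤ 2 → 1 ≤ P → P ≤ 1+W → 0 < W → 0 ≤ D → D ≤ 2*y+W+a →
      0 < a → a ≤ 1/8 → 0 < ε → 0 < y → y < 1 → (y ≤ 1/2 → ε*a ≤ 8*W*P*η) → (2*a ≤ W → W ≤ 2*P^2*η) →
      W^2 ≤ y+a^2 → y ≤ W^2+a^2 → (1-y)*a^2-y ≤ W^2 → |y-y1| ≤ 2*W^2 → y ≠ y1 →
      y^γ * Mr α γ l κ T P W D η y ≤ C * ((a^2+y)^(-(3/2-κ)) + ε^(-(𝔴 γ l)) * (a^(l-γ-1+2*κ) *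
        (a^(-(1/2):ℝ)*((a^2)^(γ+2)*(y^γ*(a^2+y)^(-(γ+2)))) + (a^2)^γ*((a^2)^(2:ℝ)*(|y-y1|^(-(1/4):ℝ)*(a^2+|y-y1|)^(-(2:ℝ))))))) := by
  obtain ⟨C1, h1, hC1⟩ : ∃ C : ℝ, 0 ≤ C ∧ C = (2^(α+γ+2)*3^(γ+2)*5^(l+1/2)*18^(𝔴 γ l)*(5^(2*κ)*2^κ+1)*2^(γ+3/2)*2^(3/2-κ)) := ⟨_, by positivity, rfl⟩
  obtain ⟨C2, h2, hC2⟩ : ∃ C : ℝ, 0 ≤ C ∧ C = (2^(α+γ+2)*3^(γ+2)*5^(l+1/2)*18^(𝔴 γ l)*(5^(2*κ)+5^κ)*2^l) := ⟨_, by positivity, rfl⟩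
  obtain ⟨A1, hA1, eA1⟩ : ∃ C : ℝ, 0 ≤ C ∧ C = 4^(1/4:ℝ)*6^(γ+2) := ⟨_, by positivity, rfl⟩
  obtain ⟨A2, hA2, eA2⟩ : ∃ C : ℝ, 0 ≤ C ∧ C = (5^(γ+1)*(1/4:ℝ)⁻¹)*(2^(1/4:ℝ)*9^(2:ℝ)) := ⟨_, by positivity, rfl⟩
  refine ⟨C1+C2*(A1+A2), by positivity, ?_⟩
  intro T P W D η y a ε y1 hT hT2 hP hP1 hW hD hD1 ha ha1 hε hy hy1 hη1 hη2 hW1 hW2 hW3 hs hne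
  have hv : 0 < |y-y1| := abs_pos.2 (sub_ne_zero.2 hne)
  generalize hvv : |y-y1| = v at *
  have hWb : W ≤ 1.01 := ar0 hy1 ha ha1 hW1
  have pA : 0 ≤ (a^2+y)^(-(3/2-κ)) := by positivity
  have pB : 0 ≤ a^(-(1/2):ℝ)*((a^2)^(γ+2)*(y^γ*(a^2+y)^(-(γ+2)))) := by positivity
  have pC : 0 ≤ (a^2)^γ*((a^2)^(2:ℝ)*(v^(-(1/4):ℝ)*(a^2+v)^(-(2:ℝ)))) := by positivity
  have pE : 0 ≤ ε^(-(𝔴 γ l)) * a^(l-γ-1+2*κ) := by positivity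
  rcases le_or_gt (2*a) W with hc | hc
  · have hη := hη2 hc
    obtain ⟨q1, q2, q3, q4, q5⟩ := ar1 hW hWb ha hc hP hP1 hη hD1 hW1 hW2
    have := Mr_case1 (T := T) (P := P) (W := W) (D := D) (η := η) (y := y) (a := a) hα hγ hl hκ hκ1 𝔩 hT2 hP 𝔩 hW hD q1 q2 q3 q4 q5
    rw [← hC1] at this
    refine this.trans ?_
    have : 0 ≤ ε^(-(𝔴 γ l)) * (a^(l-γ-1+2*κ) *
        (a^(-(1/2):ℝ)*((a^2)^(γ+2)*(y^γ*(a^2+y)^(-(γ+2)))) + (a^2)^γ*((a^2)^(2:ℝ)*(v^(-(1/4):ℝ)*(a^2+v)^(-(2:ℝ)))))) := by positivity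
    refine mul_le_mul ?_ ?_ pA 𝔭
    · linarith [mul_nonneg h2 (add_nonneg hA1 hA2)]
    · linarith
  · obtain ⟨y5, q1, q2⟩ := ar2 hW ha ha1 hc hε hP hP1 hη1 hD1 hW2
    have := Mr_case2 (T := T) (P := P) (W := W) (D := D) (η := η) (y := y) (a := a) (ε := ε) hα hγ hl hκ hκ1 𝔩 hT2 hP 𝔩 hW ha hc.le hD q1 hε q2 hy.le y5
    rw [← hC2] at this
    have hyg : 0 ≤ y^γ := by positivity
    have key : y^γ*W^(-(1/2):ℝ) ≤ (A1+A2)*(a^(-(1/2):ℝ)*((a^2)^(γ+2)*(y^γ*(a^2+y)^(-(γ+2)))) + (a^2)^γ*((a^2)^(2:ℝ)*(v^(-(1/4):ℝ)*(a^2+v)^(-(2:ℝ))))) := by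
      have hq : 0 < a^2 := by positivity
      rcases le_or_gt y (a^2/4) with hy4 | hy4
      · have b1 : W^(-(1/2):ℝ) ≤ 4^(1/4:ℝ)*a^(-(1/2):ℝ) := by
          have := sing_pt (c := 4) (v := a^2) hW hq (by norm_num) (by
            clear * - hW3 hy4 ha1 ha hy
            have : a^2 ≤ 1/64 := by nlinarith
            have : y*a^2 ≤ 1/64*a^2 := mul_le_mul_of_nonneg_right 𝔩 (sq_nonneg a)
            linarith)
          rw [sq_rp ha.le] at this
          convert this using 3; norm_num
        have b2 := loc_fac (C := 6) (n := γ+2) hq (by norm_num) hy.le 𝔩 𝔩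
        calc _ ≤ y^γ*(4^(1/4:ℝ)*a^(-(1/2):ℝ))*(6^(γ+2)*((a^2)^(γ+2)*(a^2+y)^(-(γ+2)))) := by
              refine (mul_le_mul_of_nonneg_left b1 hyg).trans (le_mul_of_one_le_right 𝔭 b2)
          _ = A1*(a^(-(1/2):ℝ)*((a^2)^(γ+2)*(y^γ*(a^2+y)^(-(γ+2))))) := by rw [eA1]; ring
          _ ≤ _ := by
            refine mul_le_mul ?_ ?_ pB 𝔭 <;> linarith
      · have b0 := pw_mid (c := 1/4) (C := 5) (q := a^2) (y := y) hγ hq (by norm_num) (by norm_num) 𝔩 y5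
        have b1 := sing_pt (c := 2) (v := v) hW hv (by norm_num) hs
        have b2 := loc_fac (C := 9) (t := v) (n := 2) hq (by norm_num) hv.le (by clear * - hs hc hW ha; nlinarith) (by norm_num)
        calc _ ≤ ((5^(γ+1)*(1/4:ℝ)⁻¹)*(a^2)^γ)*(2^(1/4:ℝ)*v^(-(1/4):ℝ))*(9^(2:ℝ)*((a^2)^(2:ℝ)*(a^2+v)^(-(2:ℝ)))) := by
              refine (mul_le_mul b0 b1 𝔭 𝔭).trans (le_mul_of_one_le_right 𝔭 b2)
          _ = A2*((a^2)^γ*((a^2)^(2:ℝ)*(v^(-(1/4):ℝ)*(a^2+v)^(-(2:ℝ))))) := by rw [eA2]; ring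
          _ ≤ _ := by
            refine mul_le_mul ?_ ?_ pC 𝔭 <;> linarith
    calc _ ≤ y^γ*(C2*(ε^(-(𝔴 γ l)) * a^(l-γ-1+2*κ) * W^(-(1/2):ℝ))) := mul_le_mul_of_nonneg_left this hyg
      _ = C2*((ε^(-(𝔴 γ l)) * a^(l-γ-1+2*κ)) * (y^γ*W^(-(1/2):ℝ))) := by ring
      _ ≤ C2*((ε^(-(𝔴 γ l)) * a^(l-γ-1+2*κ)) * _) := mul_le_mul_of_nonneg_left (mul_le_mul_of_nonneg_left key pE) h2
      _ = (C2*(A1+A2))*(ε^(-(𝔴 γ l)) * (a^(l-γ-1+2*κ) * (a^(-(1/2):ℝ)*((a^2)^(γ+2)*(y^γ*(a^2+y)^(-(γ+2)))) + (a^2)^γ*((a^2)^(2:ℝ)*(v^(-(1/4):ℝ)*(a^2+v)^(-(2:ℝ))))))) := by ring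
      _ ≤ _ := by
        refine mul_le_mul ?_ ?_ 𝔭 𝔭 <;> linarith

theorem away_pt {α γ l κ : ℝ} (hαl : l ≤ α) (hγ : -1 < γ) (hl : 0 ≤ l) (hκ : 0 ≤ κ) :
    ∃ C, 0 ≤ C ∧ ∀ T P W D η y x a ε y1 : ℝ, 1 ≤ T → 1 ≤ P → P ≤ 1+W → W ≤ P → 0 < W → 0 ≤ D → D ≤ 2 → 1/8 ≤ a → a ≤ T → T ≤ 9*a →
      0 < ε → ε ≤ 1 → T*ε ≤ 2 → 0 < y → y < 1 → 0 < x → x^2 = 1-y → x*T ≤ 2*P →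
      (1 ≤ 2*η ∧ P ≤ 4*W ∨ ε*T ≤ 72*W*η) →
      W^2 ≤ y+a^2 → (1-y)*a^2-y ≤ W^2 → T^2*|y-y1| ≤ 2*W^2 → y ≠ y1 →
      y^γ * (x^(2*α) * Mr α γ l κ T P W D η y) ≤ C * (ε^(-(𝔴 γ l)) * (x^(-1:ℝ)*y^γ + |y-y1|^(-(1/4):ℝ)*(1+|y-y1|)^(-(2:ℝ)))) := by
  have hα : 0 ≤ α := hl.trans hαl
  obtain ⟨C1, h1, hC1⟩ : ∃ C : ℝ, 0 ≤ C ∧ C = (2^(α+1)*2^(γ+1)*4^(γ+2)*2^(l+1/2)*2^(𝔴 γ l)*(2^(2*κ)+1)) := ⟨_, by positivity, rfl⟩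
  obtain ⟨C2, h2, hC2⟩ : ∃ C : ℝ, 0 ≤ C ∧ C = (2^(l+1/2)*72^(𝔴 γ l)*(2^(2*κ)+1)*2^(α-l)) := ⟨_, by positivity, rfl⟩
  obtain ⟨A2, hA2, eA2⟩ : ∃ C : ℝ, 0 ≤ C ∧ C = (1^(γ+1)*(1/1000:ℝ)⁻¹)*(2^(1/4:ℝ)*5^(2:ℝ)) := ⟨_, by positivity, rfl⟩
  refine ⟨C1+C2*(10+A2), by positivity, ?_⟩
  intro T P W D η y x a ε y1 hT hP hP1 hWP hW hD hD1 ha haT hTa hε hε1 hTε hy hy1 hx hxy hxT hη hW1 hW3 hs hne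
  have hv : 0 < |y-y1| := abs_pos.2 (sub_ne_zero.2 hne)
  generalize hvv : |y-y1| = v at *
  have hx1 : x ≤ 1 := by clear * - hxy hy hx; nlinarith
  have hyg : 0 ≤ y^γ := by positivity
  have pE : 0 ≤ ε^(-(𝔴 γ l)) := by positivity
  have pB : 0 ≤ x^(-1:ℝ)*y^γ := by positivity
  have pC : 0 ≤ v^(-(1/4):ℝ)*(1+v)^(-(2:ℝ)) := by positivity
  rcases hη with ⟨hη, hPW⟩ | hη
  · have := Mr_case3 (T := T) (P := P) (W := W) (D := D) (η := η) (y := y) (x := x) (ε := ε) hα hγ hl hκ hx hx1 𝔩 hP hxT hε hε1 hTε hPW hD hD1 hη hy.le hy1.le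
    rw [← hC1] at this
    calc _ ≤ y^γ*_ := mul_le_mul_of_nonneg_left this hyg
      _ = C1*(ε^(-(𝔴 γ l))*(x^(-1:ℝ)*y^γ)) := by ring
      _ ≤ _ := by
        refine mul_le_mul ?_ ?_ 𝔭 𝔭
        · linarith [mul_nonneg h2 (add_nonneg (by norm_num : (0:ℝ) ≤ 10) hA2)]
        · exact mul_le_mul_of_nonneg_left 𝔩 pE
  · have := Mr_case4 (T := T) (P := P) (W := W) (D := D) (η := η) (y := y) (x := x) (ε := ε) hαl hγ hl hκ hx hx1 𝔩 hP hxT hε hη hW hWP hD hD1 hy.le hy1.le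
    rw [← hC2] at this
    have key : y^γ*(T/W)^(1/2:ℝ) ≤ (10+A2)*(x^(-1:ℝ)*y^γ + v^(-(1/4):ℝ)*(1+v)^(-(2:ℝ))) := by
      rcases le_or_gt y (1/1000) with hy4 | hy4
      · have b1 : (T/W)^(1/2:ℝ) ≤ 10 := by
          have : T/W ≤ 100 := by
            rw [div_le_iff₀ hW]
            have : a ≤ 2*W := by
              apply le_of_sq_le_sq₀' _ 𝔩; clear * - hW3 hy4 hy ha; nlinarith
            linarith
          calc _ ≤ (100:ℝ)^(1/2:ℝ) := rpow_le_rpow 𝔭 this (by norm_num)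
            _ = (10^2:ℝ)^(1/2:ℝ) := by norm_num
            _ = 10 := by rw [sq_rp (by norm_num)]; norm_num
        have b2 : 1 ≤ x^(-1:ℝ) := by
          rw [rpow_neg_one]; exact (one_le_inv₀ hx).2 hx1
        calc _ ≤ y^γ*10*x^(-1:ℝ) := (mul_le_mul_of_nonneg_left b1 hyg).trans (le_mul_of_one_le_right 𝔭 b2)
          _ = 10*(x^(-1:ℝ)*y^γ) := by ring
          _ ≤ _ := by refine mul_le_mul ?_ ?_ pB 𝔭 <;> linarith
      · have b0 := pw_mid (c := 1/1000) (C := 1) (q := 1) (y := y) hγ one_pos (by norm_num) (by norm_num) 𝔩 𝔩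
        have hWT : 0 < W/T := by positivity
        have b1 := sing_pt (c := 2) (v := v) (W := W/T) hWT hv (by norm_num) (by
          rw [div_pow, mul_div_assoc', le_div_iff₀ 𝔭]; linarith)
        rw [rpow_neg hWT.le, ← inv_rpow hWT.le, inv_div] at b1
        have b2 := loc_fac (C := 5) (q := 1) (t := v) (n := 2) one_pos (by norm_num) hv.le (by
          have : W^2 ≤ 2*T^2 := by clear * - hW1 hy1 haT hT ha; nlinarith
          have hT2 : 0 < T^2 := by positivity
          have : T^2*v ≤ T^2*4 := by linarith
          linarith [le_of_mul_le_mul_left this hT2]) (by norm_num)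
        rw [one_rpow γ, mul_one] at b0
        rw [one_rpow, one_mul] at b2
        calc _ ≤ (1^(γ+1)*(1/1000:ℝ)⁻¹)*(2^(1/4:ℝ)*v^(-(1/4):ℝ))*(5^(2:ℝ)*(1+v)^(-(2:ℝ))) := by
              refine (mul_le_mul b0 b1 𝔭 𝔭).trans (le_mul_of_one_le_right 𝔭 b2)
          _ = A2*(v^(-(1/4):ℝ)*(1+v)^(-(2:ℝ))) := by rw [eA2]; ring
          _ ≤ _ := by
            refine mul_le_mul ?_ ?_ pC 𝔭 <;> linarith
    calc _ ≤ y^γ*_ := mul_le_mul_of_nonneg_left this hyg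
      _ = C2*(ε^(-(𝔴 γ l))* (y^γ*(T/W)^(1/2:ℝ))) := by ring
      _ ≤ C2*(ε^(-(𝔴 γ l)) * _) := mul_le_mul_of_nonneg_left (mul_le_mul_of_nonneg_left key pE) h2
      _ = (C2*(10+A2))*(ε^(-(𝔴 γ l)) * (x^(-1:ℝ)*y^γ + v^(-(1/4):ℝ)*(1+v)^(-(2:ℝ)))) := by ring
      _ ≤ _ := by
        refine mul_le_mul ?_ le_rfl 𝔭 𝔭; linarith

theorem lint_abs_univ (G : ℝ → ℝ≥0∞) : ∫⁻ u, G |u| ≤ 2*∫⁻ t in Ioi (0:ℝ), G t := by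
  calc ∫⁻ u, G |u|
    _ = ∫⁻ u in Iio 0 ∪ Ioi 0, G |u| := by
      rw [← setLIntegral_univ]
      apply setLIntegral_congr
      rw [show Iio (0:ℝ) ∪ Ioi 0 = {0}ᶜ by ext x; simp]
      exact (ae_eq_univ.2 (by simp)).symm
    _ ≤ _ := lintegral_union_le _ _ _
    _ = (∫⁻ t in Ioi (0:ℝ), G t) + ∫⁻ t in Ioi (0:ℝ), G t := by
      congr 1
      · rw [← (Measure.measurePreserving_neg volume).setLIntegral_comp_preimage_emb (MeasurableEquiv.neg ℝ).measurableEmbedding]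
        simp only [neg_preimage, abs_neg, Set.neg_Iio, neg_zero]
        exact setLIntegral_congr_fun measurableSet_Ioi (fun x hx => by simp only [abs_of_pos (show 0 < x from hx)])
      · exact setLIntegral_congr_fun measurableSet_Ioi (fun x hx => by simp only [abs_of_pos (show 0 < x from hx)])
    _ = _ := (two_mul _).symm

theorem lint_abs (G : ℝ → ℝ≥0∞) (y1 : ℝ) : ∫⁻ s in 𝔦, G |1-s-y1| ≤ 2*∫⁻ t in Ioi (0:ℝ), G t := by
  calc _ ≤ ∫⁻ s, G |1-s-y1| := setLIntegral_le_lintegral _ _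
    _ = ∫⁻ u, G |u| := by
      have := lintegral_sub_left_eq_self (μ := volume) (fun u => G |u|) (1-y1)
      rw [← this]; congr 1; ext s; congr 2; ring
    _ ≤ _ := lint_abs_univ G

theorem ae_ne_set (y1 : ℝ) : ∀ᵐ s ∂(volume.restrict (𝔦)), s ∈ 𝔦 ∧ 1-s ≠ y1 := by
  filter_upwards [ae_restrict_mem measurableSet_Ioo, ae_restrict_of_ae (Measure.ae_ne volume (1-y1))] with s hs h
  exact ⟨hs, fun h' => h 𝔩⟩

theorem abs_lint {q y1 : ℝ} (hq : 0 < q) : ∫⁻ s in 𝔦, 𝔬 (|1-s-y1|^(-(1/4):ℝ)*(q+|1-s-y1|)^(-(2:ℝ))) ≤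
    𝔬 (5*q^(-(5/4):ℝ)) := by
  refine (lint_abs (fun t => 𝔬 (t^(-(1/4):ℝ)*(q+t)^(-(2:ℝ)))) y1).trans ?_
  have := rpow_int_bound (p := 3/4) (N := 2) (by norm_num) (by norm_num) hq
  rw [show (3/4-1:ℝ) = -(1/4) by norm_num, show (3/4-2:ℝ) = -(5/4) by norm_num] at this
  refine (mul_le_mul_right this _).trans ?_
  rw [show (2:ℝ≥0∞) = 𝔬 2 by simp, ← ENNReal.ofReal_mul (by norm_num)]
  apply ENNReal.ofReal_le_ofReal
  have := rpow_nonneg hq.le (-(5/4):ℝ)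
  norm_num
  linarith

theorem pw_lint {q p N : ℝ} (hp : 0 < p) (hN : p < N) (hq : 0 < q) : ∫⁻ s in 𝔦, 𝔬 ((1-s)^(p-1)*(q+(1-s))^(-N)) ≤
    𝔬 ((1/p+1/(N-p))*q^(p-N)) := by
  rw [lint_sub_left (fun t => 𝔬 (t^(p-1)*(q+t)^(-N)))]
  exact (lintegral_mono_set Ioo_subset_Ioi_self).trans (rpow_int_bound hp hN hq)

theorem rp_any {a b p c : ℝ} (ha : 0 < a) (h1 : a ≤ c*b) (h2 : b ≤ c*a) (hc : 1 ≤ c) : a^p ≤ c^|p| * b^p := by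
  have hb : 0 < b := by
    by_contra h
    push Not at h
    nlinarith
  rcases le_total 0 p with hp | hp
  · rw [abs_of_nonneg hp]; exact rp1 ha.le 𝔩 hb.le h1 hp
  · rw [abs_of_nonpos hp]
    have := rp2 hb 𝔩 h2 (p := -p) 𝔩
    rwa [neg_neg] at this

theorem int_near {γ l κ : ℝ} (hγ : -1 < γ) (hκ : 0 ≤ κ) (hκ1 : κ ≤ 1/4) :
    ∃ C, 0 ≤ C ∧ ∀ a ε y1 : ℝ, 0 < a → 0 < ε →
    ∫⁻ s in 𝔦, 𝔬 ((a^2+(1-s))^(-(3/2-κ)) + ε^(-(𝔴 γ l)) * (a^(l-γ-1+2*κ) *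
        (a^(-(1/2):ℝ)*((a^2)^(γ+2)*((1-s)^γ*(a^2+(1-s))^(-(γ+2)))) + (a^2)^γ*((a^2)^(2:ℝ)*(|1-s-y1|^(-(1/4):ℝ)*(a^2+|1-s-y1|)^(-(2:ℝ)))))))
      ≤ 𝔬 (C*(a^(2*κ-1) + ε^(-(𝔴 γ l))*a^(γ+l+1/2+2*κ))) := by
  refine ⟨(1+1/(1/2-κ)) + (1/(γ+1)+1) + 5, ?_, ?_⟩
  · have : 0 < γ+1 := by linarith
    have : 0 < 1/2-κ := by linarith
    positivity
  intro a ε y1 ha hε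
  have hq : 0 < a^2 := by positivity
  have g1 : 0 < γ+1 := by linarith
  have k1 : 0 < 1/2-κ := by linarith
  have i1 := pw_lint (p := 1) (N := 3/2-κ) one_pos 𝔩 hq
  have i2 := pw_lint (p := γ+1) (N := γ+2) g1 𝔩 hq
  have i3 := abs_lint (q := a^2) (y1 := y1) hq
  simp only [sub_self, rpow_zero, one_mul] at i1
  rw [add_sub_cancel_right] at i2
  have e1 : ∀ s ∈ 𝔦, 𝔬 ((a^2+(1-s))^(-(3/2-κ)) + ε^(-(𝔴 γ l)) * (a^(l-γ-1+2*κ) *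
        (a^(-(1/2):ℝ)*((a^2)^(γ+2)*((1-s)^γ*(a^2+(1-s))^(-(γ+2)))) + (a^2)^γ*((a^2)^(2:ℝ)*(|1-s-y1|^(-(1/4):ℝ)*(a^2+|1-s-y1|)^(-(2:ℝ)))))))
      = 𝔬 ((a^2+(1-s))^(-(3/2-κ))) + (𝔬 (ε^(-(𝔴 γ l)) * (a^(l-γ-1+2*κ)*(a^(-(1/2):ℝ)*(a^2)^(γ+2))))*𝔬 ((1-s)^γ*(a^2+(1-s))^(-(γ+2)))
        + 𝔬 (ε^(-(𝔴 γ l)) * (a^(l-γ-1+2*κ)*((a^2)^γ*(a^2)^(2:ℝ)))) * 𝔬 (|1-s-y1|^(-(1/4):ℝ)*(a^2+|1-s-y1|)^(-(2:ℝ)))) := by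
    intro s hs
    have h1 : 0 < 1-s := by linarith [hs.2]
    rw [← ENNReal.ofReal_mul 𝔭, ← ENNReal.ofReal_mul 𝔭, ← ENNReal.ofReal_add 𝔭 𝔭, ← ENNReal.ofReal_add 𝔭 𝔭]
    congr 1; ring
  rw [setLIntegral_congr_fun measurableSet_Ioo e1, lintegral_add_left (by fun_prop), lintegral_add_left (by fun_prop), lintegral_const_mul' _ _ ENNReal.ofReal_ne_top, lintegral_const_mul' _ _ ENNReal.ofReal_ne_top]
  refine (add_le_add i1 (add_le_add (mul_le_mul_right i2 _) (mul_le_mul_right i3 _))).trans ?_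
  have k2 : 0 < 3/2-κ-1 := by linarith
  have k3 : 0 < γ+2-(γ+1) := by linarith
  rw [← ENNReal.ofReal_mul 𝔭, ← ENNReal.ofReal_mul 𝔭, ← ENNReal.ofReal_add 𝔭 𝔭, ← ENNReal.ofReal_add 𝔭 𝔭]
  apply ENNReal.ofReal_le_ofReal
  have f1 : (a^2)^(1-(3/2-κ)) = a^(2*κ-1) := by rw [sq_rp ha.le]; congr 1; ring
  have f2 : a^(l-γ-1+2*κ)*(a^(-(1/2):ℝ)*(a^2)^(γ+2)) * (a^2)^(γ+1-(γ+2)) = a^(γ+l+1/2+2*κ) := by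
    rw [sq_rp ha.le, sq_rp ha.le, ← rpow_add ha, ← rpow_add ha, ← rpow_add ha]; congr 1; ring
  have f3 : a^(l-γ-1+2*κ)*((a^2)^γ*(a^2)^(2:ℝ))*(a^2)^(-(5/4):ℝ) = a^(γ+l+1/2+2*κ) := by
    rw [sq_rp ha.le, sq_rp ha.le, sq_rp ha.le, ← rpow_add ha, ← rpow_add ha, ← rpow_add ha]; congr 1; ring
  have p1 : 0 ≤ a^(2*κ-1) := by positivity
  have p2 : 0 ≤ ε^(-(𝔴 γ l))*a^(γ+l+1/2+2*κ) := by positivity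
  calc _ = (1+1/(1/2-κ))*a^(2*κ-1) + ((1/(γ+1)+1)+5)*(ε^(-(𝔴 γ l))*a^(γ+l+1/2+2*κ)) := by
        rw [f1]
        have h2 : ε^(-(𝔴 γ l)) * (a^(l-γ-1+2*κ)*(a^(-(1/2):ℝ)*(a^2)^(γ+2))) * ((1/(γ+1)+1/(γ+2-(γ+1)))*(a^2)^(γ+1-(γ+2))) = (1/(γ+1)+1)*(ε^(-(𝔴 γ l))*a^(γ+l+1/2+2*κ)) := by
          rw [← f2, show γ+2-(γ+1) = 1 by ring]; ring
        have h3 : ε^(-(𝔴 γ l)) * (a^(l-γ-1+2*κ)*((a^2)^γ*(a^2)^(2:ℝ)))*(5*(a^2)^(-(5/4):ℝ)) = 5*(ε^(-(𝔴 γ l))*a^(γ+l+1/2+2*κ)) := by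
          rw [← f3]; ring
        rw [h2, h3, show 3/2-κ-1 = 1/2-κ by ring]; ring
    _ ≤ _ := by
      have : 0 ≤ 1/(1/2-κ) := by positivity
      have : 0 ≤ 1/(γ+1) := by positivity
      rw [mul_add]
      apply add_le_add <;> apply mul_le_mul_of_nonneg_right _ (by assumption) <;> linarith

theorem int_away {γ : ℝ} (hγ : -1 < γ) :
    ∃ C, 0 ≤ C ∧ ∀ y1 : ℝ,
    ∫⁻ s in 𝔦, 𝔬 ((√s)^(-1:ℝ)*(1-s)^γ + |1-s-y1|^(-(1/4):ℝ)*(1+|1-s-y1|)^(-(2:ℝ))) ≤ 𝔬 C := by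
  refine ⟨Gamma (1/2)*Gamma (γ+1)/Gamma (1/2+(γ+1)) + 5, ?_, ?_⟩
  · have h1 := Gamma_pos_of_pos (show (0:ℝ) < 1/2 by norm_num)
    have h2 := Gamma_pos_of_pos (show (0:ℝ) < γ+1 by linarith)
    have h3 := Gamma_pos_of_pos (show (0:ℝ) < 1/2+(γ+1) by linarith)
    positivity
  intro y1
  have h1 := Gamma_pos_of_pos (show (0:ℝ) < 1/2 by norm_num)
  have h2 := Gamma_pos_of_pos (show (0:ℝ) < γ+1 by linarith)
  have h3 := Gamma_pos_of_pos (show (0:ℝ) < 1/2+(γ+1) by linarith)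
  have i3 := abs_lint (q := 1) (y1 := y1) one_pos
  rw [one_rpow, mul_one] at i3
  have i1 : ∫⁻ s in 𝔦, 𝔬 ((√s)^(-1:ℝ)*(1-s)^γ) ≤ 𝔬 (Gamma (1/2)*Gamma (γ+1)/Gamma (1/2+(γ+1))) := by
    refine lint_le measurableSet_Ioo (beta_integrable (a := 1/2) (b := γ+1) (by norm_num) 𝔩) ?_ ?_ (beta_integral (by norm_num) 𝔩).le
    · intro s hs
      apply le_of_eq
      rw [add_sub_cancel_right, sqrt_eq_rpow, ← rpow_mul hs.1.le]; norm_num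
    · intro s hs
      have h1 : 0 < 1-s := by linarith [hs.2]
      have := hs.1
      positivity
  have e1 : ∀ s ∈ 𝔦, 𝔬 ((√s)^(-1:ℝ)*(1-s)^γ + |1-s-y1|^(-(1/4):ℝ)*(1+|1-s-y1|)^(-(2:ℝ))) =
      𝔬 ((√s)^(-1:ℝ)*(1-s)^γ) + 𝔬 (|1-s-y1|^(-(1/4):ℝ)*(1+|1-s-y1|)^(-(2:ℝ))) := by
    intro s hs
    have h1 : 0 < 1-s := by linarith [hs.2]
    rw [ENNReal.ofReal_add 𝔭 𝔭]
  rw [setLIntegral_congr_fun measurableSet_Ioo e1, lintegral_add_left (by fun_prop), ENNReal.ofReal_add 𝔭 (by norm_num)]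
  exact add_le_add i1 i3

theorem sixA {α γ l κ : ℝ} (hαl : l ≤ α) (hγ : -1 < γ) (hl : 0 ≤ l) (hκ : 0 ≤ κ) (hκ1 : κ ≤ 1/4) :
    ∃ C, 0 ≤ C ∧ ∀ r : ℂ, 1/2 ≤ ‖r‖ → ‖r‖ < 1 →
    ∫⁻ s in 𝔦, 𝔬 (s^α*((1-s)^γ*Mr α γ l κ ‖1+zt r‖ ‖1+ww s r‖ ‖ww s r‖ ‖1-XX s r‖ (1-‖XX s r‖) (1-s)))
      ≤ 𝔬 (C*(‖1-r‖^(γ+l+1/2+2*κ)*(1-‖r‖)^(-(𝔴 γ l)))) := by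
  have hα : 0 ≤ α := hl.trans hαl
  obtain ⟨C1, hC1, H1⟩ := near_pt hα hγ hl hκ hκ1
  obtain ⟨C2, hC2, H2⟩ := away_pt (κ := κ) hαl hγ hl hκ
  obtain ⟨D1, hD1, I1⟩ := int_near (l := l) hγ hκ hκ1
  obtain ⟨D2, hD2, I2⟩ := int_away hγ
  refine ⟨C1*D1*(2^|2*κ-1|+2^|γ+l+1/2+2*κ|) + C2*D2*9^|γ+l+1/2+2*κ|, by positivity, ?_⟩
  intro r hr2 hr
  obtain ⟨y1, hy1⟩ := geo_sing hr hr2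
  have hε : 0 < 1-‖r‖ := by linarith
  have hz := zt_re_pos hr
  have ha : 0 < ‖zt r‖ := norm_pos_iff.2 (fun h => by rw [h] at hz; simp at hz)
  have hT := norm_one_add_ge hz
  have hT' : ‖1+zt r‖ ≤ 1+‖zt r‖ := (norm_add_le _ _).trans (by simp)
  have hrr : ‖1-r‖*‖1+zt r‖ = 2*‖zt r‖ := norm_one_sub_r hr
  have hεr : 1-‖r‖ ≤ ‖1-r‖ := by
    have := norm_sub_norm_le 1 r; simpa using this
  have h1r : 0 < ‖1-r‖ := by linarith
  rcases le_or_gt ‖zt r‖ (1/8) with hz8 | hz8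
  · -- near
    calc _ ≤ ∫⁻ s in 𝔦, 𝔬 C1 * 𝔬 ((‖zt r‖^2+(1-s))^(-(3/2-κ)) + (1-‖r‖)^(-(𝔴 γ l)) * (‖zt r‖^(l-γ-1+2*κ) *
        (‖zt r‖^(-(1/2):ℝ)*((‖zt r‖^2)^(γ+2)*((1-s)^γ*(‖zt r‖^2+(1-s))^(-(γ+2)))) + (‖zt r‖^2)^γ*((‖zt r‖^2)^(2:ℝ)*(|1-s-y1|^(-(1/4):ℝ)*(‖zt r‖^2+|1-s-y1|)^(-(2:ℝ))))))) := by
          apply lintegral_mono_ae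
          filter_upwards [ae_ne_set y1] with s ⟨hs, hne⟩
          rw [← ENNReal.ofReal_mul hC1]
          apply ENNReal.ofReal_le_ofReal
          have hs1 := hs.2.le
          have hw := ww_re_pos hs.1 hs1 hr
          have hW : 0 < ‖ww s r‖ := norm_pos_iff.2 (fun h => by rw [h] at hw; simp at hw)
          have hP := norm_one_add_ge hw
          have hP' : ‖1+ww s r‖ ≤ 1+‖ww s r‖ := (norm_add_le _ _).trans (by simp)
          obtain ⟨g1, g2, g3⟩ := geo_W (r := r) hs.1 hs1
          have hX : ‖XX s r‖ < 1 := (norm_XX_le hs.1 hs1 hr).trans_lt hr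
          have y0 : 0 < 1-s := by linarith [hs.2]
          have := H1 ‖1+zt r‖ ‖1+ww s r‖ ‖ww s r‖ ‖1-XX s r‖ (1-‖XX s r‖) (1-s) ‖zt r‖ (1-‖r‖) y1 hT.1 𝔩 hP.1 hP' hW (norm_nonneg _)
            (geo_D hs.1 hs1 hr) ha hz8 hε y0 (by linarith [hs.1]) (by
              intro hs2
              have h1 := geo_eta hs.1 hs1 hr
              have h2 := (geo_add hs.1 hs1 hr).2
              have h3 : 1/2 ≤ √s := by
                apply le_sqrt_of_sq_le; norm_num; linarith
              have h4 : (1-‖r‖)*(1/2)*‖zt r‖*1 ≤ (1-‖r‖)*√s*‖ww s r+zt r‖*‖1+zt r‖ := by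
                gcongr
                exact hT.1
              linarith) (fun h => by linarith [geo_eta2 hs.1 hs1 hr h]) g1 g2 𝔩 (by
                have h5 := hy1 s
                have h6 : 1*|1-s-y1| ≤ ‖1+zt r‖^2*|1-s-y1| := by
                  gcongr; nlinarith [hT.1]
                linarith) hne
          refine le_trans ?_ this
          refine mul_le_of_le_one_left ?_ (rpow_le_one hs.1.le hs1 hα)
          unfold Mr
          have : 0 < 1-‖XX s r‖ := by linarith
          positivity
      _ ≤ 𝔬 C1 * 𝔬 (D1*(‖zt r‖^(2*κ-1) + (1-‖r‖)^(-(𝔴 γ l))*‖zt r‖^(γ+l+1/2+2*κ))) := by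
          rw [lintegral_const_mul' _ _ ENNReal.ofReal_ne_top]
          exact mul_le_mul_right (I1 _ _ _ ha hε) _
      _ ≤ _ := by
          rw [← ENNReal.ofReal_mul hC1]
          apply ENNReal.ofReal_le_ofReal
          have q1 : ‖zt r‖ ≤ 2*‖1-r‖ := by nlinarith [hT.1]
          have q2 : ‖1-r‖ ≤ 2*‖zt r‖ := by nlinarith [hT.1]
          have b1 := rp_any (p := 2*κ-1) ha q1 q2 (by norm_num)
          have b2 := rp_any (p := γ+l+1/2+2*κ) ha q1 q2 (by norm_num)
          have b3 : ‖1-r‖^(2*κ-1) ≤ ‖1-r‖^(γ+l+1/2+2*κ)*(1-‖r‖)^(-(𝔴 γ l)) := by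
            rw [show 2*κ-1 = (γ+l+1/2+2*κ)+(-(𝔴 γ l)) by ring, rpow_add h1r]
            refine mul_le_mul_of_nonneg_left ?_ 𝔭
            exact rpow_le_rpow_of_nonpos hε hεr 𝔩
          have hE : 0 ≤ (1-‖r‖)^(-(𝔴 γ l)) := by positivity
          generalize hZ : ‖1-r‖^(γ+l+1/2+2*κ)*(1-‖r‖)^(-(𝔴 γ l)) = Z at *
          have hZ0 : 0 ≤ Z := by rw [← hZ]; positivity
          have c1 : ‖zt r‖^(2*κ-1) ≤ 2^|2*κ-1| *Z := b1.trans (mul_le_mul_of_nonneg_left b3 𝔭)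
          have c2 : (1-‖r‖)^(-(𝔴 γ l))*‖zt r‖^(γ+l+1/2+2*κ) ≤ 2^|γ+l+1/2+2*κ| *Z := by
            refine (mul_le_mul_of_nonneg_left b2 hE).trans (le_of_eq ?_)
            rw [← hZ]; ring
          have c3 : 0 ≤ C2*D2*9^|γ+l+1/2+2*κ| := by positivity
          calc C1*(D1*(_+_)) ≤ C1*(D1*(2^|2*κ-1| *Z+2^|γ+l+1/2+2*κ| *Z)) := by
                apply mul_le_mul_of_nonneg_left _ hC1
                apply mul_le_mul_of_nonneg_left (add_le_add c1 c2) hD1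
            _ = (C1*D1*(2^|2*κ-1|+2^|γ+l+1/2+2*κ|))*Z := by ring
            _ ≤ _ := by apply mul_le_mul_of_nonneg_right _ hZ0; linarith
  · calc _ ≤ ∫⁻ s in 𝔦, 𝔬 (C2*(1-‖r‖)^(-(𝔴 γ l))) * 𝔬 ((√s)^(-1:ℝ)*(1-s)^γ + |1-s-y1|^(-(1/4):ℝ)*(1+|1-s-y1|)^(-(2:ℝ))) := by
          apply lintegral_mono_ae
          filter_upwards [ae_ne_set y1] with s ⟨hs, hne⟩
          rw [← ENNReal.ofReal_mul 𝔭]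
          apply ENNReal.ofReal_le_ofReal
          have hs1 := hs.2.le
          have hw := ww_re_pos hs.1 hs1 hr
          have hW : 0 < ‖ww s r‖ := norm_pos_iff.2 (fun h => by rw [h] at hw; simp at hw)
          have hP := norm_one_add_ge hw
          have hP' : ‖1+ww s r‖ ≤ 1+‖ww s r‖ := (norm_add_le _ _).trans (by simp)
          obtain ⟨g1, g2, g3⟩ := geo_W (r := r) hs.1 hs1
          have hX : ‖XX s r‖ < 1 := (norm_XX_le hs.1 hs1 hr).trans_lt hr
          have y0 : 0 < 1-s := by linarith [hs.2]
          have x0 : 0 < √s := sqrt_pos.2 hs.1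
          have hXn := norm_XX hs.1 hs1 hr
          have hP0 : 0 < ‖1+ww s r‖ := by linarith [hP.1]
          have hT0 : 0 < ‖1+zt r‖ := by linarith [hT.1]
          have hxT0 : 0 < √s*‖1+zt r‖ := by positivity
          have := H2 ‖1+zt r‖ ‖1+ww s r‖ ‖ww s r‖ ‖1-XX s r‖ (1-‖XX s r‖) (1-s) (√s) ‖zt r‖ (1-‖r‖) y1 hT.1 hP.1 hP' hP.2 hW (norm_nonneg _)
            ((norm_sub_le _ _).trans (by simp; linarith)) hz8.le hT.2 𝔩 hε (by linarith [norm_nonneg r]) (by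
              have h1 := norm_one_add_r hr
              have h2 : 1-‖r‖ ≤ ‖1+r‖ := by
                have := norm_sub_norm_le 1 (-r); simpa using this
              calc _ ≤ ‖1+zt r‖*‖1+r‖ := mul_le_mul_of_nonneg_left h2 hT0.le
                _ = 2 := by linarith) y0 (by linarith [hs.1]) x0 (by rw [sq_sqrt hs.1.le]; ring) (by
              have h1 : ‖XX s r‖*‖1+ww s r‖ ≤ 1*‖1+ww s r‖ := mul_le_mul_of_nonneg_right hX.le hP0.le
              have h2 : √s*‖1+zt r‖*(1/2) ≤ √s*‖1+zt r‖*‖r‖ := mul_le_mul_of_nonneg_left hr2 hxT0.le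
              linarith) (by
              rcases lt_or_ge ‖XX s r‖ (1/2) with hx2 | hx2
              · left
                refine ⟨by linarith, ?_⟩
                have h1 := norm_XX_sq hs.1 hs1 hr
                have h2 := norm_one_sub_qq hs.1 hs1 hr
                have h3 : ‖qq s r‖ ≤ 1/2 := by nlinarith [norm_nonneg (qq s r), norm_nonneg (XX s r)]
                have h4 : 1/2 ≤ ‖1-qq s r‖ := by
                  have := norm_sub_norm_le 1 (qq s r); simp at this; linarith
                rw [h2, le_div_iff₀ hP0] at h4
                linarith
              · right
                have h1 := geo_eta hs.1 hs1 hr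
                have h2 := (geo_add hs.1 hs1 hr).2
                have h3 : ‖1+ww s r‖ ≤ 2*(√s*‖1+zt r‖) := by
                  have h4 : (1/2)*‖1+ww s r‖ ≤ ‖XX s r‖*‖1+ww s r‖ := mul_le_mul_of_nonneg_right hx2 hP0.le
                  have h5 : √s*‖1+zt r‖*‖r‖ ≤ √s*‖1+zt r‖*1 := mul_le_mul_of_nonneg_left hr.le hxT0.le
                  linarith
                have h6 : ‖1+zt r‖ ≤ 9*‖ww s r+zt r‖ := by linarith
                have h7 : √s*‖1+zt r‖ ≤ √s*(9*‖ww s r+zt r‖) := mul_le_mul_of_nonneg_left h6 x0.le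
                have h8 : ((1-‖r‖)*‖1+zt r‖)*‖1+ww s r‖ ≤ ((1-‖r‖)*‖1+zt r‖)*(18*(√s*‖ww s r+zt r‖)) := mul_le_mul_of_nonneg_left 𝔩 𝔭
                refine le_of_mul_le_mul_right (a := ‖1+ww s r‖) ?_ hP0
                linarith) g1 𝔩 (hy1 s) hne
          have e1 : (√s)^(2*α) = s^α := by
            rw [sqrt_eq_rpow, ← rpow_mul hs.1.le]; congr 1; ring
          rw [e1] at this
          calc _ = _ := by ring
            _ ≤ _ := this
            _ = _ := by ring
      _ ≤ 𝔬 (C2*(1-‖r‖)^(-(𝔴 γ l))) * 𝔬 D2 := by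
          rw [lintegral_const_mul' _ _ ENNReal.ofReal_ne_top]
          exact mul_le_mul_right (I2 _) _
      _ ≤ _ := by
          rw [← ENNReal.ofReal_mul 𝔭]
          apply ENNReal.ofReal_le_ofReal
          have q1 : 1 ≤ 9*‖1-r‖ := by nlinarith [hT.1]
          have q2 : ‖1-r‖ ≤ 9*1 := by
            have := norm_sub_le 1 r; simp at this; linarith
          have b2 := rp_any (p := γ+l+1/2+2*κ) one_pos q1 q2 (by norm_num)
          rw [one_rpow] at b2
          have c3 : 0 ≤ C1*D1*(2^|2*κ-1|+2^|γ+l+1/2+2*κ|) := by positivity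
          have hE : 0 ≤ (1-‖r‖)^(-(𝔴 γ l)) := by positivity
          calc _ = C2*D2*(1-‖r‖)^(-(𝔴 γ l))*1 := by ring
            _ ≤ C2*D2*(1-‖r‖)^(-(𝔴 γ l))*_ := mul_le_mul_of_nonneg_left b2 𝔭
            _ = (C2*D2*9^|γ+l+1/2+2*κ|)*(‖1-r‖^(γ+l+1/2+2*κ)*(1-‖r‖)^(-(𝔴 γ l))) := by ring
            _ ≤ _ := by apply mul_le_mul_of_nonneg_right _ 𝔭; linarith

theorem cz_lower {R : ℝ} (hR : 1/2 ≤ R) (hR1 : R < 1) {θ : ℝ} (hθ : |θ| ≤ π) : (1-R)+|θ| ≤ 4*‖1-cz R θ‖ := by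
  have h1 : ‖1-cz R θ‖^2 = (1-R)^2+2*R*(1-cos θ) := by
    have hs := sin_sq_add_cos_sq θ
    rw [← Complex.normSq_eq_norm_sq, Complex.normSq_apply]
    have e1 : (1-cz R θ).re = 1-R*cos θ := by simp [cz, Complex.exp_ofReal_mul_I_re, Complex.exp_ofReal_mul_I_im]
    have e2 : (1-cz R θ).im = -(R*sin θ) := by simp [cz, Complex.exp_ofReal_mul_I_re, Complex.exp_ofReal_mul_I_im]
    rw [e1, e2]
    linear_combination R^2*hs
  have h2 := cos_le_one_sub_mul_cos_sq hθ
  have h3 : 1/5 ≤ 2/π^2 := by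
    rw [div_le_div_iff₀ (by norm_num) 𝔭]
    have := pi_lt_d2; nlinarith [pi_pos]
  have h4 : 1/5*θ^2 ≤ 1-cos θ := by
    have := mul_le_mul_of_nonneg_right h3 (sq_nonneg θ); linarith
  have h5 : 1*(1-cos θ) ≤ 2*R*(1-cos θ) := mul_le_mul_of_nonneg_right 𝔩 (by linarith [cos_le_one θ])
  apply le_of_sq_le_sq₀' _ 𝔭
  have := sq_abs θ
  rw [mul_pow, h1]
  nlinarith [sq_nonneg (1-R-|θ|), sq_nonneg (1-R)]

theorem theta_int {m : ℝ} (hm : 0 < m) : ∃ C, 0 ≤ C ∧ ∀ R, 1/2 ≤ R → R < 1 →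
    ∫⁻ θ in Ioc (-π) π, 𝔬 (‖1-cz R θ‖^(-(m+1))) ≤ 𝔬 (C*(1-R)^(-m)) := by
  refine ⟨4^(m+1)*(2*(1+1/m)), by positivity, ?_⟩
  intro R hR hR1
  have hε : 0 < 1-R := by linarith
  have ib := rpow_int_bound (p := 1) (N := m+1) one_pos 𝔩 hε
  simp only [sub_self, rpow_zero, one_mul] at ib
  rw [show 1/1+1/(m+1-1) = 1+1/m by rw [add_sub_cancel_right, div_one], show 1-(m+1) = -m by ring] at ib
  calc _ ≤ ∫⁻ θ in Ioc (-π) π, 𝔬 (4^(m+1))*𝔬 (((1-R)+|θ|)^(-(m+1))) := by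
        refine setLIntegral_mono' measurableSet_Ioc (fun θ hθ => ?_)
        rw [← ENNReal.ofReal_mul 𝔭]
        apply ENNReal.ofReal_le_ofReal
        exact rp2 𝔭 (by norm_num) (cz_lower hR hR1 (abs_le.2 ⟨hθ.1.le, hθ.2⟩)) 𝔩
    _ ≤ ∫⁻ θ, 𝔬 (4^(m+1))*𝔬 (((1-R)+|θ|)^(-(m+1))) := setLIntegral_le_lintegral _ _
    _ = 𝔬 (4^(m+1))*∫⁻ θ, 𝔬 (((1-R)+|θ|)^(-(m+1))) := lintegral_const_mul' _ _ ENNReal.ofReal_ne_top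
    _ ≤ 𝔬 (4^(m+1))*(2*𝔬 ((1+1/m)*(1-R)^(-m))) := by
        refine mul_le_mul_right ?_ _
        exact (lint_abs_univ (fun t => 𝔬 (((1-R)+t)^(-(m+1))))).trans (mul_le_mul_right ib _)
    _ = _ := by
        rw [show (2:ℝ≥0∞) = 𝔬 2 by simp, ← ENNReal.ofReal_mul (by norm_num), ← ENNReal.ofReal_mul 𝔭]
        congr 1; ring

theorem Rn_bound {n : ℕ} (hn : 2 ≤ n) : exp (-2) ≤ (1-1/(n:ℝ))^n := by
  have hn' : (2:ℝ) ≤ n := by exact_mod_cast hn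
  have h1 : exp (-(2/n)) ≤ 1-1/(n:ℝ) := by
    have h2 : 0 < 1-1/(n:ℝ) := by rw [sub_pos, div_lt_one 𝔩]; linarith
    rw [exp_neg, inv_le_comm₀ (exp_pos _) h2]
    refine le_trans ?_ (add_one_le_exp _)
    rw [inv_le_iff_one_le_mul₀ h2]
    have : 0 < (n:ℝ) := by linarith
    have e : (2/(n:ℝ)+1)*(1-1/n) - 1 = (n-2)/n^2 := by field_simp; ring
    have : 0 ≤ ((n:ℝ)-2)/n^2 := div_nonneg 𝔩 𝔭
    linarith
  calc _ = (exp (-(2/n)))^n := by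
        rw [← exp_nat_mul]; congr 1; field_simp
    _ ≤ _ := pow_le_pow_left₀ (exp_pos _).le h1 n

theorem XX_meas : Measurable (fun p : ℝ × ℂ => XX p.1 p.2) := by
  unfold XX ww zt; fun_prop
theorem ww_meas : Measurable (fun p : ℝ × ℂ => ww p.1 p.2) := by
  unfold ww zt; fun_prop
theorem zt_meas : Measurable zt := by
  unfold zt; fun_prop
theorem cz_meas (R : ℝ) : Measurable (cz R) := by
  unfold cz; fun_prop

theorem K_pt (d : ℕ) (hd : 2 ≤ d) {β γ δ : ℝ} (hβ : -(1/2) ≤ β) (hγ : -1 < γ) {N : ℕ} (hN : γ+1 < N) :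
    ∃ C, 0 ≤ C ∧ ∀ n : ℕ, 2 ≤ n → ∀ s ω : ℝ, 0 < s → s < 1 →
    ‖∑ j ∈ 𝔯 (n+1), binomC (δ-1) (n-j)*KnV0 d β γ j 1 s (cos ω)‖ₑ ≤
      ∫⁻ θ in Ioc (-π) π, 𝔬 (C*(‖1-cz (1-1/n) θ‖^(-δ)*((‖1+zt (cz (1-1/n) θ)‖/‖1+ww s (cz (1-1/n) θ)‖)^(β+𝔡 d+γ+2)
        *(‖ww s (cz (1-1/n) θ)‖/‖1+ww s (cz (1-1/n) θ)‖)^(-(γ+2)))))*Vint γ (((d:ℝ)-2)/2) N ω (XX s (cz (1-1/n) θ)) := by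
  have hd' : (2:ℝ) ≤ d := by exact_mod_cast hd
  obtain ⟨C, hC, HF⟩ := FF_bound (α := β+𝔡 d) (l := ((d:ℝ)-2)/2) 𝔩 hγ 𝔩 hN
  refine ⟨exp 2*C, by positivity, ?_⟩
  intro n hn s ω hs hs1
  have hn' : (2:ℝ) ≤ n := by exact_mod_cast hn
  have hn1 : 1/(n:ℝ) ≤ 1/2 := one_div_le_one_div_of_le (by norm_num) hn'
  have hn0 : 0 < 1/(n:ℝ) := by positivity
  have K := Kcoef d hd β γ δ hβ hγ n s ω (1-1/n) hs hs1.le 𝔩 𝔩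
  have hRn := Rn_bound hn
  generalize (∑ j ∈ 𝔯 (n+1), binomC (δ-1) (n-j)*KnV0 d β γ j 1 s (cos ω)) = S at *
  have hR0 : 0 ≤ 1-1/(n:ℝ) := by linarith
  have hR1 : 1-1/(n:ℝ) < 1 := by linarith
  generalize hRe : 1-1/(n:ℝ) = R at *
  have h1 : ‖S‖ₑ ≤ 𝔬 (exp 2) * ‖(2*π*R^n*(S:ℂ) : ℂ)‖ₑ := by
    rw [← ofReal_norm, ← ofReal_norm, ← ENNReal.ofReal_mul 𝔭]
    apply ENNReal.ofReal_le_ofReal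
    rw [norm_mul, norm_mul, norm_mul, norm_pow, Complex.norm_real, Complex.norm_real, Complex.norm_real, Complex.norm_ofNat, norm_of_nonneg pi_pos.le, norm_of_nonneg hR0]
    have h2 : 1 ≤ exp 2*R^n := by
      calc (1:ℝ) = exp 2*exp (-2) := by rw [← exp_add]; simp
        _ ≤ _ := by gcongr
    have h3 : 1*1 ≤ (2*π)*(exp 2*R^n) := mul_le_mul (by linarith [pi_gt_three]) h2 (by norm_num) 𝔭
    nlinarith [norm_nonneg S]
  refine h1.trans ?_
  rw [K, intervalIntegral.integral_of_le (by linarith [pi_pos])]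
  refine (mul_le_mul_right (enorm_integral_le_lintegral_enorm _) _).trans ?_
  rw [← lintegral_const_mul' _ _ ENNReal.ofReal_ne_top]
  apply lintegral_mono
  intro θ
  have hr : ‖cz R θ‖ < 1 := by rw [norm_cz hR0]; exact hR1
  simp only [enorm_mul]
  have hF := HF ω (qq s (cz R θ)) (XX s (cz R θ)) (norm_qq_le_XX hs hs1.le hr) ((norm_XX_le hs hs1.le hr).trans_lt hr)
  change _ ≤ _ * Vint γ (((d:ℝ)-2)/2) N ω (XX s (cz R θ)) at hF
  generalize Vint γ (((d:ℝ)-2)/2) N ω (XX s (cz R θ)) = V at *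
  generalize FF (β+𝔡 d) γ (((d:ℝ)-2)/2) ω (qq s (cz R θ)) (XX s (cz R θ)) = F at *
  have e1 : ‖Complex.exp (-(n*(θ*Complex.I)))‖ₑ = 1 := by
    rw [← ofReal_norm, norm_exp_neg]; simp
  have e2 : ‖(1-cz R θ)^(-(δ:ℂ))‖ₑ = 𝔬 (‖1-cz R θ‖^(-δ)) := by
    rw [← ofReal_norm, ← Complex.ofReal_neg, Complex.norm_cpow_real]
  have e3 := norm_pref (β+𝔡 d+γ+2) hs hs1.le hr
  have e4 : ‖1-qq s (cz R θ)‖^(-(γ+2)) ≤ (‖ww s (cz R θ)‖/‖1+ww s (cz R θ)‖)^(-(γ+2)) := by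
    have hw := ww_re_pos hs hs1.le hr
    have hW : 0 < ‖ww s (cz R θ)‖ := norm_pos_iff.2 (fun h => by rw [h] at hw; simp at hw)
    have hP := (norm_one_add_ge hw).1
    rw [norm_one_sub_qq hs hs1.le hr]
    refine rpow_le_rpow_of_nonpos 𝔭 ?_ 𝔩
    gcongr; linarith
  rw [e1, mul_one, e2, ← ofReal_norm (pref _ _ _), e3]
  calc _ ≤ 𝔬 (exp 2)*(𝔬 (‖1-cz R θ‖^(-δ))*(𝔬 ((‖1+zt (cz R θ)‖/‖1+ww s (cz R θ)‖)^(β+𝔡 d+γ+2)) * (𝔬 (C*(‖ww s (cz R θ)‖/‖1+ww s (cz R θ)‖)^(-(γ+2)))*V))) := by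
        refine mul_le_mul_right (mul_le_mul_right (mul_le_mul_right (hF.trans ?_) _) _) _
        refine mul_le_mul_left (ENNReal.ofReal_le_ofReal (mul_le_mul_of_nonneg_left e4 hC)) _
    _ = _ := by
        simp only [← mul_assoc]
        congr 1
        rw [← ENNReal.ofReal_mul 𝔭, ← ENNReal.ofReal_mul 𝔭, ← ENNReal.ofReal_mul 𝔭]
        congr 1; ring

theorem bigK (d : ℕ) (hd : 2 ≤ d) {β γ δ κ : ℝ} (hβ : -(1/2) ≤ β) (hγ : -1 < γ) (hκ : 0 ≤ κ) (hκ1 : κ ≤ 1/4) (hκ2 : 2*κ < γ+1)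
    (hδ : 2*κ < δ-(γ+((d:ℝ)-2)/2+3/2)) :
    ∃ C, 0 ≤ C ∧ ∀ n : ℕ, 2 ≤ n →
    ∫⁻ s in 𝔦, 𝔬 (s^(β+𝔡 d)*(1-s)^γ) * ∫⁻ ω in Ioo (0:ℝ) π,
      ‖∑ j ∈ 𝔯 (n+1), binomC (δ-1) (n-j)*KnV0 d β γ j 1 s (cos ω)‖ₑ *
        𝔬 (((1-cos ω)^κ+(1-s)^κ)*(sin ω)^(2*(((d:ℝ)-2)/2))) ≤ 𝔬 (C*(n:ℝ)^(δ-2*κ)) := by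
  have hd' : (2:ℝ) ≤ d := by exact_mod_cast hd
  have hN : γ+1 < (⌊γ+1⌋₊+1 : ℕ) := by push_cast; exact Nat.lt_floor_add_one _
  generalize ⌊γ+1⌋₊+1 = N at hN
  obtain ⟨C1, hC1, H1⟩ := K_pt d hd (δ := δ) hβ hγ hN
  generalize hα : β+𝔡 d = α at *
  generalize hl : ((d:ℝ)-2)/2 = l at *
  have hl0 : 0 ≤ l := by linarith
  have hαl : l ≤ α := by linarith
  obtain ⟨C2, hC2, H2⟩ := Vint_bound hl0 hγ hκ hκ1 hκ2 hN
  obtain ⟨C3, hC3, H3⟩ := sixA hαl hγ hl0 hκ hκ1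
  obtain ⟨C4, hC4, H4⟩ := theta_int (m := δ-(𝔴 γ l)-2*κ) 𝔩
  refine ⟨C1*C2*C3*C4, by positivity, ?_⟩
  intro n hn
  have hn' : (2:ℝ) ≤ n := by exact_mod_cast hn
  have hn1 : 1/(n:ℝ) ≤ 1/2 := one_div_le_one_div_of_le (by norm_num) hn'
  have hn0 : 0 < 1/(n:ℝ) := by positivity
  have K := H1 n hn
  have hR0 : 1/2 ≤ 1-1/(n:ℝ) := by linarith
  have hR1 : 1-1/(n:ℝ) < 1 := by linarith
  have hnR : (n:ℝ)^(δ-2*κ) = (1-(1-1/(n:ℝ)))^(-(𝔴 γ l))*(1-(1-1/(n:ℝ)))^(-(δ-(𝔴 γ l)-2*κ)) := by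
    rw [sub_sub_cancel, one_div, ← rpow_add 𝔭, inv_rpow 𝔭, ← rpow_neg 𝔭]
    congr 1; ring
  rw [hnR]
  generalize hRe : 1-1/(n:ℝ) = R at *
  have hrn : ∀ θ, ‖cz R θ‖ = R := fun θ => norm_cz 𝔩 θ
  have hr : ∀ θ, ‖cz R θ‖ < 1 := fun θ => by rw [hrn]; exact hR1
  set G : ℝ → ℝ → ℝ := fun s θ => C1*(‖1-cz R θ‖^(-δ)*((‖1+zt (cz R θ)‖/‖1+ww s (cz R θ)‖)^(α+γ+2)
        *(‖ww s (cz R θ)‖/‖1+ww s (cz R θ)‖)^(-(γ+2)))) with hG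
  set Q : ℝ → ℝ → ℝ := fun s ω => ((1-cos ω)^κ+(1-s)^κ)*(sin ω)^(2*l) with hQ
  have mc := cz_meas R
  have mz : Measurable (fun θ => zt (cz R θ)) := zt_meas.comp mc
  have mw : Measurable (fun p : ℝ × ℝ => ww p.1 (cz R p.2)) := ww_meas.comp (measurable_fst.prodMk (mc.comp measurable_snd))
  have mX : Measurable (fun p : ℝ × ℝ => XX p.1 (cz R p.2)) := XX_meas.comp (measurable_fst.prodMk (mc.comp measurable_snd))
  have mz2 : Measurable (fun p : ℝ × ℝ => zt (cz R p.2)) := mz.comp measurable_snd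
  have mw1 : ∀ s, Measurable (fun θ => ww s (cz R θ)) := fun s => mw.comp (measurable_const.prodMk measurable_id)
  have mX1 : ∀ s, Measurable (fun θ => XX s (cz R θ)) := fun s => mX.comp (measurable_const.prodMk measurable_id)
  have step1 : ∀ s ∈ 𝔦, 𝔬 (s^α*(1-s)^γ) * ∫⁻ ω in Ioo (0:ℝ) π,
      ‖∑ j ∈ 𝔯 (n+1), binomC (δ-1) (n-j)*KnV0 d β γ j 1 s (cos ω)‖ₑ * 𝔬 (Q s ω) ≤
      ∫⁻ θ in Ioc (-π) π, 𝔬 (C1*C2*‖1-cz R θ‖^(-δ)) * 𝔬 (s^α*((1-s)^γ*Mr α γ l κ ‖1+zt (cz R θ)‖ ‖1+ww s (cz R θ)‖ ‖ww s (cz R θ)‖ ‖1-XX s (cz R θ)‖ (1-‖XX s (cz R θ)‖) (1-s))) := by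
    intro s hs
    have h1s : 0 < 1-s := by linarith [hs.2]
    have hs0 := hs.1
    have hXs : ∀ θ, ‖XX s (cz R θ)‖ < 1 := fun θ => (norm_XX_le hs.1 hs.2.le (hr θ)).trans_lt (hr θ)
    calc _ ≤ 𝔬 (s^α*(1-s)^γ) * ∫⁻ ω in Ioo (0:ℝ) π, ∫⁻ θ in Ioc (-π) π, 𝔬 (G s θ)*Vint γ l N ω (XX s (cz R θ)) * 𝔬 (Q s ω) := by
          refine mul_le_mul_right ?_ _
          apply lintegral_mono
          intro ω
          refine (mul_le_mul_left (K s ω hs.1 hs.2) _).trans ?_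
          exact (lintegral_mul_const' _ _ ENNReal.ofReal_ne_top).ge
      _ = 𝔬 (s^α*(1-s)^γ) * ∫⁻ θ in Ioc (-π) π, ∫⁻ ω in Ioo (0:ℝ) π, 𝔬 (G s θ)*Vint γ l N ω (XX s (cz R θ)) * 𝔬 (Q s ω) := by
          rw [lintegral_lintegral_swap]
          apply Measurable.aemeasurable
          have m1 : Measurable (fun p : ℝ × ℝ => Vint γ l N p.1 (XX s (cz R p.2))) := Vint_meas γ l N measurable_fst ((mX1 s).comp measurable_snd)
          have m2 : Measurable (fun p : ℝ × ℝ => G s p.2) := by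
            have : Measurable (G s) := by
              have := mw1 s
              rw [hG]; fun_prop
            exact this.comp measurable_snd
          have m3 : Measurable (fun p : ℝ × ℝ => Q s p.1) := by rw [hQ]; fun_prop
          exact ((m2.ennreal_ofReal).mul m1).mul m3.ennreal_ofReal
      _ ≤ 𝔬 (s^α*(1-s)^γ) * ∫⁻ θ in Ioc (-π) π, 𝔬 (G s θ)*𝔬 (C2*(‖1-XX s (cz R θ)‖^(l+1/2)*(1-‖XX s (cz R θ)‖)^(-(𝔴 γ l))*(‖1-XX s (cz R θ)‖^(2*κ)+(1-s)^κ))) := by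
          refine mul_le_mul_right ?_ _
          apply lintegral_mono
          intro θ
          simp only [mul_assoc]
          rw [lintegral_const_mul' _ _ ENNReal.ofReal_ne_top]
          refine mul_le_mul_right ?_ _
          have := H2 (XX s (cz R θ)) ((1-s)^κ) (hXs θ) 𝔭
          simpa only [mul_assoc] using this
      _ = _ := by
          rw [← lintegral_const_mul' _ _ ENNReal.ofReal_ne_top]
          congr 1
          ext θ
          have := hXs θ
          have h1X : 0 < 1-‖XX s (cz R θ)‖ := by linarith
          have g0 : 0 ≤ G s θ := by rw [hG]; positivity
          rw [← ENNReal.ofReal_mul 𝔭, ← ENNReal.ofReal_mul 𝔭, ← ENNReal.ofReal_mul 𝔭]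
          congr 1
          rw [hG, Mr]; ring
  calc _ ≤ ∫⁻ s in 𝔦, ∫⁻ θ in Ioc (-π) π, 𝔬 (C1*C2*‖1-cz R θ‖^(-δ)) * 𝔬 (s^α*((1-s)^γ*Mr α γ l κ ‖1+zt (cz R θ)‖ ‖1+ww s (cz R θ)‖ ‖ww s (cz R θ)‖ ‖1-XX s (cz R θ)‖ (1-‖XX s (cz R θ)‖) (1-s))) :=
        setLIntegral_mono' measurableSet_Ioo step1
    _ = ∫⁻ θ in Ioc (-π) π, ∫⁻ s in 𝔦, 𝔬 (C1*C2*‖1-cz R θ‖^(-δ)) * 𝔬 (s^α*((1-s)^γ*Mr α γ l κ ‖1+zt (cz R θ)‖ ‖1+ww s (cz R θ)‖ ‖ww s (cz R θ)‖ ‖1-XX s (cz R θ)‖ (1-‖XX s (cz R θ)‖) (1-s))) := by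
        rw [lintegral_lintegral_swap]
        apply Measurable.aemeasurable
        have m1 : Measurable (fun p : ℝ × ℝ => p.1^α*((1-p.1)^γ*Mr α γ l κ ‖1+zt (cz R p.2)‖ ‖1+ww p.1 (cz R p.2)‖ ‖ww p.1 (cz R p.2)‖ ‖1-XX p.1 (cz R p.2)‖ (1-‖XX p.1 (cz R p.2)‖) (1-p.1))) := by
          unfold Mr; fun_prop
        have m2 : Measurable (fun p : ℝ × ℝ => C1*C2*‖1-cz R p.2‖^(-δ)) := by fun_prop
        exact m2.ennreal_ofReal.mul m1.ennreal_ofReal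
    _ ≤ ∫⁻ θ in Ioc (-π) π, 𝔬 (C1*C2*‖1-cz R θ‖^(-δ)) * 𝔬 (C3*(‖1-cz R θ‖^(γ+l+1/2+2*κ)*(1-‖cz R θ‖)^(-(𝔴 γ l)))) := by
        apply lintegral_mono
        intro θ
        simp only
        rw [lintegral_const_mul' _ _ ENNReal.ofReal_ne_top]
        exact mul_le_mul_right (H3 (cz R θ) (by rw [hrn]; exact hR0) (hr θ)) _
    _ = ∫⁻ θ in Ioc (-π) π, 𝔬 (C1*C2*C3*(1-R)^(-(𝔴 γ l))) * 𝔬 (‖1-cz R θ‖^(-(δ-(𝔴 γ l)-2*κ+1))) := by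
        congr 1
        ext θ
        have hε : 0 < 1-R := by linarith
        rw [hrn, ← ENNReal.ofReal_mul 𝔭, ← ENNReal.ofReal_mul 𝔭]
        congr 1
        have : 0 < ‖1-cz R θ‖ := norm_pos_iff.2 (one_sub_ne (hr θ))
        rw [show -(δ-(𝔴 γ l)-2*κ+1) = -δ+(γ+l+1/2+2*κ) by ring, rpow_add this (-δ)]
        generalize (1-R)^(-(𝔴 γ l)) = q1
        generalize ‖1-cz R θ‖^(γ+l+1/2+2*κ) = q2
        generalize ‖1-cz R θ‖^(-δ) = q3
        ring
    _ ≤ 𝔬 (C1*C2*C3*(1-R)^(-(𝔴 γ l))) * 𝔬 (C4*(1-R)^(-(δ-(𝔴 γ l)-2*κ))) := by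
        rw [lintegral_const_mul' _ _ ENNReal.ofReal_ne_top]
        exact mul_le_mul_right (H4 R hR0 hR1) _
    _ = _ := by
        have hε : 0 < 1-R := by linarith
        rw [← ENNReal.ofReal_mul 𝔭]
        congr 1; ring

theorem binomC_lower {δ : ℝ} (hδ : 0 < δ) : ∃ c, 0 < c ∧ ∀ᶠ n : ℕ in atTop, c*(n:ℝ)^δ ≤ binomC δ n := by
  have h := GammaSeq_tendsto_Gamma δ
  have hΓ := Gamma_pos_of_pos hδ
  refine ⟨(2*Gamma δ*δ)⁻¹, by positivity, ?_⟩
  filter_upwards [h.eventually (gt_mem_nhds (show Gamma δ < 2*Gamma δ by linarith)), eventually_gt_atTop 0] with n hn hn0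
  have hn' : 0 < (n:ℝ) := by exact_mod_cast hn0
  have hp := poch_pos hδ (n+1)
  have e1 : GammaSeq δ n = (n:ℝ)^δ*n.factorial/poch δ (n+1) := by
    unfold GammaSeq; rfl
  have e2 := poch_succ_left δ n
  rw [e1, div_lt_iff₀ hp, e2] at hn
  have hf : 0 < (n.factorial:ℝ) := by positivity
  unfold binomC
  rw [le_div_iff₀ hf, mul_assoc, inv_mul_le_iff₀ 𝔭]
  linarith

theorem polar_lint {E : Type*} [NormedAddCommGroup E] [NormedSpace ℝ E] [FiniteDimensional ℝ E] [Nontrivial E]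
    [MeasurableSpace E] [BorelSpace E] (μ : Measure E) [μ.IsAddHaarMeasure] {F : E → ℝ≥0∞} (hF : Measurable F) :
    ∫⁻ x, F x ∂μ = ∫⁻ η : Metric.sphere (0:E) 1, (∫⁻ r in Ioi (0:ℝ), 𝔬 (r^(Module.finrank ℝ E-1)) * F (r • (η:E))) ∂μ.toSphere := by
  have h1 : ∫⁻ x, F x ∂μ = ∫⁻ x : ({0}ᶜ : Set E), F x ∂(μ.comap (↑)) := by
    rw [lintegral_subtype_comap (measurableSet_singleton _).compl, restrict_compl_singleton]
  have h2 := (μ.measurePreserving_homeomorphUnitSphereProd).lintegral_comp_emb (Homeomorph.measurableEmbedding _)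
    (fun p : Metric.sphere (0:E) 1 × Ioi (0:ℝ) => F ((p.2:ℝ) • (p.1:E)))
  have h3 : ∀ x : ({0}ᶜ : Set E), F (((homeomorphUnitSphereProd E x).2:ℝ) • ((homeomorphUnitSphereProd E x).1:E)) = F x := by
    intro x
    congr 1
    exact congrArg Subtype.val ((homeomorphUnitSphereProd E).symm_apply_apply x)
  simp only [h3] at h2
  rw [h1, h2, lintegral_prod _ (by fun_prop)]
  congr 1; ext η
  rw [Measure.volumeIoiPow, lintegral_withDensity_eq_lintegral_mul _ (by fun_prop) (by fun_prop),
    ← lintegral_subtype_comap measurableSet_Ioi]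
  rfl

theorem euc_split (k : ℕ) {F : ℝ → ℝ → ℝ≥0∞} (hF : Measurable (Function.uncurry F)) :
    ∫⁻ x : Euc (k+1), F (x 0) ‖x‖ = ∫⁻ a : ℝ, ∫⁻ y : Euc k, F a (√(a^2+‖y‖^2)) := by
  have e2 := (volume_preserving_piFinSuccAbove (fun _ : Fin (k+1) => ℝ) 0)
  have m1 : Measurable (fun p : ℝ × (Fin k → ℝ) => F p.1 (√(p.1^2+∑ i, p.2 i^2))) :=
    hF.comp (f := fun p : ℝ × (Fin k → ℝ) => (p.1, √(p.1^2+∑ i, p.2 i^2))) (by fun_prop)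
  have m2 : Measurable (fun v : Fin (k+1) → ℝ => F (v 0) (√(∑ i, v i^2))) :=
    hF.comp (f := fun v : Fin (k+1) → ℝ => (v 0, √(∑ i, v i^2))) (by fun_prop)
  have a1 := (PiLp.volume_preserving_ofLp (Fin (k+1))).lintegral_comp m2
  have a2 := e2.lintegral_comp m1
  calc ∫⁻ x : Euc (k+1), F (x 0) ‖x‖
    _ = ∫⁻ v : Fin (k+1) → ℝ, F (v 0) (√(∑ i, v i^2)) := by
        rw [← a1]; congr 1; ext x; rw [EuclideanSpace.norm_eq]; simp
    _ = ∫⁻ p : ℝ × (Fin k → ℝ), F p.1 (√(p.1^2+∑ i, p.2 i^2)) := by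
        refine Eq.trans ?_ a2
        congr 1; ext v
        rw [Fin.sum_univ_succ]
        rfl
    _ = _ := by
        rw [Measure.volume_eq_prod, lintegral_prod _ m1.aemeasurable]
        congr 1; ext a
        refine Eq.trans ((PiLp.volume_preserving_ofLp (Fin k)).lintegral_comp (m1.comp (by fun_prop : Measurable fun v : Fin k → ℝ => (a,v)))).symm ?_
        simp only [Function.comp_def]
        congr 1; ext y
        rw [EuclideanSpace.norm_eq, sq_sqrt 𝔭]
        simp

theorem sphere_reflect (d : ℕ) (ξ e : Euc d) (h1 : ‖ξ‖ = 1) (h2 : ‖e‖ = 1) {F : ℝ → ℝ → ℝ≥0∞} :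
    ∫⁻ x : Euc d, F ⟪ξ,x⟫ ‖x‖ = ∫⁻ x : Euc d, F ⟪e,x⟫ ‖x‖ := by
  set R := Submodule.reflection (Submodule.span ℝ {ξ - e})ᗮ with hR
  have hr : R ξ = e := by rw [hR]; exact Submodule.reflection_sub (by rw [h1,h2])
  rw [← (R.measurePreserving).lintegral_comp_emb R.toHomeomorph.measurableEmbedding (fun x => F ⟪e,x⟫ ‖x‖)]
  congr 1; ext x
  rw [← hr, LinearIsometryEquiv.inner_map_map, LinearIsometryEquiv.norm_map]

theorem zonal_aux (k : ℕ) {g : ℝ → ℝ≥0∞} (hg : Measurable g) (w : ℝ → ℝ≥0∞) (hw : Measurable w) :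
    ∫⁻ a : ℝ, ∫⁻ ρ in Ioi (0:ℝ), 𝔬 (ρ^k) * (g (a/√(a^2+ρ^2)) * w (√(a^2+ρ^2))) =
      (∫⁻ r in Ioi (0:ℝ), 𝔬 (r^(k+1)) * w r) * ∫⁻ θ in Ioo (0:ℝ) π, g (cos θ) * 𝔬 (sin θ^k) := by
  set f : ℝ × ℝ → ℝ≥0∞ := fun p => (Ioi (0:ℝ)).indicator (fun ρ => 𝔬 (ρ^k) * (g (p.1/√(p.1^2+ρ^2)) * w (√(p.1^2+ρ^2)))) p.2 with hf
  have mf : Measurable f := by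
    have : f = (Prod.snd ⁻¹' (Ioi (0:ℝ))).indicator (fun p : ℝ × ℝ => 𝔬 (p.2^k) * (g (p.1/√(p.1^2+p.2^2)) * w (√(p.1^2+p.2^2)))) := by
      ext p; simp [hf, Set.indicator]
    rw [this]
    exact Measurable.indicator (by fun_prop) (measurable_snd measurableSet_Ioi)
  have h1 : ∫⁻ a : ℝ, ∫⁻ ρ in Ioi (0:ℝ), 𝔬 (ρ^k) * (g (a/√(a^2+ρ^2)) * w (√(a^2+ρ^2))) = ∫⁻ p, f p := by
    rw [Measure.volume_eq_prod, lintegral_prod _ mf.aemeasurable]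
    congr 1; ext a
    rw [← lintegral_indicator measurableSet_Ioi]
  rw [h1, ← lintegral_comp_polarCoord_symm, polarCoord_target, Measure.volume_eq_prod, ← Measure.prod_restrict,
    lintegral_prod _ (by
      apply Measurable.aemeasurable
      have : Measurable (polarCoord.symm : ℝ × ℝ → ℝ × ℝ) := by
        change Measurable (fun p : ℝ × ℝ => (p.1*cos p.2, p.1*sin p.2))
        fun_prop
      fun_prop)]
  rw [← lintegral_mul_const _ (by fun_prop)]
  refine setLIntegral_congr_fun measurableSet_Ioi (fun r hr => ?_)
  have hr : 0 < r := hr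
  have h2 : ∀ θ ∈ Ioo (-π) π, 𝔬 r • f (polarCoord.symm (r,θ)) =
      (Ioo 0 π).indicator (fun θ => (𝔬 (r^(k+1)) * w r) * (g (cos θ) * 𝔬 (sin θ^k))) θ := by
    intro θ hθ
    rw [polarCoord_symm_apply]
    simp only [hf]
    by_cases h0 : 0 < θ
    · have hs := sin_pos_of_pos_of_lt_pi h0 hθ.2
      have hsq : √((r*cos θ)^2+(r*sin θ)^2) = r := by
        rw [show (r*cos θ)^2+(r*sin θ)^2 = r^2*(sin θ^2+cos θ^2) by ring, sin_sq_add_cos_sq, mul_one, sqrt_sq hr.le]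
      rw [Set.indicator_of_mem (by exact mul_pos hr hs), Set.indicator_of_mem (show θ ∈ Ioo 0 π from ⟨h0,hθ.2⟩), hsq, mul_div_cancel_left₀ _ hr.ne', mul_pow,
        pow_succ, ENNReal.ofReal_mul 𝔭, ENNReal.ofReal_mul 𝔭, smul_eq_mul]
      ring
    · have hs := sin_nonpos_of_nonpos_of_neg_pi_le (not_lt.1 h0) hθ.1.le
      rw [Set.indicator_of_notMem (by rw [mem_Ioi, not_lt]; exact mul_nonpos_of_nonneg_of_nonpos hr.le hs), Set.indicator_of_notMem (fun h => h0 h.1), smul_zero]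
  rw [setLIntegral_congr_fun measurableSet_Ioo h2, lintegral_indicator measurableSet_Ioo, Measure.restrict_restrict measurableSet_Ioo,
    lintegral_const_mul _ (by fun_prop)]
  congr 3
  exact Set.inter_eq_left.2 (Ioo_subset_Ioo_left (by linarith [pi_pos]))

theorem zonal_nat (k : ℕ) : ∃ C : ℝ≥0∞, C ≠ 0 ∧ C ≠ ⊤ ∧ ∀ (ξ : Euc (k+2)), ‖ξ‖ = 1 → ∀ g : ℝ → ℝ≥0∞, Measurable g →
    ∫⁻ η, g ⟪ξ,(η:Euc (k+2))⟫ ∂(sphMeas (k+2)) = C * ∫⁻ θ in Ioo (0:ℝ) π, g (cos θ) * 𝔬 (sin θ^k) := by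
  refine ⟨(volume : Measure (Euc (k+1))).toSphere univ, ?_, measure_ne_top _ _, ?_⟩
  · rw [Ne, Measure.measure_univ_eq_zero]; exact Measure.toSphere_ne_zero _
  intro ξ hξ g hg
  set w : ℝ → ℝ≥0∞ := (Iio (1:ℝ)).indicator (fun _ => 1) with hwd
  have hw : Measurable w := measurable_const.indicator measurableSet_Iio
  set W := ∫⁻ r in Ioi (0:ℝ), 𝔬 (r^(k+1)) * w r with hW
  have hWe : W = ∫⁻ r in 𝔦, 𝔬 (r^(k+1)) := by
    rw [hW, ← Ioi_inter_Iio, inter_comm, ← Measure.restrict_restrict measurableSet_Iio, ← lintegral_indicator measurableSet_Iio]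
    congr 1; ext r; simp only [hwd, Set.indicator]; split_ifs <;> simp
  have hW0 : W ≠ 0 := by
    rw [hWe]
    refine (setLIntegral_pos_iff (by fun_prop)).2 ?_ |>.ne'
    have : Function.support (fun r : ℝ => 𝔬 (r^(k+1))) ∩ Ioo 0 1 = Ioo 0 1 := by
      refine inter_eq_right.2 fun r hr => ?_
      have := hr.1
      simp only [Function.mem_support, Ne, ENNReal.ofReal_eq_zero, not_le]; positivity
    rw [this]; simp
  have hWt : W ≠ ⊤ := by
    rw [hWe]
    refine ne_top_of_le_ne_top (b := ∫⁻ r in 𝔦, 1) (by simp) ?_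
    refine setLIntegral_mono' measurableSet_Ioo (fun x hx => ?_)
    rw [← ENNReal.ofReal_one]
    exact ENNReal.ofReal_le_ofReal (pow_le_one₀ hx.1.le hx.2.le)
  set F : ℝ → ℝ → ℝ≥0∞ := fun a r => g (a/r) * w r with hF
  have mF : Measurable (Function.uncurry F) := by
    change Measurable (fun p : ℝ × ℝ => g (p.1/p.2)*w p.2)
    fun_prop
  have e1 : ∫⁻ x : Euc (k+2), F ⟪ξ,x⟫ ‖x‖ = (∫⁻ η, g ⟪ξ,(η:Euc (k+2))⟫ ∂(sphMeas (k+2))) * W := by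
    refine Eq.trans (polar_lint volume (mF.comp (f := fun x : Euc (k+2) => (⟪ξ,x⟫, ‖x‖)) (by fun_prop))) ?_
    rw [sphMeas, ← lintegral_mul_const _ (by fun_prop)]
    congr 1; ext η
    rw [hW, ← lintegral_const_mul _ (by fun_prop)]
    refine setLIntegral_congr_fun measurableSet_Ioi (fun r hr => ?_)
    have hr : 0 < r := hr
    have hη : ‖(η:Euc (k+2))‖ = 1 := by simp
    simp only [Function.comp_def, Function.uncurry, hF]
    rw [inner_smul_right, norm_smul, hη, mul_one, norm_of_nonneg hr.le, mul_div_cancel_left₀ _ hr.ne', finrank_euclideanSpace_fin]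
    simp only [Nat.add_sub_cancel, show k+2-1 = k+1 by omega]
    ring
  have e2 : ∫⁻ x : Euc (k+2), F ⟪ξ,x⟫ ‖x‖ = ((volume : Measure (Euc (k+1))).toSphere univ) * (W * ∫⁻ θ in Ioo (0:ℝ) π, g (cos θ) * 𝔬 (sin θ^k)) := by
    rw [sphere_reflect (k+2) ξ (EuclideanSpace.single 0 1) hξ (by simp)]
    simp only [EuclideanSpace.inner_single_left, map_one, one_mul]
    rw [euc_split (k+1) mF, ← zonal_aux k hg w hw, ← lintegral_const_mul]
    · congr 1; ext a
      refine Eq.trans (polar_lint volume (mF.comp (f := fun y : Euc (k+1) => (a, √(a^2+‖y‖^2))) (by fun_prop))) ?_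
      have : ∀ η : Metric.sphere (0:Euc (k+1)) 1, ∫⁻ r in Ioi (0:ℝ), 𝔬 (r^(Module.finrank ℝ (Euc (k+1))-1)) *
          ((Function.uncurry F ∘ fun y : Euc (k+1) => (a, √(a^2+‖y‖^2))) (r • (η:Euc (k+1)))) =
          ∫⁻ ρ in Ioi (0:ℝ), 𝔬 (ρ^k) * (g (a/√(a^2+ρ^2)) * w (√(a^2+ρ^2))) := by
        intro η
        refine setLIntegral_congr_fun measurableSet_Ioi (fun r hr => ?_)
        have hη : ‖(η:Euc (k+1))‖ = 1 := by simp
        simp only [Function.comp_def, Function.uncurry, hF]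
        rw [norm_smul, hη, mul_one, norm_eq_abs, sq_abs, finrank_euclideanSpace_fin, Nat.add_sub_cancel]
      refine Eq.trans (lintegral_congr this) ?_
      rw [lintegral_const, mul_comm]
    · refine Measurable.lintegral_prod_right' (f := fun p : ℝ × ℝ => 𝔬 (p.2^k) * (g (p.1/√(p.1^2+p.2^2)) * w (√(p.1^2+p.2^2)))) ?_
      fun_prop
  rw [e1, mul_left_comm, mul_comm] at e2
  exact (ENNReal.mul_right_inj hW0 hWt).1 e2

theorem zonal (d : ℕ) (hd : 2 ≤ d) : ∃ C : ℝ≥0∞, C ≠ 0 ∧ C ≠ ⊤ ∧ (∀ (ξ : Euc d), ‖ξ‖ = 1 → ∀ g : ℝ → ℝ≥0∞, Measurable g →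
    ∫⁻ η, g ⟪ξ,(η:Euc d)⟫ ∂(sphMeas d) = C * ∫⁻ θ in Ioo (0:ℝ) π, g (cos θ) * 𝔬 (sin θ^(2*(((d:ℝ)-2)/2)))) ∧
    (∀ (ξ : Euc d), ‖ξ‖ = 1 → ∀ g : ℝ → ℝ, Continuous g →
    ∫ η, g ⟪ξ,(η:Euc d)⟫ ∂(sphMeas d) = C.toReal * ∫ θ in Ioo (0:ℝ) π, g (cos θ) * sin θ^(2*(((d:ℝ)-2)/2))) := by
  obtain ⟨k, rfl⟩ := Nat.exists_eq_add_of_le' hd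
  obtain ⟨C, h0, h1, h2⟩ := zonal_nat k
  have e : ∀ x : ℝ, x^(2*((((k+2:ℕ):ℝ)-2)/2)) = x^k := by
    intro x; rw [← rpow_natCast]; congr 1; push_cast; ring
  simp only [e]
  refine ⟨C, h0, h1, h2, ?_⟩
  intro ξ hξ g hg
  set ν : Measure ℝ := (volume.restrict (Ioo (0:ℝ) π)).withDensity (fun θ => 𝔬 (sin θ^k)) with hν
  have hm : (sphMeas (k+2)).map (fun η : Metric.sphere (0:Euc (k+2)) 1 => ⟪ξ,(η:Euc (k+2))⟫) = C • ν.map cos := by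
    ext s hs
    have h3 := h2 ξ hξ (s.indicator 1) (measurable_one.indicator hs)
    rw [Measure.map_apply (by fun_prop) hs, Measure.smul_apply, Measure.map_apply (by fun_prop) hs, smul_eq_mul,
      ← lintegral_indicator_one (by measurability), ← lintegral_indicator_one (continuous_cos.measurable hs), hν,
      lintegral_withDensity_eq_lintegral_mul _ (by fun_prop) (measurable_one.indicator (continuous_cos.measurable hs))]
    refine Eq.trans h3 ?_
    congr 2
    ext θ
    rw [mul_comm]; rfl
  rw [← integral_map (φ := fun η : Metric.sphere (0:Euc (k+2)) 1 => ⟪ξ,(η:Euc (k+2))⟫) (f := g) (by fun_prop) (by fun_prop), hm, integral_smul_measure,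
    integral_map (by fun_prop) (by fun_prop), hν, integral_withDensity_eq_integral_toReal_smul (by fun_prop) (by simp), smul_eq_mul]
  congr 1
  refine setIntegral_congr_fun measurableSet_Ioo (fun θ hθ => ?_)
  have := sin_pos_of_pos_of_lt_pi hθ.1 hθ.2
  simp only [smul_eq_mul]
  rw [ENNReal.toReal_ofReal 𝔭, mul_comm]

theorem chu (n : ℕ) (b c : ℝ) (hc : 0 < c) : ∑ j ∈ 𝔯 (n+1), ((n.choose j : ℕ):ℝ) * ((-1)^j * poch b j / poch c j) = poch (c-b) n / poch c n := by
  rw [← vandermonde n b c, Finset.sum_div]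
  refine Finset.sum_congr rfl fun j hj => ?_
  have hj' : j ≤ n := by simpa [Nat.lt_succ_iff] using hj
  have h := poch_add c j (n-j)
  rw [show j+(n-j) = n by omega] at h
  have h1 := poch_pos hc j
  have h2 := poch_pos (show 0 < c+j by positivity) (n-j)
  rw [h]
  field_simp

theorem usin_int (k j : ℕ) : ∫ θ in (0:ℝ)..π, ((1-cos θ)/2)^j * sin θ^k =
    poch (((k:ℝ)+1)/2) j / poch ((k:ℝ)+1) j * ∫ θ in (0:ℝ)..π, sin θ^k := by
  induction j with
  | zero => simp [poch_zero]
  | succ j ih =>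
    have hd : ∀ θ ∈ uIcc 0 π, HasDerivAt (fun θ => ((1-cos θ)/2)^j * sin θ^(k+1))
      (((2*j+k+1:ℝ)*(((1-cos θ)/2)^j * sin θ^k)) - (2*j+2*k+2)*(((1-cos θ)/2)^(j+1) * sin θ^k)) θ := by
      intro θ _
      have h1 : HasDerivAt (fun θ => (1-cos θ)/2) (sin θ/2) θ := by
        have := ((hasDerivAt_cos θ).const_sub 1).div_const 2
        simpa using this
      have h2 := (h1.pow j).mul ((hasDerivAt_sin θ).pow (k+1))
      refine h2.congr_deriv ?_
      have hs : sin θ^2 = 4*((1-cos θ)/2)*(1-(1-cos θ)/2) := by nlinarith [sin_sq_add_cos_sq θ]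
      have hc : cos θ = 1-2*((1-cos θ)/2) := by ring
      simp only [Pi.pow_apply]
      rw [Nat.add_sub_cancel]
      generalize (1-cos θ)/2 = u at *
      rw [pow_succ (sin θ) k]
      rcases j with _ | j
      · rw [hc]; simp; ring
      · rw [Nat.add_sub_cancel]
        have : (((j+1:ℕ):ℝ) * u^j * (sin θ/2)) * (sin θ^k*sin θ) = ((j:ℝ)+1)*u^j*sin θ^k*(sin θ^2)/2 := by push_cast; ring
        rw [this, hs, hc]
        push_cast; ring
    have h := intervalIntegral.integral_eq_sub_of_hasDerivAt hd (by apply Continuous.intervalIntegrable; fun_prop)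
    rw [intervalIntegral.integral_sub (by apply Continuous.intervalIntegrable; fun_prop) (by apply Continuous.intervalIntegrable; fun_prop),
      intervalIntegral.integral_const_mul, intervalIntegral.integral_const_mul, ih] at h
    simp only [sin_pi, sin_zero, zero_pow (Nat.succ_ne_zero k), mul_zero, sub_zero] at h
    rw [poch_succ, poch_succ]
    have p1 := poch_pos (show 0 < (k:ℝ)+1 by positivity) j
    have p2 : 0 < (k:ℝ)+1+j := by positivity
    generalize poch ((k:ℝ)+1) j = A at *
    generalize poch (((k:ℝ)+1)/2) j = B at *
    generalize (∫ θ in (0:ℝ)..π, ((1-cos θ)/2)^(j+1) * sin θ^k) = J at *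
    generalize (∫ θ in (0:ℝ)..π, sin θ^k) = I at *
    field_simp at h ⊢
    linarith

theorem Zm_int (k m : ℕ) (hm : 1 ≤ m) : ∫ θ in (0:ℝ)..π, Zm ((k:ℝ)/2) m (cos θ) * sin θ^k = 0 := by
  rcases Nat.eq_zero_or_pos k with rfl | hk
  · have : ∀ θ : ℝ, Zm (((0:ℕ):ℝ)/2) m (cos θ) * sin θ^0 = 2*cos (m*θ) := by
      intro θ
      have := Polynomial.Chebyshev.T_real_cos θ m
      simp [Zm, show m ≠ 0 by omega] at this ⊢
    simp only [this]
    have hm' : (m:ℝ) ≠ 0 := by positivity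
    rw [intervalIntegral.integral_const_mul, intervalIntegral.integral_comp_mul_left _ hm', integral_cos]
    simp
  · have hl : 0 < (k:ℝ)/2 := by positivity
    simp only [Zm_eq_aux _ hl]
    have e : ∀ θ : ℝ, (∑ j ∈ 𝔯 (m+1), (((j+(m-j):ℕ)+(k:ℝ)/2)/((k:ℝ)/2) * poch (2*((k:ℝ)/2)) (2*j+(m-j)) / (poch ((k:ℝ)/2+1/2) j * ((m-j).factorial:ℝ)))
      * ((-((1-cos θ)/2))^j / (j.factorial:ℝ)))*sin θ^k = ∑ j ∈ 𝔯 (m+1), ((((m:ℝ)+(k:ℝ)/2)/((k:ℝ)/2) * poch (k:ℝ) (m+j) / (poch (((k:ℝ)+1)/2) j * ((m-j).factorial:ℝ)))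
      * ((-1)^j / (j.factorial:ℝ))) * (((1-cos θ)/2)^j*sin θ^k) := by
      intro θ
      rw [Finset.sum_mul]
      refine Finset.sum_congr rfl fun j hj => ?_
      have hj' : j ≤ m := by simpa [Nat.lt_succ_iff] using hj
      rw [show j+(m-j) = m by omega, show 2*j+(m-j) = m+j by omega, neg_pow, show 2*((k:ℝ)/2) = k by ring, show (k:ℝ)/2+1/2 = (k+1)/2 by ring]
      ring
    simp only [e]
    rw [intervalIntegral.integral_finsetSum (fun j _ => by apply Continuous.intervalIntegrable; fun_prop)]
    simp only [intervalIntegral.integral_const_mul, usin_int]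
    have hk' : (0:ℝ) < k := by positivity
    have hc := chu m ((k:ℝ)+m) ((k:ℝ)+1) 𝔭
    have hz : poch ((k:ℝ)+1-(k+m)) m = 0 := by
      obtain ⟨r, rfl⟩ := Nat.exists_eq_add_of_le' hm
      rw [poch_succ]
      push_cast; ring
    rw [hz, zero_div] at hc
    generalize (∫ θ in (0:ℝ)..π, sin θ^k) = I
    have : ∀ j ∈ 𝔯 (m+1), ((((m:ℝ)+(k:ℝ)/2)/((k:ℝ)/2) * poch (k:ℝ) (m+j) / (poch (((k:ℝ)+1)/2) j * ((m-j).factorial:ℝ)))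
      * ((-1)^j / (j.factorial:ℝ))) * (poch (((k:ℝ)+1)/2) j / poch ((k:ℝ)+1) j * I) =
      (((m:ℝ)+(k:ℝ)/2)/((k:ℝ)/2)*poch (k:ℝ) m*I/(m.factorial:ℝ)) * (((m.choose j : ℕ):ℝ) * ((-1)^j * poch ((k:ℝ)+m) j / poch ((k:ℝ)+1) j)) := by
      intro j hj
      have hj' : j ≤ m := by simpa [Nat.lt_succ_iff] using hj
      rw [poch_add, Nat.cast_choose ℝ hj']
      have p1 := poch_pos (show 0 < ((k:ℝ)+1)/2 by positivity) j
      have p2 := poch_pos (show 0 < ((k:ℝ)+1) by positivity) j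
      generalize poch (((k:ℝ)+1)/2) j = A at *
      generalize poch ((k:ℝ)+1) j = B at *
      generalize poch ((k:ℝ)+m) j = D at *
      generalize poch (k:ℝ) m = E at *
      field_simp
    rw [Finset.sum_congr rfl this, ← Finset.mul_sum, hc, mul_zero]

theorem kco_int (α γ : ℝ) (hα : -1 < α) (hγ : -1 < γ) (n : ℕ) :
    ∫ s in 𝔦, s^α*(1-s)^γ * kco α γ 0 n s = Gamma (α+1)*Gamma (γ+1)/Gamma (α+γ+2) := by
  have e : ∀ s ∈ 𝔦, s^α*(1-s)^γ * kco α γ 0 n s = ∑ j ∈ 𝔯 (n+1), ((-1)^(n-j) * poch (α+γ+2) (n+j) /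
    (poch (α+1) j * (j.factorial:ℝ) * ((n-j).factorial:ℝ))) * (s^(α+1+j-1)*(1-s)^(γ+1-1)) := by
    intro s hs
    rw [kco, Finset.mul_sum]
    refine Finset.sum_congr rfl fun j hj => ?_
    rw [show α+1+j-1 = α+j by ring, rpow_add hs.1, rpow_natCast, show γ+1-1 = γ by ring, zero_add, zero_add]
    ring
  rw [setIntegral_congr_fun measurableSet_Ioo e, integral_finsetSum _ (fun j _ => (beta_integrable (by linarith [(j.cast_nonneg : (0:ℝ) ≤ j)]) 𝔩).const_mul _)]
  simp only [integral_const_mul]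
  have hc := chu n (α+γ+2+n) (α+γ+2) 𝔩
  rw [show α+γ+2-(α+γ+2+n) = -(n:ℝ) by ring, poch_neg_nat n n le_rfl] at hc
  have p0 := poch_pos (show 0 < α+γ+2 by linarith) n
  have g1 := Gamma_pos_of_pos (show 0 < α+γ+2 by linarith)
  have : ∀ j ∈ 𝔯 (n+1), ((-1)^(n-j) * poch (α+γ+2) (n+j) /
    (poch (α+1) j * (j.factorial:ℝ) * ((n-j).factorial:ℝ))) * ∫ s in 𝔦, (s^(α+1+j-1)*(1-s)^(γ+1-1)) =
    (Gamma (α+1)*Gamma (γ+1)/Gamma (α+γ+2) * ((-1)^n*poch (α+γ+2) n/(n.factorial:ℝ))) * (((n.choose j : ℕ):ℝ) * ((-1)^j * poch (α+γ+2+n) j / poch (α+γ+2) j)) := by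
    intro j hj
    have hj' : j ≤ n := by simpa [Nat.lt_succ_iff] using hj
    rw [beta_integral (by linarith [(j.cast_nonneg : (0:ℝ) ≤ j)]) 𝔩, show α+1+j+(γ+1) = α+γ+2+j by ring,
      Gamma_add_nat _ 𝔩, Gamma_add_nat _ 𝔩, poch_add, Nat.cast_choose ℝ hj']
    have hp : (-1:ℝ)^(n-j) = (-1)^n*(-1)^j := by
      rw [← pow_add, show n+j = (n-j)+2*j by omega, pow_add, pow_mul]; simp
    rw [hp]
    have p1 := poch_pos (show 0 < α+1 by linarith) j
    have p2 := poch_pos (show 0 < α+γ+2 by linarith) j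
    generalize poch (α+1) j = A at *
    generalize poch (α+γ+2) j = B at *
    generalize poch (α+γ+2+n) j = D at *
    generalize poch (α+γ+2) n = E at *
    generalize Gamma (α+1) = G1 at *
    generalize Gamma (γ+1) = G2 at *
    generalize Gamma (α+γ+2) = G3 at *
    field_simp
  rw [Finset.sum_congr rfl this, ← Finset.mul_sum, hc]
  generalize poch (α+γ+2) n = E at *
  generalize Gamma (α+1) = G1 at *
  generalize Gamma (γ+1) = G2 at *
  generalize Gamma (α+γ+2) = G3 at *
  have : (-1:ℝ)^n*(-1)^n = 1 := by rw [← pow_add, ← two_mul, pow_mul]; simp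
  simp
  field_simp
  linear_combination (G1*G2)*this

theorem Zm_cont (l : ℝ) (m : ℕ) : Continuous (Zm l m) := by
  unfold Zm
  by_cases h : l = 0
  · by_cases h2 : m = 0
    · simp only [h, h2, if_true]; fun_prop
    · simp only [h, h2, if_true, if_false]; exact (Polynomial.continuous _).const_mul _ 
  · simp only [h, if_false]
    unfold jacobiP
    fun_prop

theorem kco_cont (α γ : ℝ) (m N : ℕ) : Continuous (kco α γ m N) := by
  unfold kco; fun_prop

theorem KnV0_cont (d : ℕ) (hd : 2 ≤ d) (β γ : ℝ) (hβ : -(1/2) ≤ β) (hγ : -1 < γ) (n : ℕ) :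
    Continuous (fun p : ℝ × ℝ => KnV0 d β γ n 1 p.1 p.2) := by
  simp only [KnV0_eq d hd β γ hβ hγ]
  refine continuous_finsetSum _ fun m _ => ?_
  exact (((kco_cont _ _ _ _).comp continuous_fst).mul (by fun_prop)).mul ((Zm_cont _ _).comp continuous_snd)

theorem KnV0Ces_cont (d : ℕ) (hd : 2 ≤ d) (β γ δ : ℝ) (hβ : -(1/2) ≤ β) (hγ : -1 < γ) (n : ℕ) :
    Continuous (fun p : ℝ × ℝ => KnV0Ces d β γ δ n 1 p.1 p.2) := by
  unfold KnV0Ces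
  exact continuous_const.mul (continuous_finsetSum _ fun m _ => continuous_const.mul (KnV0_cont d hd β γ hβ hγ m))

theorem binomC_sum (δ : ℝ) (n : ℕ) : ∑ m ∈ 𝔯 (n+1), binomC (δ-1) (n-m) = binomC δ n := by
  have hr := Finset.sum_range_reflect (fun m => binomC (δ-1) m) (n+1)
  simp only [Nat.add_sub_cancel] at hr
  rw [hr]; clear hr
  induction n with
  | zero => simp [binomC, poch_zero]
  | succ n ih =>
    rw [Finset.sum_range_succ, ih]
    unfold binomC
    rw [show δ-1+1 = δ by ring, poch_succ_left δ n, poch_succ (δ+1), Nat.factorial_succ]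
    push_cast
    field_simp
    ring

theorem Zm_sph (d : ℕ) (hd : 2 ≤ d) (ξ : Euc d) (hξ : ‖ξ‖ = 1) (m : ℕ) :
    ∫ η, Zm (((d:ℝ)-2)/2) m ⟪ξ,(η:Euc d)⟫ ∂(sphMeas d) = if m = 0 then (sphMeas d univ).toReal else 0 := by
  split_ifs with h
  · subst h; simp [Zm_zero, measureReal_def]
  · obtain ⟨C, -, -, -, h2⟩ := zonal d hd
    rw [h2 ξ hξ _ (Zm_cont _ _)]
    obtain ⟨k, rfl⟩ := Nat.exists_eq_add_of_le' hd
    have e : ∀ x : ℝ, x^(2*((((k+2:ℕ):ℝ)-2)/2)) = x^k := by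
      intro x; rw [← rpow_natCast]; congr 1; push_cast; ring
    have := Zm_int k m (by omega)
    rw [intervalIntegral.integral_of_le pi_pos.le, integral_Ioc_eq_integral_Ioo] at this
    simp only [e]
    rw [show (((k+2:ℕ):ℝ)-2)/2 = (k:ℝ)/2 by push_cast; ring, this, mul_zero]

instance sph_fin (d : ℕ) : IsFiniteMeasure (sphMeas d) := by unfold sphMeas; infer_instance

theorem sph_pos (d : ℕ) (hd : 2 ≤ d) : 0 < (sphMeas d univ).toReal := by
  refine ENNReal.toReal_pos ?_ (measure_ne_top _ _)
  obtain ⟨k, rfl⟩ := Nat.exists_eq_add_of_le' hd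
  rw [Ne, Measure.measure_univ_eq_zero]; exact Measure.toSphere_ne_zero _

theorem Ces_sph (d : ℕ) (hd : 2 ≤ d) (β γ δ : ℝ) (hβ : -(1/2) ≤ β) (hγ : -1 < γ) (ξ : Euc d) (hξ : ‖ξ‖ = 1) (n : ℕ) (s : ℝ) :
    ∫ η, KnV0Ces d β γ δ n 1 s ⟪ξ,(η:Euc d)⟫ ∂(sphMeas d) =
     (sphMeas d univ).toReal * ((binomC δ n)⁻¹ * ∑ m ∈ 𝔯 (n+1), binomC (δ-1) (n-m) * kco (β+𝔡 d) γ 0 m s) := by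
  have hint : ∀ m, Integrable (fun η : Metric.sphere (0:Euc d) 1 => Zm (((d:ℝ)-2)/2) m ⟪ξ,(η:Euc d)⟫) (sphMeas d) := fun m =>
    Continuous.integrable_of_hasCompactSupport ((Zm_cont _ _).comp (by fun_prop)) (HasCompactSupport.of_compactSpace _)
  have h1 : ∀ m, ∫ η, KnV0 d β γ m 1 s ⟪ξ,(η:Euc d)⟫ ∂(sphMeas d) = (sphMeas d univ).toReal * kco (β+𝔡 d) γ 0 m s := by
    intro m
    simp only [KnV0_eq d hd β γ hβ hγ]
    rw [integral_finsetSum _ (fun j _ => (hint j).const_mul _)]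
    simp only [integral_const_mul, Zm_sph d hd ξ hξ]
    rw [Finset.sum_range_succ']
    simp
    ring
  unfold KnV0Ces
  rw [integral_const_mul, integral_finsetSum]
  · simp only [integral_const_mul, h1]
    rw [mul_left_comm, Finset.mul_sum, Finset.mul_sum, Finset.mul_sum]
    refine Finset.sum_congr rfl fun j _ => ?_
    ring
  · intro m _
    refine Integrable.const_mul ?_ _
    exact Continuous.integrable_of_hasCompactSupport ((KnV0_cont d hd β γ hβ hγ m).comp (f := fun η : Metric.sphere (0:Euc d) 1 => (s, ⟪ξ,(η:Euc d)⟫)) (by fun_prop)) (HasCompactSupport.of_compactSpace _)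

theorem wt_int {α γ : ℝ} (hα : -1 < α) (hγ : -1 < γ) {g : ℝ → ℝ} (hg : Continuous g) :
    IntegrableOn (fun s => s^α*(1-s)^γ*g s) (Ioo 0 1) := by
  have h := beta_integrable (show 0 < α+1 by linarith) (show 0 < γ+1 by linarith)
  simp only [add_sub_cancel_right] at h
  rw [← integrableOn_Icc_iff_integrableOn_Ioo] at h ⊢
  exact h.mul_continuousOn hg.continuousOn isCompact_Icc

theorem Ces_norm (d : ℕ) (hd : 2 ≤ d) (β γ δ : ℝ) (hβ : -(1/2) ≤ β) (hγ : -1 < γ) (hδ : 0 < δ) (ξ : Euc d) (hξ : ‖ξ‖ = 1) (n : ℕ) :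
    ∫ s in 𝔦, s^(β+𝔡 d)*(1-s)^γ * ∫ η, KnV0Ces d β γ δ n 1 s ⟪ξ,(η:Euc d)⟫ ∂(sphMeas d) =
     (sphMeas d univ).toReal * (Gamma (β+𝔡 d+1)*Gamma (γ+1)/Gamma (β+𝔡 d+γ+2)) := by
  have hd' : (2:ℝ) ≤ d := by exact_mod_cast hd
  have hα : -1 < β+𝔡 d := by linarith
  simp only [Ces_sph d hd β γ δ hβ hγ ξ hξ]
  generalize β+𝔡 d = α at *
  have e : ∀ s : ℝ, s^α*(1-s)^γ * ((sphMeas d univ).toReal * ((binomC δ n)⁻¹ * ∑ m ∈ 𝔯 (n+1), binomC (δ-1) (n-m) * kco α γ 0 m s)) =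
     ((sphMeas d univ).toReal * (binomC δ n)⁻¹) * ∑ m ∈ 𝔯 (n+1), binomC (δ-1) (n-m) * (s^α*(1-s)^γ * kco α γ 0 m s) := by
    intro s
    rw [show ∀ a b c e : ℝ, a*(b*(c*e)) = (b*c)*(a*e) by intros; ring, Finset.mul_sum]
    congr 1
    refine Finset.sum_congr rfl fun j _ => ?_
    ring
  simp only [e]
  rw [integral_const_mul, integral_finsetSum _ (fun m _ => (wt_int hα hγ (kco_cont _ _ _ _)).const_mul _)]
  simp only [integral_const_mul, kco_int α γ hα hγ]
  rw [← Finset.sum_mul, binomC_sum]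
  have : 0 < binomC δ n := by
    unfold binomC; have := poch_pos (show 0 < δ+1 by linarith) n; positivity
  field_simp

theorem bV0_eq (d : ℕ) (hd : 2 ≤ d) (β γ : ℝ) (hβ : -(1/2) ≤ β) (hγ : -1 < γ) :
    bV0 d β γ = ((sphMeas d univ).toReal * (Gamma (β+𝔡 d+1)*Gamma (γ+1)/Gamma (β+𝔡 d+γ+2)))⁻¹ := by
  have hd' : (2:ℝ) ≤ d := by exact_mod_cast hd
  unfold bV0 V0Int wt
  rw [intervalIntegral.integral_of_le zero_le_one, integral_Ioc_eq_integral_Ioo]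
  congr 1
  have h := beta_integral (a := β+𝔡 d+1) (b := γ+1) 𝔩 𝔩
  rw [show β+𝔡 d+γ+2 = β+𝔡 d+1+(γ+1) by ring, ← h, ← integral_const_mul]
  refine setIntegral_congr_fun measurableSet_Ioo (fun s hs => ?_)
  simp only [integral_const, smul_eq_mul, measureReal_def, add_sub_cancel_right]
  rw [rpow_add hs.1]
  ring

theorem bV0_pos (d : ℕ) (hd : 2 ≤ d) (β γ : ℝ) (hβ : -(1/2) ≤ β) (hγ : -1 < γ) : 0 < bV0 d β γ := by
  have hd' : (2:ℝ) ≤ d := by exact_mod_cast hd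
  rw [bV0_eq d hd β γ hβ hγ]
  have h0 := sph_pos d hd
  have h1 := Gamma_pos_of_pos (show 0 < β+𝔡 d+1 by linarith)
  have h2 := Gamma_pos_of_pos (show 0 < γ+1 by linarith)
  have h3 := Gamma_pos_of_pos (show 0 < β+𝔡 d+γ+2 by linarith)
  positivity

theorem kerBound (d : ℕ) (hd : 2 ≤ d) {β γ δ κ : ℝ} (hβ : -(1/2) ≤ β) (hγ : -1 < γ) (hκ : 0 ≤ κ) (hκ1 : κ ≤ 1/4) (hκ2 : 2*κ < γ+1)
    (hδ : 2*κ < δ-(γ+((d:ℝ)-2)/2+3/2)) (hδ0 : 0 < δ) :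
    ∃ C, 0 ≤ C ∧ ∀ᶠ n : ℕ in atTop, ∀ ξ : Euc d, ‖ξ‖ = 1 →
    ∫⁻ s in 𝔦, 𝔬 (s^(β+𝔡 d)*(1-s)^γ) * ∫⁻ η,
      ‖KnV0Ces d β γ δ n 1 s ⟪ξ,(η:Euc d)⟫‖ₑ * 𝔬 ((1-⟪ξ,(η:Euc d)⟫)^κ+(1-s)^κ) ∂(sphMeas d) ≤ 𝔬 (C*(n:ℝ)^(-(2*κ))) := by
  obtain ⟨C1, hC1, H1⟩ := bigK d hd hβ hγ hκ hκ1 hκ2 hδ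
  obtain ⟨c, hc, H2⟩ := binomC_lower hδ0
  obtain ⟨Z, hZ0, hZt, hZ, -⟩ := zonal d hd
  refine ⟨Z.toReal*(c⁻¹*C1), by positivity, ?_⟩
  filter_upwards [H2, eventually_ge_atTop 2] with n hn hn2 ξ hξ
  have hn0 : (0:ℝ) < n := by positivity
  have hb : 0 < binomC δ n := lt_of_lt_of_le 𝔭 hn
  have hn' : ((binomC δ n)⁻¹) ≤ c⁻¹*(n:ℝ)^(-δ) := by
    rw [rpow_neg hn0.le, ← mul_inv]
    exact inv_anti₀ 𝔭 hn
  have e : ∀ s ∈ 𝔦, 𝔬 (s^(β+𝔡 d)*(1-s)^γ) * ∫⁻ η,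
      ‖KnV0Ces d β γ δ n 1 s ⟪ξ,(η:Euc d)⟫‖ₑ * 𝔬 ((1-⟪ξ,(η:Euc d)⟫)^κ+(1-s)^κ) ∂(sphMeas d) =
      (Z * 𝔬 ((binomC δ n)⁻¹)) * (𝔬 (s^(β+𝔡 d)*(1-s)^γ) * ∫⁻ ω in Ioo (0:ℝ) π,
      ‖∑ j ∈ 𝔯 (n+1), binomC (δ-1) (n-j)*KnV0 d β γ j 1 s (cos ω)‖ₑ *
        𝔬 (((1-cos ω)^κ+(1-s)^κ)*(sin ω)^(2*(((d:ℝ)-2)/2)))) := by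
    intro s hs
    have hm : Measurable fun c : ℝ => ‖KnV0Ces d β γ δ n 1 s c‖ₑ :=
      ((KnV0Ces_cont d hd β γ δ hβ hγ n).comp (f := fun c : ℝ => (s,c)) (by fun_prop)).measurable.enorm
    have h := hZ ξ hξ (fun c => ‖KnV0Ces d β γ δ n 1 s c‖ₑ * 𝔬 ((1-c)^κ+(1-s)^κ)) (hm.mul (by fun_prop))
    rw [h]
    have h2 : ∫⁻ θ in Ioo (0:ℝ) π, ‖KnV0Ces d β γ δ n 1 s (cos θ)‖ₑ * 𝔬 ((1-cos θ)^κ+(1-s)^κ) * 𝔬 (sin θ^(2*(((d:ℝ)-2)/2))) =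
       𝔬 ((binomC δ n)⁻¹) * ∫⁻ ω in Ioo (0:ℝ) π,
      ‖∑ j ∈ 𝔯 (n+1), binomC (δ-1) (n-j)*KnV0 d β γ j 1 s (cos ω)‖ₑ *
        𝔬 (((1-cos ω)^κ+(1-s)^κ)*(sin ω)^(2*(((d:ℝ)-2)/2))) := by
      rw [← lintegral_const_mul' _ _ ENNReal.ofReal_ne_top]
      refine setLIntegral_congr_fun measurableSet_Ioo (fun θ hθ => ?_)
      have h1 : 0 ≤ 1-cos θ := by linarith [cos_le_one θ]
      have h3 : 0 ≤ 1-s := by linarith [hs.2]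
      rw [KnV0Ces, enorm_mul, ENNReal.ofReal_mul 𝔭, enorm_of_nonneg 𝔭]
      ring
    rw [h2]
    ring
  rw [setLIntegral_congr_fun measurableSet_Ioo e, lintegral_const_mul' _ _ (ENNReal.mul_ne_top hZt ENNReal.ofReal_ne_top)]
  calc _ ≤ (Z * 𝔬 (c⁻¹*(n:ℝ)^(-δ))) * 𝔬 (C1*(n:ℝ)^(δ-2*κ)) := by
        gcongr
        exact H1 n hn2
    _ = 𝔬 (Z.toReal*(c⁻¹*C1)*(n:ℝ)^(-(2*κ))) := by
        rw [← ENNReal.ofReal_toReal hZt, ← ENNReal.ofReal_mul 𝔭, ← ENNReal.ofReal_mul 𝔭,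
          ENNReal.toReal_ofReal 𝔭, show -(2*κ) = -δ+(δ-2*κ) by ring, rpow_add hn0]
        congr 1; ring

theorem V0_compact (d : ℕ) : IsCompact (V0set d) := by
  refine (isCompact_closedBall (0:Euc d) 1 |>.prod (isCompact_Icc (a := (0:ℝ)) (b := 1))).of_isClosed_subset ?_ ?_
  · unfold V0set
    exact (isClosed_eq (f := fun q : Euc d × ℝ => ‖q.1‖^2) (g := fun q => q.2) (by fun_prop) (by fun_prop)).inter (isClosed_le (f := fun q : Euc d × ℝ => q.2) (g := fun _ => 1) (by fun_prop) (by fun_prop))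
  · rintro ⟨x, t⟩ ⟨h1, h2⟩
    simp only at h1 h2
    have : ‖x‖ ≤ 1 := by nlinarith [norm_nonneg x]
    refine ⟨by simpa using this, ?_, h2⟩
    simp only; rw [← h1]; positivity

theorem mem_V0 {d : ℕ} {η : Euc d} (hη : ‖η‖ = 1) {s : ℝ} (h0 : 0 ≤ s) (h1 : s ≤ 1) : (√s • η, s) ∈ V0set d := by
  refine ⟨?_, h1⟩
  simp only
  rw [norm_smul, hη, mul_one, norm_eq_abs, sq_abs, sq_sqrt h0]

theorem modulus (d : ℕ) (f : Euc d × ℝ → ℝ) (hf : ContinuousOn f (V0set d)) {κ : ℝ} (hκ : 0 < κ) {ε : ℝ} (hε : 0 < ε) :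
    ∃ A, 0 ≤ A ∧ ∀ ξ η : Euc d, ‖ξ‖ = 1 → ‖η‖ = 1 → ∀ s ∈ 𝔦,
      |f (√s • η, s) - f (ξ,1)| ≤ ε + A*((1-⟪ξ,η⟫)^κ+(1-s)^κ) := by
  obtain ⟨M, hM⟩ := (V0_compact d).exists_bound_of_continuousOn hf
  have huc := (V0_compact d).uniformContinuousOn_of_continuous hf
  rw [Metric.uniformContinuousOn_iff] at huc
  obtain ⟨r, hr, H⟩ := huc ε hε
  set τ := min r (r^2/3) with hτ
  have hτ0 : 0 < τ := by positivity
  refine ⟨2*|M| /τ^κ, by positivity, ?_⟩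
  intro ξ η hξ hη s hs
  have hc : ⟪ξ,η⟫ ≤ 1 := by simpa [hξ, hη] using real_inner_le_norm ξ η
  have hc0 : 0 ≤ 1-⟪ξ,η⟫ := by linarith
  have hs0 : 0 ≤ 1-s := by linarith [hs.2]
  have m1 := mem_V0 hη hs.1.le hs.2.le
  have m2 : (ξ,(1:ℝ)) ∈ V0set d := by simpa using mem_V0 hξ zero_le_one le_rfl
  by_cases h : dist ((√s • η, s) : Euc d × ℝ) (ξ,1) < r
  · have := H _ m1 _ m2 h
    rw [dist_eq] at this
    have : 0 ≤ 2*|M| /τ^κ*((1-⟪ξ,η⟫)^κ+(1-s)^κ) := by positivity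
    linarith
  · have h1 : |f (√s • η, s) - f (ξ,1)| ≤ 2*|M| := by
      have a := hM _ m1
      have b := hM _ m2
      rw [norm_eq_abs] at a b
      have := abs_sub (f (√s • η, s)) (f (ξ,1))
      linarith [le_abs_self M]
    have h2 : τ ≤ 1-s ∨ τ ≤ 1-⟪ξ,η⟫ := by
      by_contra hcon
      push Not at hcon
      obtain ⟨c1, c2⟩ := hcon
      apply h
      have q1 := min_le_left r (r^2/3)
      have q2 := min_le_right r (r^2/3)
      rw [Prod.dist_eq, max_lt_iff]
      refine ⟨?_, ?_⟩
      · rw [dist_eq_norm]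
        refine lt_of_pow_lt_pow_left₀ 2 hr.le ?_
        rw [norm_sub_sq_real, norm_smul, hη, hξ, inner_smul_left, real_inner_comm, mul_one, norm_eq_abs, sq_abs, sq_sqrt hs.1.le]
        simp only [conj_trivial]
        have s1 := sqrt_nonneg s
        have s2 : √s ≤ 1 := sqrt_le_one.2 hs.2.le
        have s3 := sq_sqrt hs.1.le
        have s4 : √s*(1-⟪ξ,η⟫) ≤ 1-⟪ξ,η⟫ := by nlinarith
        nlinarith
      · rw [dist_eq, abs_sub_comm, abs_of_nonneg hs0]; linarith
    have h3 : τ^κ ≤ (1-⟪ξ,η⟫)^κ+(1-s)^κ := by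
      have a1 : 0 ≤ (1-⟪ξ,η⟫)^κ := by positivity
      have a2 : 0 ≤ (1-s)^κ := by positivity
      rcases h2 with h2 | h2
      · have := rpow_le_rpow hτ0.le h2 hκ.le; linarith
      · have := rpow_le_rpow hτ0.le h2 hκ.le; linarith
    have h4 : 0 < τ^κ := by positivity
    have h5 : 2*|M| ≤ 2*|M| /τ^κ*((1-⟪ξ,η⟫)^κ+(1-s)^κ) := by
      calc 2*|M| = 2*|M| /τ^κ*τ^κ := by field_simp
        _ ≤ _ := by gcongr
    linarith

theorem Phi_cont (d : ℕ) {F : Euc d × ℝ → ℝ} (hF : ContinuousOn F (V0set d)) {K : ℝ × ℝ → ℝ} (hK : Continuous K) (ξ : Euc d) :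
    ∃ G : ℝ → ℝ, Continuous G ∧ ∀ s ∈ 𝔦, ∫ η, F (√s • (η:Euc d), s) * K (s, ⟪ξ,(η:Euc d)⟫) ∂(sphMeas d) = G s := by
  refine ⟨fun s => ∫ η, F (√(max 0 (min s 1)) • (η:Euc d), max 0 (min s 1)) * K (max 0 (min s 1), ⟪ξ,(η:Euc d)⟫) ∂(sphMeas d), ?_, ?_⟩
  · have hc : Continuous (Function.uncurry (fun (s : ℝ) (η : Metric.sphere (0:Euc d) 1) => F (√(max 0 (min s 1)) • (η:Euc d), max 0 (min s 1)) * K (max 0 (min s 1), ⟪ξ,(η:Euc d)⟫))) := by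
      refine Continuous.mul (f := fun p : ℝ × Metric.sphere (0:Euc d) 1 => F (√(max 0 (min p.1 1)) • (p.2:Euc d), max 0 (min p.1 1))) (g := fun p => K (max 0 (min p.1 1), ⟪ξ,(p.2:Euc d)⟫)) ?_ (hK.comp (by fun_prop))
      refine hF.comp_continuous (f := fun p : ℝ × Metric.sphere (0:Euc d) 1 => (√(max 0 (min p.1 1)) • (p.2:Euc d), max 0 (min p.1 1))) (by fun_prop) ?_
      intro p
      exact mem_V0 (by simp) (le_max_left _ _) (max_le zero_le_one (min_le_right _ _))
    have := continuous_parametric_integral_of_continuous (μ := sphMeas d) hc isCompact_univ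
    simpa using this
  · intro s hs
    simp only [min_eq_left hs.2.le, max_eq_right hs.1.le]

theorem Sn_diff (d : ℕ) (hd : 2 ≤ d) (β γ δ : ℝ) (hβ : -(1/2) ≤ β) (hγ : -1 < γ) (hδ : 0 < δ)
    (f : Euc d × ℝ → ℝ) (hf : ContinuousOn f (V0set d)) (ξ : Euc d) (hξ : ‖ξ‖ = 1) (n : ℕ) :
    SnV0Ces d β γ δ n f ξ 1 - f (ξ,1) = bV0 d β γ * ∫ s in 𝔦, s^(β+𝔡 d)*(1-s)^γ *
      ∫ η, (f (√s • (η:Euc d), s) - f (ξ,1)) * KnV0Ces d β γ δ n 1 s ⟪ξ,(η:Euc d)⟫ ∂(sphMeas d) := by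
  have hd' : (2:ℝ) ≤ d := by exact_mod_cast hd
  have hα : -1 < β+𝔡 d := by linarith
  have hb := bV0_pos d hd β γ hβ hγ
  have hbe := bV0_eq d hd β γ hβ hγ
  have hn := Ces_norm d hd β γ δ hβ hγ hδ ξ hξ n
  have hK := KnV0Ces_cont d hd β γ δ hβ hγ n
  obtain ⟨G1, hG1, e1⟩ := Phi_cont d hf hK ξ
  obtain ⟨G2, hG2, e2⟩ := Phi_cont d (F := fun _ => 1) continuousOn_const hK ξ
  simp only [one_mul] at e2
  have hS : SnV0Ces d β γ δ n f ξ 1 = bV0 d β γ * ∫ s in 𝔦, s^(β+𝔡 d)*(1-s)^γ * G1 s := by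
    rw [SnV0Ces, intervalIntegral.integral_of_le zero_le_one, integral_Ioc_eq_integral_Ioo]
    congr 1
    refine setIntegral_congr_fun measurableSet_Ioo (fun s hs => ?_)
    have := e1 s hs
    simp only at this ⊢
    rw [this, wt, rpow_add hs.1]
    ring
  have hF : f (ξ,1) = bV0 d β γ * ∫ s in 𝔦, s^(β+𝔡 d)*(1-s)^γ * (G2 s * f (ξ,1)) := by
    have : ∀ s ∈ 𝔦, s^(β+𝔡 d)*(1-s)^γ * (G2 s * f (ξ,1)) = 
        (s^(β+𝔡 d)*(1-s)^γ * ∫ η, KnV0Ces d β γ δ n 1 s ⟪ξ,(η:Euc d)⟫ ∂(sphMeas d)) * f (ξ,1) := by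
      intro s hs; rw [e2 s hs]; ring
    rw [setIntegral_congr_fun measurableSet_Ioo this, integral_mul_const, hn, ← mul_assoc]
    rw [hbe] at hb ⊢
    rw [inv_mul_cancel₀ (inv_pos.1 hb).ne', one_mul]
  rw [hS]
  nth_rw 1 [hF]
  rw [← mul_sub, ← integral_sub (wt_int hα hγ hG1) (wt_int hα hγ (hG2.mul_const _))]
  congr 1
  refine setIntegral_congr_fun measurableSet_Ioo (fun s hs => ?_)
  rw [← mul_sub, ← e1 s hs, ← e2 s hs]
  congr 1
  rw [mul_comm, ← integral_const_mul, ← integral_sub]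
  · congr 1; ext η; ring
  · refine Continuous.integrable_of_hasCompactSupport ?_ (HasCompactSupport.of_compactSpace _)
    refine Continuous.mul ?_ (hK.comp (f := fun η : Metric.sphere (0:Euc d) 1 => (s, ⟪ξ,(η:Euc d)⟫)) (by fun_prop))
    exact hf.comp_continuous (f := fun η : Metric.sphere (0:Euc d) 1 => (√s • (η:Euc d), s)) (by fun_prop) (fun η => mem_V0 (by simp) hs.1.le hs.2.le)
  · refine Continuous.integrable_of_hasCompactSupport ?_ (HasCompactSupport.of_compactSpace _)
    exact continuous_const.mul (hK.comp (f := fun η : Metric.sphere (0:Euc d) 1 => (s, ⟪ξ,(η:Euc d)⟫)) (by fun_prop))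

theorem Sn_est (d : ℕ) (hd : 2 ≤ d) {β γ δ κ ε A : ℝ} (hβ : -(1/2) ≤ β) (hγ : -1 < γ) (hδ : 0 < δ) (hε : 0 ≤ ε) (hA : 0 ≤ A)
    (f : Euc d × ℝ → ℝ) (hf : ContinuousOn f (V0set d)) (ξ : Euc d) (hξ : ‖ξ‖ = 1) (n : ℕ) 
    (H : ∀ η : Euc d, ‖η‖ = 1 → ∀ s ∈ 𝔦, |f (√s • η, s) - f (ξ,1)| ≤ ε + A*((1-⟪ξ,η⟫)^κ+(1-s)^κ))
    {B0 B1 : ℝ} (hB0 : 0 ≤ B0) (hB1 : 0 ≤ B1)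
    (h0 : ∫⁻ s in 𝔦, 𝔬 (s^(β+𝔡 d)*(1-s)^γ) * ∫⁻ η,
      ‖KnV0Ces d β γ δ n 1 s ⟪ξ,(η:Euc d)⟫‖ₑ * 𝔬 ((1-⟪ξ,(η:Euc d)⟫)^(0:ℝ)+(1-s)^(0:ℝ)) ∂(sphMeas d) ≤ 𝔬 B0)
    (h1 : ∫⁻ s in 𝔦, 𝔬 (s^(β+𝔡 d)*(1-s)^γ) * ∫⁻ η,
      ‖KnV0Ces d β γ δ n 1 s ⟪ξ,(η:Euc d)⟫‖ₑ * 𝔬 ((1-⟪ξ,(η:Euc d)⟫)^κ+(1-s)^κ) ∂(sphMeas d) ≤ 𝔬 B1) :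
    |SnV0Ces d β γ δ n f ξ 1 - f (ξ,1)| ≤ bV0 d β γ * (ε*B0+A*B1) := by
  have hb := bV0_pos d hd β γ hβ hγ
  have hK := KnV0Ces_cont d hd β γ δ hβ hγ n
  have mK : Measurable (fun p : ℝ × ℝ => ‖KnV0Ces d β γ δ n 1 p.1 p.2‖ₑ) := hK.measurable.enorm
  have hR : 0 ≤ bV0 d β γ * (ε*B0+A*B1) := by positivity
  rw [Sn_diff d hd β γ δ hβ hγ hδ f hf ξ hξ n, ← norm_eq_abs, ← ENNReal.ofReal_le_ofReal_iff hR, ofReal_norm, enorm_mul,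
    enorm_of_nonneg hb.le, ENNReal.ofReal_mul hb.le]
  refine mul_le_mul_right ?_ _
  refine (enorm_integral_le_lintegral_enorm _).trans ?_
  set g0 : ℝ → Metric.sphere (0:Euc d) 1 → ℝ≥0∞ := fun s η => ‖KnV0Ces d β γ δ n 1 s ⟪ξ,(η:Euc d)⟫‖ₑ * 𝔬 ((1-⟪ξ,(η:Euc d)⟫)^(0:ℝ)+(1-s)^(0:ℝ)) with hg0
  set g1 : ℝ → Metric.sphere (0:Euc d) 1 → ℝ≥0∞ := fun s η => ‖KnV0Ces d β γ δ n 1 s ⟪ξ,(η:Euc d)⟫‖ₑ * 𝔬 ((1-⟪ξ,(η:Euc d)⟫)^κ+(1-s)^κ) with hg1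
  have mk2 : Measurable (fun p : ℝ × Metric.sphere (0:Euc d) 1 => ‖KnV0Ces d β γ δ n 1 p.1 ⟪ξ,(p.2:Euc d)⟫‖ₑ) :=
    mK.comp (f := fun p : ℝ × Metric.sphere (0:Euc d) 1 => (p.1, ⟪ξ,(p.2:Euc d)⟫)) (by fun_prop)
  have mg0 : Measurable (Function.uncurry g0) := mk2.mul (by fun_prop)
  have mg1 : Measurable (Function.uncurry g1) := mk2.mul (by fun_prop)
  have mI0 : Measurable (fun s => ∫⁻ η, g0 s η ∂(sphMeas d)) := mg0.lintegral_prod_right'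
  have hpt : ∀ s ∈ 𝔦, ‖s^(β+𝔡 d)*(1-s)^γ *
      ∫ η, (f (√s • (η:Euc d), s) - f (ξ,1)) * KnV0Ces d β γ δ n 1 s ⟪ξ,(η:Euc d)⟫ ∂(sphMeas d)‖ₑ ≤
      𝔬 ε * (𝔬 (s^(β+𝔡 d)*(1-s)^γ) * ∫⁻ η, g0 s η ∂(sphMeas d)) +
      𝔬 A * (𝔬 (s^(β+𝔡 d)*(1-s)^γ) * ∫⁻ η, g1 s η ∂(sphMeas d)) := by
    intro s hs
    have hs0 : 0 < s := hs.1
    have hs1 : 0 < 1-s := by linarith [hs.2]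
    rw [enorm_mul, enorm_of_nonneg 𝔭, mul_left_comm, mul_left_comm (𝔬 A), ← mul_add]
    refine mul_le_mul_right ?_ _
    refine (enorm_integral_le_lintegral_enorm _).trans ?_
    have mg0s : Measurable (g0 s) := mg0.comp (f := fun η : Metric.sphere (0:Euc d) 1 => (s,η)) (by fun_prop)
    rw [← lintegral_const_mul' _ _ ENNReal.ofReal_ne_top, ← lintegral_const_mul' _ _ ENNReal.ofReal_ne_top, ← lintegral_add_left (mg0s.const_mul _)]
    refine lintegral_mono fun η => ?_
    have hη : ‖(η:Euc d)‖ = 1 := by simp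
    have hc : ⟪ξ,(η:Euc d)⟫ ≤ 1 := by simpa [hξ] using real_inner_le_norm ξ (η:Euc d)
    have hc0 : 0 ≤ 1-⟪ξ,(η:Euc d)⟫ := by linarith
    simp only [hg0, hg1]
    rw [enorm_mul, mul_left_comm, mul_left_comm (𝔬 A), ← mul_add, mul_comm ‖f _ - _‖ₑ]
    refine mul_le_mul_right ?_ _
    rw [← ENNReal.ofReal_mul hε, ← ENNReal.ofReal_mul hA, ← ENNReal.ofReal_add 𝔭 𝔭, ← ofReal_norm, norm_eq_abs]
    refine ENNReal.ofReal_le_ofReal ((H η hη s hs).trans ?_)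
    rw [rpow_zero, rpow_zero]
    linarith
  refine (setLIntegral_mono' measurableSet_Ioo hpt).trans ?_
  rw [lintegral_add_left (by fun_prop), lintegral_const_mul' _ _ ENNReal.ofReal_ne_top, lintegral_const_mul' _ _ ENNReal.ofReal_ne_top,
    ENNReal.ofReal_add 𝔭 𝔭, ENNReal.ofReal_mul hε, ENNReal.ofReal_mul hA]
  gcongr

/-- uniform convergence of the Cesàro means on the boundary circle `t = 1`
of the surface of the paraboloid, for `δ > β + γ + (d+2)/2`. -/
theorem stmt12 (d : ℕ) (hd : 2 ≤ d) (β γ δ : ℝ) (hβ : -(1/2) ≤ β) (hγ : -1 < γ)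
    (hδ : β + γ + ((d : ℝ) + 2)/2 < δ)
    (f : Euc d × ℝ → ℝ) (hf : ContinuousOn f (V0set d)) :
    TendstoUniformly
      (fun n (ξ : Metric.sphere (0 : Euc d) 1) => SnV0Ces d β γ δ n f (ξ : Euc d) 1)
      (fun ξ => f ((ξ : Euc d), 1)) atTop := by
  have hd' : (2:ℝ) ≤ d := by exact_mod_cast hd
  have hδ0 : 0 < δ := by linarith
  have hδe : 0 < δ-(γ+((d:ℝ)-2)/2+3/2) := by linarith
  obtain ⟨κ, hκ, hκ1, hκ2, hκ3⟩ : ∃ κ : ℝ, 0 < κ ∧ κ ≤ 1/4 ∧ 2*κ < γ+1 ∧ 2*κ < δ-(γ+((d:ℝ)-2)/2+3/2) := by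
    have h1 : 0 < γ+1 := by linarith
    refine ⟨min (1/4) (min ((γ+1)/4) ((δ-(γ+((d:ℝ)-2)/2+3/2))/4)), by positivity, min_le_left _ _, ?_, ?_⟩
    · have := (min_le_right (1/4) (min ((γ+1)/4) ((δ-(γ+((d:ℝ)-2)/2+3/2))/4))).trans (min_le_left _ _)
      linarith
    · have := (min_le_right (1/4) (min ((γ+1)/4) ((δ-(γ+((d:ℝ)-2)/2+3/2))/4))).trans (min_le_right _ _)
      linarith
  obtain ⟨C0, hC0, H0⟩ := kerBound d hd (κ := 0) hβ hγ le_rfl (by norm_num) 𝔩 𝔩 hδ0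
  obtain ⟨C1, hC1, H1⟩ := kerBound d hd hβ hγ hκ.le hκ1 hκ2 hκ3 hδ0
  have hb := bV0_pos d hd β γ hβ hγ
  generalize hbb : bV0 d β γ = b at hb
  rw [Metric.tendstoUniformly_iff]
  intro ε hε
  obtain ⟨A, hA, HA⟩ := modulus d f hf hκ (ε := ε/(2*(b*(C0+1)))) 𝔭
  have ht : Tendsto (fun n : ℕ => b*(A*(C1*(n:ℝ)^(-(2*κ))))) atTop (nhds 0) := by
    have := ((tendsto_rpow_neg_atTop (show 0 < 2*κ by linarith)).comp tendsto_natCast_atTop_atTop).const_mul (b*A*C1)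
    rw [mul_zero] at this
    refine this.congr fun n => ?_
    simp only [Function.comp]; ring
  filter_upwards [H0, H1, ht.eventually (gt_mem_nhds (show 0 < ε/2 by linarith))] with n h0 h1 h2 ξ
  have hξ : ‖(ξ:Euc d)‖ = 1 := by simp
  have k0 := h0 ξ hξ
  simp only [mul_zero, neg_zero, rpow_zero, mul_one] at k0
  have := Sn_est d hd hβ hγ hδ0 𝔭 hA f hf ξ hξ n (fun η hη s hs => HA ξ η hξ hη s hs) hC0 𝔭
    (by simpa only [rpow_zero] using k0) (h1 ξ hξ)
  rw [dist_comm, dist_eq]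
  refine this.trans_lt ?_
  rw [hbb, mul_add]
  have h3 : b*(ε/(2*(b*(C0+1)))*C0) ≤ ε/2 := by
    rw [show b*(ε/(2*(b*(C0+1)))*C0) = ε/2*(C0/(C0+1)) by field_simp]
    have : C0/(C0+1) ≤ 1 := by rw [div_le_one 𝔩]; linarith
    nlinarith
  linarith
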